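/- Fix an integer n ≥ 2 and a real number p ≥ 2n−1. Assume x₀ = y₀ = R > 0 and that λ_{1,p}(σ) < sup{λ_{1,p}(β) : β ∈ 𝒞}. Then there exists a simple curve α ∈ 𝒞 such that λ_{1,p}(α) = sup{λ_{1,p}(β) : β ∈ 𝒞}. -/

import Mathlib

open Set MeasureTheory Filter Topology

noncomputable section

/-- The closed quarter plane `P`. -/
def Pset : Set (ℝ × ℝ) := {z | 0 ≤ z.1 ∧ 0 ≤ z.2}

/-- The interior `P°` of the quarter plane. -/
def Pint : Set (ℝ × ℝ) := {z | 0 < z.1 ∧ 0 < z.2}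

/-- The boundary `∂P` of the quarter plane. -/
def Pbdry : Set (ℝ × ℝ) := {z | (0 ≤ z.1 ∧ 0 ≤ z.2) ∧ (z.1 = 0 ∨ z.2 = 0)}

/-- `F(x,y) = c_n x^(n-1) y^(n-1)`. -/
def Fvol (n : ℕ) (cn : ℝ) (z : ℝ × ℝ) : ℝ := cn * z.1 ^ (n - 1) * z.2 ^ (n - 1)

/-- Euclidean speed of a curve at `t`, computed with derivatives within `s`. -/
def gSpeedOn (s : Set ℝ) (α : ℝ → ℝ × ℝ) (t : ℝ) : ℝ :=
  Real.sqrt ((derivWithin (fun u => (α u).1) s t) ^ 2 + (derivWithin (fun u => (α u).2) s t) ^ 2)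

/-- Euclidean speed of a curve defined on `[0,1]`. -/
def gSpeed (α : ℝ → ℝ × ℝ) : ℝ → ℝ := gSpeedOn (Icc 0 1) α

/-- Euclidean length `L_g` of a curve on `[0,1]`. -/
def Lg (α : ℝ → ℝ × ℝ) : ℝ := ∫ t in (0:ℝ)..1, gSpeed α t

/-- The `h`-speed `|γ'|_h = F(γ) |γ'|_g`, with derivatives within `s`. -/
def hSpeedOn (n : ℕ) (cn : ℝ) (s : Set ℝ) (α : ℝ → ℝ × ℝ) (t : ℝ) : ℝ :=
  Fvol n cn (α t) * gSpeedOn s α t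

/-- The `h`-speed for curves defined on `[0,1)`. -/
def hSpeed (n : ℕ) (cn : ℝ) (α : ℝ → ℝ × ℝ) : ℝ → ℝ := hSpeedOn n cn (Ico 0 1) α

/-- The `h`-length `L_h` of a curve on `[0,1)`. -/
def Lh (n : ℕ) (cn : ℝ) (α : ℝ → ℝ × ℝ) : ℝ := ∫ t in (0:ℝ)..1, hSpeed n cn α t

/-- Numerator integrand of the `g`-Rayleigh quotient:
`|w'(t)|^p F(α t) |α'(t)|_g^(1-p)`. -/
def numG (n : ℕ) (cn p : ℝ) (s : Set ℝ) (α : ℝ → ℝ × ℝ) (w : ℝ → ℝ) (t : ℝ) : ℝ :=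
  |derivWithin w (Icc 0 1) t| ^ p * Fvol n cn (α t) * gSpeedOn s α t ^ (1 - p)

/-- Denominator integrand of the `g`-Rayleigh quotient:
`|w(t)|^p F(α t) |α'(t)|_g`. -/
def denG (n : ℕ) (cn p : ℝ) (s : Set ℝ) (α : ℝ → ℝ × ℝ) (w : ℝ → ℝ) (t : ℝ) : ℝ :=
  |w t| ^ p * Fvol n cn (α t) * gSpeedOn s α t

/-- First Dirichlet eigenvalue of the `p`-Laplacian along a curve, `g`-form:
infimum of the Rayleigh quotient over Lipschitz test functions on `[0,1]`
vanishing at `0` (with admissible, i.e. integrable with positive denominator,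
Rayleigh quotients). -/
def lambdaGOn (n : ℕ) (cn p : ℝ) (s : Set ℝ) (α : ℝ → ℝ × ℝ) : ℝ :=
  sInf {q | ∃ w : ℝ → ℝ, (∃ K, LipschitzOnWith K w (Icc 0 1)) ∧ w 0 = 0 ∧
    IntervalIntegrable (numG n cn p s α w) volume 0 1 ∧
    IntervalIntegrable (denG n cn p s α w) volume 0 1 ∧
    (0 < ∫ t in (0:ℝ)..1, denG n cn p s α w t) ∧
    q = (∫ t in (0:ℝ)..1, numG n cn p s α w t) / (∫ t in (0:ℝ)..1, denG n cn p s α w t)}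

/-- `λ_{1,p}` in the `g`-form for curves on `[0,1]`. -/
def lambdaG (n : ℕ) (cn p : ℝ) (α : ℝ → ℝ × ℝ) : ℝ := lambdaGOn n cn p (Icc 0 1) α

/-- Numerator integrand of the `h`-Rayleigh quotient on `[c,d]`:
`|w'(t)|^p F(γ t)^p |γ'(t)|_h^(1-p)`. -/
def numH (n : ℕ) (cn p c d : ℝ) (s : Set ℝ) (γ : ℝ → ℝ × ℝ) (w : ℝ → ℝ) (t : ℝ) : ℝ :=
  |derivWithin w (Icc c d) t| ^ p * Fvol n cn (γ t) ^ p * hSpeedOn n cn s γ t ^ (1 - p)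

/-- Denominator integrand of the `h`-Rayleigh quotient: `|w(t)|^p |γ'(t)|_h`. -/
def denH (n : ℕ) (cn p : ℝ) (s : Set ℝ) (γ : ℝ → ℝ × ℝ) (w : ℝ → ℝ) (t : ℝ) : ℝ :=
  |w t| ^ p * hSpeedOn n cn s γ t

/-- `λ_{1,p}` in the `h`-form for a curve on `[c,d)`, with test functions
Lipschitz on `[c,d]` vanishing at `c`. -/
def lambdaHOn (n : ℕ) (cn p c d : ℝ) (s : Set ℝ) (γ : ℝ → ℝ × ℝ) : ℝ :=
  sInf {q | ∃ w : ℝ → ℝ, (∃ K, LipschitzOnWith K w (Icc c d)) ∧ w c = 0 ∧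
    IntervalIntegrable (numH n cn p c d s γ w) volume c d ∧
    IntervalIntegrable (denH n cn p s γ w) volume c d ∧
    (0 < ∫ t in c..d, denH n cn p s γ w t) ∧
    q = (∫ t in c..d, numH n cn p c d s γ w t) / (∫ t in c..d, denH n cn p s γ w t)}

/-- `λ_{1,p}` in the `h`-form for curves on `[0,1)`. -/
def lambdaH (n : ℕ) (cn p : ℝ) (γ : ℝ → ℝ × ℝ) : ℝ :=
  lambdaHOn n cn p 0 1 (Ico 0 1) γ

/-- The class `𝒞` of `C¹` curves from `(x₀,y₀)` to the boundary, with constant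
speed, interior image on `[0,1)`, endpoint away from the origin, and meeting the
boundary orthogonally. -/
def MemC (x0 y0 : ℝ) (α : ℝ → ℝ × ℝ) : Prop :=
  ContDiffOn ℝ 1 α (Icc 0 1) ∧
  α 0 = (x0, y0) ∧
  (∀ t ∈ Ico (0:ℝ) 1, α t ∈ Pint) ∧
  α 1 ∈ Pbdry ∧ α 1 ≠ ((0 : ℝ), (0 : ℝ)) ∧
  (∀ t ∈ Icc (0:ℝ) 1, gSpeed α t = Lg α) ∧
  ((α 1).1 = 0 → derivWithin (fun u => (α u).2) (Icc 0 1) 1 = 0) ∧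
  ((α 1).2 = 0 → derivWithin (fun u => (α u).1) (Icc 0 1) 1 = 0)

/-- The Simons cone curve `σ(t) = (1-t)·(R,R)`. -/
def simonsCurve (R : ℝ) : ℝ → ℝ × ℝ := fun t => ((1 - t) * R, (1 - t) * R)

/-- The class `R_h`: locally Lipschitz curves on `[0,1)` with image in `P°`,
starting at `(x₀,y₀)`, with essentially bounded `h`-speed, reaching the collapsed
boundary point as `t → 1` (i.e. `x(γ t)·y(γ t) → 0`). -/
def MemRh (n : ℕ) (cn x0 y0 : ℝ) (γ : ℝ → ℝ × ℝ) : Prop :=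
  γ 0 = (x0, y0) ∧
  (∀ t ∈ Ico (0:ℝ) 1, γ t ∈ Pint) ∧
  (∀ a ∈ Ico (0:ℝ) 1, ∃ K, LipschitzOnWith K γ (Icc 0 a)) ∧
  (∃ M : ℝ, ∀ᵐ t ∂(volume : Measure ℝ), t ∈ Ico (0:ℝ) 1 → hSpeed n cn γ t ≤ M) ∧
  Tendsto (fun t => (γ t).1 * (γ t).2) (𝓝[<] (1:ℝ)) (𝓝 0)

/-- The class `R_h^+`: continuous curves on `[0,1]` into `P` ending on `∂P`
whose restriction to `[0,1)` belongs to `R_h`. -/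
def MemRhPlus (n : ℕ) (cn x0 y0 : ℝ) (α : ℝ → ℝ × ℝ) : Prop :=
  ContinuousOn α (Icc 0 1) ∧ (∀ t ∈ Icc (0:ℝ) 1, α t ∈ Pset) ∧ α 1 ∈ Pbdry ∧
  MemRh n cn x0 y0 α

/-- The class `R_g`: Lipschitz curves on `[0,1]` from `(x₀,y₀)` to `∂P` with
interior image on `[0,1)`. -/
def MemRg (x0 y0 : ℝ) (α : ℝ → ℝ × ℝ) : Prop :=
  (∃ K, LipschitzOnWith K α (Icc 0 1)) ∧ α 0 = (x0, y0) ∧ α 1 ∈ Pbdry ∧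
  ∀ t ∈ Ico (0:ℝ) 1, α t ∈ Pint

/-- The coordinate `u(x,y) = (x² - y²)/2`. -/
def ucoord (z : ℝ × ℝ) : ℝ := (z.1 ^ 2 - z.2 ^ 2) / 2

/-- The coordinate `v(x,y) = xy`. -/
def vcoord (z : ℝ × ℝ) : ℝ := z.1 * z.2

/-- The coordinate `r = √(u² + v²)`. -/
def rcoord (z : ℝ × ℝ) : ℝ := Real.sqrt (ucoord z ^ 2 + vcoord z ^ 2)

/-- The class `R_g^*`: simple curves in `R_g` with a.e. constant speed,
`u(α(1)) > 0`, and `v(α(t)) ≥ c(1-t)` for some `c > 0`. -/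
def MemRgStar (x0 y0 : ℝ) (α : ℝ → ℝ × ℝ) : Prop :=
  MemRg x0 y0 α ∧ InjOn α (Icc 0 1) ∧
  (∀ᵐ t ∂(volume : Measure ℝ), t ∈ Icc (0:ℝ) 1 → gSpeed α t = Lg α) ∧
  0 < ucoord (α 1) ∧
  ∃ c > (0:ℝ), ∀ t ∈ Icc (0:ℝ) 1, c * (1 - t) ≤ vcoord (α t)

namespace QuarterPlane

/-- The weighted Hardy inequality on `[0, T]` with weight `f`, exponent `p` and constant `lam`. -/
def Hardy (p lam T : ℝ) (f : ℝ → ℝ) : Prop :=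
  ∀ w : ℝ → ℝ, (∃ K, LipschitzWith K w) → w 0 = 0 →
    lam * ∫ t in (0:ℝ)..T, |w t| ^ p * f t ≤ ∫ t in (0:ℝ)..T, |deriv w t| ^ p * f t

theorem intervalIntegrable_rpow_mul {p : ℝ} (hp : 0 ≤ p) {w f : ℝ → ℝ} (hw : Continuous w)
    (hf : Continuous f) (a b : ℝ) :
    IntervalIntegrable (fun t => |w t| ^ p * f t) volume a b :=
  ((hw.abs.rpow_const fun _ => Or.inr hp).mul hf).intervalIntegrable a b

theorem intervalIntegrable_deriv_rpow_mul {p : ℝ} (hp : 0 ≤ p) {w f : ℝ → ℝ}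
    {K : NNReal} (hw : LipschitzWith K w) (hf : Continuous f) (a b : ℝ) :
    IntervalIntegrable (fun t => |deriv w t| ^ p * f t) volume a b := by
  have h1 : IntervalIntegrable f volume a b := hf.intervalIntegrable a b
  rw [intervalIntegrable_iff] at h1 ⊢
  refine Integrable.bdd_mul (c := (K:ℝ) ^ p) h1 ?_ ?_
  · exact (((measurable_deriv w).abs).pow_const p).aestronglyMeasurable
  · refine Filter.Eventually.of_forall fun t => ?_
    have h2 : |deriv w t| ≤ K := by
      have := norm_deriv_le_of_lipschitz (x₀ := t) hw
      simpa using this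
    rw [Real.norm_eq_abs, abs_of_nonneg (by positivity)]
    exact Real.rpow_le_rpow (abs_nonneg _) h2 hp

theorem Hardy.congr {p lam T : ℝ} (hT : 0 ≤ T) {f g : ℝ → ℝ} (h : Hardy p lam T f)
    (hfg : ∀ t ∈ Icc 0 T, f t = g t) : Hardy p lam T g := by
  intro w hw hw0
  have e1 : ∫ t in (0:ℝ)..T, |w t| ^ p * f t = ∫ t in (0:ℝ)..T, |w t| ^ p * g t := by
    refine intervalIntegral.integral_congr fun t ht => ?_
    rw [uIcc_of_le hT] at ht
    simp only [hfg t ht]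
  have e2 : ∫ t in (0:ℝ)..T, |deriv w t| ^ p * f t = ∫ t in (0:ℝ)..T, |deriv w t| ^ p * g t := by
    refine intervalIntegral.integral_congr fun t ht => ?_
    rw [uIcc_of_le hT] at ht
    simp only [hfg t ht]
  rw [← e1, ← e2]
  exact h w hw hw0

theorem Hardy.truncate {p lam T : ℝ} (hp : 0 < p) {f : ℝ → ℝ} (hf : Continuous f)
    (h : Hardy p lam T f) {s : ℝ} (hs : 0 ≤ s) (hsT : s ≤ T) {w : ℝ → ℝ}
    (hw : ∃ K, LipschitzWith K w) (hw0 : w 0 = 0) :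
    lam * ((∫ t in (0:ℝ)..s, |w t| ^ p * f t) + |w s| ^ p * ∫ t in s..T, f t) ≤
      ∫ t in (0:ℝ)..s, |deriv w t| ^ p * f t := by
  obtain ⟨K, hK⟩ := hw
  have hmin : LipschitzWith 1 (fun t : ℝ => min t s) := LipschitzWith.id.min_const s
  have hv : LipschitzWith (K * 1) (fun t => w (min t s)) := hK.comp hmin
  have h1 := h (fun t => w (min t s)) ⟨_, hv⟩ (by simp [hs, hw0])
  rw [← intervalIntegral.integral_add_adjacent_intervals (b := s)
      (intervalIntegrable_rpow_mul hp.le hv.continuous hf _ _)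
      (intervalIntegrable_rpow_mul hp.le hv.continuous hf _ _),
    ← intervalIntegral.integral_add_adjacent_intervals (b := s)
      (intervalIntegrable_deriv_rpow_mul hp.le hv hf _ _)
      (intervalIntegrable_deriv_rpow_mul hp.le hv hf _ _)] at h1
  have e1 : ∫ t in (0:ℝ)..s, |w (min t s)| ^ p * f t = ∫ t in (0:ℝ)..s, |w t| ^ p * f t := by
    refine intervalIntegral.integral_congr fun t ht => ?_
    rw [uIcc_of_le hs] at ht
    simp only [min_eq_left ht.2]
  have e2 : ∫ t in s..T, |w (min t s)| ^ p * f t = |w s| ^ p * ∫ t in s..T, f t := by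
    rw [← intervalIntegral.integral_const_mul]
    refine intervalIntegral.integral_congr fun t ht => ?_
    rw [uIcc_of_le hsT] at ht
    simp only [min_eq_right ht.1]
  have e3 : ∫ t in (0:ℝ)..s, |deriv (fun t => w (min t s)) t| ^ p * f t =
      ∫ t in (0:ℝ)..s, |deriv w t| ^ p * f t := by
    rw [intervalIntegral.integral_of_le hs, intervalIntegral.integral_of_le hs,
      integral_Ioc_eq_integral_Ioo, integral_Ioc_eq_integral_Ioo]
    refine setIntegral_congr_fun measurableSet_Ioo fun t ht => ?_
    have : (fun t => w (min t s)) =ᶠ[𝓝 t] w := by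
      filter_upwards [Iio_mem_nhds ht.2] with x hx
      rw [min_eq_left (le_of_lt hx)]
    simp only [this.deriv_eq]
  have e4 : ∫ t in s..T, |deriv (fun t => w (min t s)) t| ^ p * f t = 0 := by
    rw [intervalIntegral.integral_of_le hsT]
    refine setIntegral_eq_zero_of_forall_eq_zero fun t ht => ?_
    have : (fun t => w (min t s)) =ᶠ[𝓝 t] fun _ => w s := by
      filter_upwards [Ioi_mem_nhds ht.1] with x hx
      rw [min_eq_right (le_of_lt hx)]
    rw [this.deriv_eq, deriv_const, abs_zero, Real.zero_rpow hp.ne', zero_mul]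
  rw [e1, e2, e3, e4, add_zero] at h1
  exact h1

theorem Hardy.mono_time {p lam T : ℝ} (hp : 0 < p) (hlam : 0 ≤ lam) {f : ℝ → ℝ}
    (hf : Continuous f) (hf0 : ∀ t, 0 ≤ f t)
    (h : Hardy p lam T f) {s : ℝ} (hs : 0 ≤ s) (hsT : s ≤ T) : Hardy p lam s f := by
  intro w hw hw0
  have h1 := h.truncate hp hf hs hsT hw hw0
  have h2 : 0 ≤ lam * (|w s| ^ p * ∫ t in s..T, f t) := by
    have := intervalIntegral.integral_nonneg hsT (μ := volume) fun t _ => hf0 t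
    positivity
  linarith

theorem Hardy.id_le {p lam T : ℝ} (hp : 0 < p) {f : ℝ → ℝ} (hf : Continuous f)
    (h : Hardy p lam T f) {s : ℝ} (hs : 0 ≤ s) (hsT : s ≤ T) :
    lam * ((∫ t in (0:ℝ)..s, |t| ^ p * f t) + s ^ p * ∫ t in s..T, f t) ≤
      ∫ t in (0:ℝ)..s, f t := by
  have h1 := h.truncate hp hf hs hsT (w := id) ⟨1, LipschitzWith.id⟩ rfl
  simpa [abs_of_nonneg hs] using h1

theorem Hardy.rescale {p lam T : ℝ} (hT : 0 ≤ T) {f g : ℝ → ℝ}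
    {κ : ℝ} (hκ : 0 < κ) (h : Hardy p lam T f) (hfg : ∀ t ∈ Icc 0 T, g (κ * t) = f t) :
    Hardy p (lam / κ ^ p) (κ * T) g := by
  rintro w ⟨K, hK⟩ hw0
  have hl : LipschitzWith (Real.toNNReal κ) (fun t : ℝ => κ * t) := by
    refine LipschitzWith.of_dist_le_mul fun x y => ?_
    rw [Real.dist_eq, Real.dist_eq, ← mul_sub, abs_mul, Real.coe_toNNReal _ hκ.le,
      abs_of_pos hκ]
  have h1 := h (fun t => w (κ * t)) ⟨_, hK.comp hl⟩ (by simp [hw0])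
  have e1 : ∫ t in (0:ℝ)..T, |w (κ * t)| ^ p * f t =
      κ⁻¹ * ∫ t in (0:ℝ)..κ * T, |w t| ^ p * g t := by
    have := intervalIntegral.mul_integral_comp_mul_add (a := (0:ℝ)) (b := T)
      (f := fun t => |w t| ^ p * g t) (c := κ) (d := 0)
    simp only [add_zero, mul_zero] at this
    rw [← this, ← mul_assoc, inv_mul_cancel₀ hκ.ne', one_mul]
    refine intervalIntegral.integral_congr fun t ht => ?_
    rw [uIcc_of_le hT] at ht
    simp only [hfg t ht]
  have e2 : ∫ t in (0:ℝ)..T, |deriv (fun t => w (κ * t)) t| ^ p * f t =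
      κ ^ p * (κ⁻¹ * ∫ t in (0:ℝ)..κ * T, |deriv w t| ^ p * g t) := by
    have := intervalIntegral.mul_integral_comp_mul_add (a := (0:ℝ)) (b := T)
      (f := fun t => |deriv w t| ^ p * g t) (c := κ) (d := 0)
    simp only [add_zero, mul_zero] at this
    rw [← this, ← mul_assoc κ⁻¹, inv_mul_cancel₀ hκ.ne', one_mul,
      ← intervalIntegral.integral_const_mul]
    refine intervalIntegral.integral_congr fun t ht => ?_
    rw [uIcc_of_le hT] at ht
    simp only [hfg t ht]
    rw [deriv_comp_mul_left, smul_eq_mul, abs_mul, abs_of_pos hκ,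
      Real.mul_rpow hκ.le (abs_nonneg _), mul_assoc]
  rw [e1, e2] at h1
  have hkp : 0 < κ ^ p := Real.rpow_pos_of_pos hκ p
  rw [div_mul_eq_mul_div, div_le_iff₀ hkp]
  have h2 := mul_le_mul_of_nonneg_left h1 hκ.le
  have e3 : ∀ a : ℝ, κ * (κ⁻¹ * a) = a := fun a => by
    rw [← mul_assoc, mul_inv_cancel₀ hκ.ne', one_mul]
  calc _ = κ * (lam * (κ⁻¹ * ∫ t in (0:ℝ)..κ * T, |w t| ^ p * g t)) := by
        rw [mul_left_comm κ, e3]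
    _ ≤ _ := h2
    _ = _ := by rw [mul_left_comm κ, e3, mul_comm]

/-- The reparametrization which is affine of slope `d / l` on `[s, s + l]` and of slope one
elsewhere. -/
def squeeze (s l d τ : ℝ) : ℝ := min τ s + (d / l) * (min (max τ s) (s + l) - s) +
  (max τ (s + l) - (s + l))

theorem squeeze_of_le {s l d τ : ℝ} (hl : 0 ≤ l) (h : τ ≤ s) : squeeze s l d τ = τ := by
  unfold squeeze
  rw [min_eq_left h, max_eq_right h, min_eq_left (by linarith), max_eq_right (by linarith)]
  ring

theorem squeeze_of_mem {s l d τ : ℝ} (h1 : s ≤ τ) (h2 : τ ≤ s + l) :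
    squeeze s l d τ = s + d / l * (τ - s) := by
  unfold squeeze
  rw [min_eq_right h1, max_eq_left h1, min_eq_left h2, max_eq_right h2]
  ring

theorem squeeze_of_ge {s l d τ : ℝ} (hl : 0 < l) (h : s + l ≤ τ) :
    squeeze s l d τ = τ - l + d := by
  unfold squeeze
  rw [min_eq_right (by linarith), max_eq_left (by linarith), min_eq_right h, max_eq_left h]
  field_simp
  ring

theorem squeeze_lipschitz (s l d : ℝ) : ∃ K, LipschitzWith K (squeeze s l d) := by
  have h1 : LipschitzWith 1 (fun τ : ℝ => min τ s) := LipschitzWith.id.min_const s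
  have h2 : LipschitzWith 1 (fun τ : ℝ => min (max τ s) (s + l)) :=
    (LipschitzWith.id.max_const s).min_const _
  have h3 : LipschitzWith 1 (fun τ : ℝ => max τ (s + l)) := LipschitzWith.id.max_const _
  have h4 : LipschitzWith (1 + Real.nnabs (d / l) + 1) (squeeze s l d) := by
    refine LipschitzWith.of_dist_le_mul fun x y => ?_
    have a1 := h1.dist_le_mul x y
    have a2 := h2.dist_le_mul x y
    have a3 := h3.dist_le_mul x y
    simp only [Real.dist_eq, NNReal.coe_one, one_mul, NNReal.coe_add, Real.coe_nnabs] at *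
    have : squeeze s l d x - squeeze s l d y = (min x s - min y s) +
      (d / l) * (min (max x s) (s + l) - min (max y s) (s + l)) +
      (max x (s + l) - max y (s + l)) := by unfold squeeze; ring
    rw [this]
    refine (abs_add_le _ _).trans ?_
    have b := (abs_add_le (min x s - min y s)
      ((d / l) * (min (max x s) (s + l) - min (max y s) (s + l))))
    rw [abs_mul] at b
    have := mul_le_mul_of_nonneg_left a2 (abs_nonneg (d / l))
    linarith
  exact ⟨_, h4⟩

theorem Hardy.squeeze {p lam T : ℝ} (hp : 1 ≤ p) (hlam : 0 ≤ lam) {f g : ℝ → ℝ}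
    (hf : Continuous f) (hg : Continuous g)
    (h : Hardy p lam T f) {s l d : ℝ} (hs : 0 ≤ s) (hl : 0 < l) (hT : s + l ≤ T) (hd : 0 ≤ d)
    (h1 : ∀ t ∈ Icc 0 s, g t = f t)
    (h2 : ∀ t ∈ Icc (s + l) T, g (t - l + d) = f t)
    (h3 : ∀ t ∈ Icc s (s + l), (d / l) ^ (p - 1) * f t ≤ g (s + d / l * (t - s)))
    (h4 : ∀ t ∈ Icc s (s + l), (d / l) * g (s + d / l * (t - s)) ≤ f t) :
    Hardy p lam (T - l + d) g := by
  rintro w ⟨K, hK⟩ hw0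
  have hp0 : 0 < p := by linarith
  have hdl : 0 ≤ d / l := div_nonneg hd hl.le
  obtain ⟨K', hK'⟩ := squeeze_lipschitz s l d
  have hv : LipschitzWith (K * K') (fun τ => w (QuarterPlane.squeeze s l d τ)) := hK.comp hK'
  have hh := h _ ⟨_, hv⟩ (by rw [squeeze_of_le hl.le hs, hw0])
  set v : ℝ → ℝ := fun τ => w (QuarterPlane.squeeze s l d τ) with hvdef
  have iw := fun a b => intervalIntegrable_rpow_mul hp0.le hv.continuous hf a b
  have id := fun a b => intervalIntegrable_deriv_rpow_mul hp0.le hv hf a b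
  have jw := fun a b => intervalIntegrable_rpow_mul hp0.le hK.continuous hg a b
  have jd := fun a b => intervalIntegrable_deriv_rpow_mul hp0.le hK hg a b
  rw [← intervalIntegral.integral_add_adjacent_intervals (b := s) (iw _ _) (iw _ _),
    ← intervalIntegral.integral_add_adjacent_intervals (a := s) (b := s + l) (iw _ _) (iw _ _),
    ← intervalIntegral.integral_add_adjacent_intervals (b := s) (id _ _) (id _ _),
    ← intervalIntegral.integral_add_adjacent_intervals (a := s) (b := s + l)
      (id _ _) (id _ _)] at hh
  rw [← intervalIntegral.integral_add_adjacent_intervals (b := s) (jw _ _) (jw _ _),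
    ← intervalIntegral.integral_add_adjacent_intervals (a := s) (b := s + d) (jw _ _) (jw _ _),
    ← intervalIntegral.integral_add_adjacent_intervals (b := s) (jd _ _) (jd _ _),
    ← intervalIntegral.integral_add_adjacent_intervals (a := s) (b := s + d)
      (jd _ _) (jd _ _)]
  have a1 : ∫ t in (0:ℝ)..s, |v t| ^ p * f t = ∫ t in (0:ℝ)..s, |w t| ^ p * g t := by
    refine intervalIntegral.integral_congr fun t ht => ?_
    rw [uIcc_of_le hs] at ht
    simp only [hvdef, squeeze_of_le hl.le ht.2, h1 t ht]
  have a3 : ∫ t in (s + l)..T, |v t| ^ p * f t =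
      ∫ t in (s + d)..(T - l + d), |w t| ^ p * g t := by
    have : ∫ t in (s + l)..T, |v t| ^ p * f t =
        ∫ t in (s + l)..T, (fun t => |w t| ^ p * g t) (t + (d - l)) := by
      refine intervalIntegral.integral_congr fun t ht => ?_
      rw [uIcc_of_le hT] at ht
      have e : t + (d - l) = t - l + d := by ring
      simp only [hvdef, squeeze_of_ge hl ht.1, ← h2 t ht, e]
    rw [this, intervalIntegral.integral_comp_add_right (fun t => |w t| ^ p * g t)]
    congr 1 <;> ring
  have b1 : ∫ t in (0:ℝ)..s, |deriv v t| ^ p * f t = ∫ t in (0:ℝ)..s, |deriv w t| ^ p * g t := by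
    rw [intervalIntegral.integral_of_le hs, intervalIntegral.integral_of_le hs,
      integral_Ioc_eq_integral_Ioo, integral_Ioc_eq_integral_Ioo]
    refine setIntegral_congr_fun measurableSet_Ioo fun t ht => ?_
    have : v =ᶠ[𝓝 t] w := by
      filter_upwards [Iio_mem_nhds ht.2] with x hx
      simp only [hvdef, squeeze_of_le hl.le (le_of_lt hx)]
    simp only [this.deriv_eq, h1 t (Ioo_subset_Icc_self ht)]
  have b3 : ∫ t in (s + l)..T, |deriv v t| ^ p * f t =
      ∫ t in (s + d)..(T - l + d), |deriv w t| ^ p * g t := by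
    have : ∫ t in (s + l)..T, |deriv v t| ^ p * f t =
        ∫ t in (s + l)..T, (fun t => |deriv w t| ^ p * g t) (t + (d - l)) := by
      rw [intervalIntegral.integral_of_le hT, intervalIntegral.integral_of_le hT,
        integral_Ioc_eq_integral_Ioo, integral_Ioc_eq_integral_Ioo]
      refine setIntegral_congr_fun measurableSet_Ioo fun t ht => ?_
      have : v =ᶠ[𝓝 t] fun x => w (x + (d - l)) := by
        filter_upwards [Ioi_mem_nhds ht.1] with x hx
        simp only [hvdef, squeeze_of_ge hl (le_of_lt hx)]
        congr 1; ring
      have e : t + (d - l) = t - l + d := by ring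
      simp only [this.deriv_eq, deriv_comp_add_const]
      rw [e, h2 t (Ioo_subset_Icc_self ht)]
    rw [this, intervalIntegral.integral_comp_add_right (fun t => |deriv w t| ^ p * g t)]
    congr 1 <;> ring
  have cv : ∀ F : ℝ → ℝ, ∫ t in s..(s + d), F t =
      ∫ t in s..(s + l), d / l * F (s + d / l * (t - s)) := by
    intro F
    have := intervalIntegral.mul_integral_comp_mul_add (a := s) (b := s + l)
      (f := F) (c := d / l) (d := s - d / l * s)
    have e1 : d / l * s + (s - d / l * s) = s := by ring
    have e2 : d / l * (s + l) + (s - d / l * s) = s + d := by field_simp; ring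
    rw [e1, e2] at this
    rw [← this, intervalIntegral.integral_const_mul]
    congr 2; ext t; congr 1; ring
  have hsl : s ≤ s + l := by linarith
  have a2 : ∫ t in s..(s + d), |w t| ^ p * g t ≤ ∫ t in s..(s + l), |v t| ^ p * f t := by
    rw [cv]
    refine intervalIntegral.integral_mono_on hsl ?_ (iw _ _) fun t ht => ?_
    · have c1 : Continuous (fun t => w (s + d / l * (t - s))) :=
        hK.continuous.comp (by fun_prop)
      have c2 : Continuous (fun t => g (s + d / l * (t - s))) := hg.comp (by fun_prop)
      exact (intervalIntegrable_rpow_mul hp0.le c1 c2 _ _).const_mul _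
    · simp only [hvdef, squeeze_of_mem ht.1 ht.2]
      have := mul_le_mul_of_nonneg_left (h4 t ht)
        (Real.rpow_nonneg (abs_nonneg (w (s + d / l * (t - s)))) p)
      linarith
  have b2 : ∫ t in s..(s + l), |deriv v t| ^ p * f t ≤
      ∫ t in s..(s + d), |deriv w t| ^ p * g t := by
    rw [cv]
    have haff : ∃ K, LipschitzWith K (fun t : ℝ => s + d / l * (t - s)) := by
      refine ⟨Real.nnabs (d / l), LipschitzWith.of_dist_le_mul fun x y => ?_⟩
      rw [Real.dist_eq, Real.dist_eq, Real.coe_nnabs, ← abs_mul]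
      apply le_of_eq; congr 1; ring
    obtain ⟨K2, hK2⟩ := haff
    have hdv : ∀ t ∈ Ioo s (s + l), deriv v t = d / l * deriv w (s + d / l * (t - s)) := by
      intro t ht
      have : v =ᶠ[𝓝 t] fun x => w ((s - d / l * s) + d / l * x) := by
        filter_upwards [Ioo_mem_nhds ht.1 ht.2] with x hx
        simp only [hvdef, squeeze_of_mem hx.1.le hx.2.le]
        congr 1; ring
      rw [this.deriv_eq, deriv_comp_mul_left (d / l) (fun x => w ((s - d / l * s) + x)) t,
        deriv_comp_const_add, smul_eq_mul]
      congr 2; ring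
    have key : ∀ t ∈ Ioo s (s + l), |deriv v t| ^ p * f t ≤
        d / l * (|deriv w (s + d / l * (t - s))| ^ p * g (s + d / l * (t - s))) := by
      intro t ht
      have q := h3 t (Ioo_subset_Icc_self ht)
      rw [hdv t ht, abs_mul, Real.mul_rpow (abs_nonneg _) (abs_nonneg _), abs_of_nonneg hdl]
      have e : (d / l) ^ p = d / l * (d / l) ^ (p - 1) := by
        rcases hdl.eq_or_lt with h0 | h0
        · rw [← h0, Real.zero_rpow hp0.ne', zero_mul]
        · rw [← Real.rpow_one_add' hdl (by linarith)]; congr 1; ring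
      rw [e]
      have := mul_le_mul_of_nonneg_left q
        (mul_nonneg hdl (Real.rpow_nonneg (abs_nonneg (deriv w (s + d / l * (t - s)))) p))
      linarith
    have ii : IntervalIntegrable (fun t => d / l * (|deriv w (s + d / l * (t - s))| ^ p *
        g (s + d / l * (t - s)))) volume s (s + l) := by
      refine IntervalIntegrable.const_mul ?_ _
      have m : Measurable (fun t => |deriv w (s + d / l * (t - s))| ^ p) :=
        (((measurable_deriv w).comp (by fun_prop : Measurable
          (fun t : ℝ => s + d / l * (t - s)))).abs).pow_const p
      have h1 : IntervalIntegrable (fun t => g (s + d / l * (t - s))) volume s (s + l) :=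
        (hg.comp (by fun_prop)).intervalIntegrable _ _
      rw [intervalIntegrable_iff] at h1 ⊢
      refine Integrable.bdd_mul (c := (K:ℝ) ^ p) h1 m.aestronglyMeasurable ?_
      refine Filter.Eventually.of_forall fun t => ?_
      have h2 : |deriv w (s + d / l * (t - s))| ≤ K := by
        have := norm_deriv_le_of_lipschitz (x₀ := s + d / l * (t - s)) hK
        simpa using this
      rw [Real.norm_eq_abs, abs_of_nonneg (by positivity)]
      exact Real.rpow_le_rpow (abs_nonneg _) h2 hp0.le
    refine intervalIntegral.integral_mono_on_of_le_Ioo hsl (id _ _) ii key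
  rw [a1, a3, b1, b3] at hh
  have := mul_le_mul_of_nonneg_left a2 hlam
  linarith

theorem young_rpow {p a b : ℝ} (hp : 1 < p) (ha : 0 ≤ a) (hb : 0 ≤ b) :
    p * (a ^ (p - 1) * b) ≤ (p - 1) * a ^ p + b ^ p := by
  have hq : (p / (p - 1)).HolderConjugate p := by
    rw [Real.holderConjugate_comm]
    exact Real.HolderConjugate.conjExponent hp
  have h := Real.young_inequality_of_nonneg (Real.rpow_nonneg ha (p - 1)) hb hq
  have hp1 : 0 < p - 1 := by linarith
  rw [← Real.rpow_mul ha, mul_div_cancel₀ _ hp1.ne'] at h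
  have h2 := mul_le_mul_of_nonneg_left h (by linarith : 0 ≤ p)
  have e : p * (a ^ p / (p / (p - 1)) + b ^ p / p) = (p - 1) * a ^ p + b ^ p := by
    field_simp
  linarith

theorem abs_deriv_abs_rpow_le {p : ℝ} (hp : 1 < p) {w : ℝ → ℝ} {t : ℝ}
    (hw : DifferentiableAt ℝ w t) :
    |deriv (fun t => |w t| ^ p) t| ≤ (p - 1) * |w t| ^ p + |deriv w t| ^ p := by
  have h1 := (hasDerivAt_abs_rpow (w t) hp).comp t hw.hasDerivAt
  have h2 : deriv (fun t => |w t| ^ p) t = p * |w t| ^ (p - 2) * w t * deriv w t := h1.deriv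
  have h3 : |w t| ^ (p - 2) * |w t| = |w t| ^ (p - 1) := by
    rcases (abs_nonneg (w t)).eq_or_lt with h0 | h0
    · rw [← h0, mul_zero, Real.zero_rpow (by linarith)]
    · nth_rewrite 2 [← Real.rpow_one |w t|]
      rw [← Real.rpow_add h0]; congr 1; ring
  rw [h2]
  simp only [abs_mul]
  rw [abs_of_pos (by linarith : 0 < p), abs_of_nonneg (Real.rpow_nonneg (abs_nonneg _) _),
    mul_assoc p, h3, mul_assoc]
  exact young_rpow hp (abs_nonneg _) (abs_nonneg _)

/-- A one-dimensional trace inequality on an interval where the weight decreases to zero like a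
power. -/
theorem integral_rpow_mul_le_of_power_weight {p : ℝ} (hp : 1 < p) {n : ℕ} (hn : 1 ≤ n)
    {s y b : ℝ} (hy : 0 ≤ y) (hb : 0 ≤ b) {g : ℝ → ℝ} (hg : Continuous g)
    (hgb : ∀ t ∈ Icc s (s + y), g t = b * (s + y - t) ^ (n - 1)) {w : ℝ → ℝ} {K : NNReal}
    (hw : LipschitzWith K w) :
    ∫ t in s..(s + y), |w t| ^ p * g t ≤ |w s| ^ p * (b * y ^ n / n) +
      y / n * ((p - 1) * (∫ t in s..(s + y), |w t| ^ p * g t) +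
        ∫ t in s..(s + y), |deriv w t| ^ p * g t) := by
  have hp0 : 0 ≤ p := by linarith
  have hsy : s ≤ s + y := by linarith
  have hn0 : (0:ℝ) < n := by exact_mod_cast hn
  set H : ℝ → ℝ := fun t => b * (s + y - t) ^ n / n with hH
  have hHd : ∀ t, HasDerivAt H (-(b * (s + y - t) ^ (n - 1))) t := by
    intro t
    have h1 : HasDerivAt (fun t => s + y - t) (-1) t := (hasDerivAt_id t).const_sub _
    have h2 := ((h1.fun_pow n).const_mul b).div_const (n : ℝ)
    refine h2.congr_deriv ?_
    field_simp
  have acw : AbsolutelyContinuousOnInterval (fun t => |w t| ^ p) s (s + y) := by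
    have c : ContDiff ℝ 1 (fun x : ℝ => |x| ^ p) := by
      have := contDiff_norm_rpow (E := ℝ) hp
      simpa using this
    have h1 : LocallyLipschitz (fun t => |w t| ^ p) :=
      c.locallyLipschitz.comp hw.locallyLipschitz
    obtain ⟨K', hK'⟩ :=
      (h1.locallyLipschitzOn (s := uIcc s (s + y))).exists_lipschitzOnWith_of_compact
      isCompact_uIcc
    exact hK'.absolutelyContinuousOnInterval
  have acH : AbsolutelyContinuousOnInterval H s (s + y) := by
    have c : ContDiff ℝ 1 H := by fun_prop
    obtain ⟨K', hK'⟩ := (c.locallyLipschitz.locallyLipschitzOn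
      (s := uIcc s (s + y))).exists_lipschitzOnWith_of_compact isCompact_uIcc
    exact hK'.absolutelyContinuousOnInterval
  have ibp := acw.integral_mul_deriv_eq_deriv_mul acH
  have e1 : ∫ t in s..(s + y), |w t| ^ p * deriv H t = - ∫ t in s..(s + y), |w t| ^ p * g t := by
    rw [← intervalIntegral.integral_neg]
    refine intervalIntegral.integral_congr fun t ht => ?_
    rw [uIcc_of_le hsy] at ht
    simp only [(hHd t).deriv, hgb t ht]
    ring
  have e2 : H (s + y) = 0 := by
    simp [hH, zero_pow (by omega : n ≠ 0)]
  have e3 : H s = b * y ^ n / n := by simp [hH]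
  rw [e1, e2, e3, mul_zero, zero_sub] at ibp
  have iw := intervalIntegrable_rpow_mul hp0 hw.continuous hg s (s + y)
  have id := intervalIntegrable_deriv_rpow_mul hp0 hw hg s (s + y)
  have key : - ∫ t in s..(s + y), deriv (fun t => |w t| ^ p) t * H t ≥
      - ∫ t in s..(s + y), (y / n) * ((p - 1) * (|w t| ^ p * g t) + |deriv w t| ^ p * g t) := by
    refine neg_le_neg (intervalIntegral.integral_mono_ae_restrict hsy ?_ ?_ ?_)
    · exact acw.intervalIntegrable_deriv.mul_continuousOn acH.continuousOn
    · exact ((iw.const_mul _).add id).const_mul _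
    · rw [EventuallyLE, ae_restrict_iff' measurableSet_Icc]
      filter_upwards [hw.ae_differentiableAt_real] with t ht htI
      have a := abs_deriv_abs_rpow_le hp ht
      have hyt : 0 ≤ s + y - t := by linarith [htI.2]
      have hH0 : 0 ≤ H t := by positivity
      have hHg : H t ≤ y / n * g t := by
        rw [hgb t htI, hH]
        obtain ⟨m, rfl⟩ : ∃ m, n = m + 1 := ⟨n - 1, by omega⟩
        simp only [Nat.add_sub_cancel]
        rw [pow_succ, div_mul_eq_mul_div]
        have : (s + y - t) ≤ y := by linarith [htI.1]
        have h3 : 0 ≤ b * (s + y - t) ^ m := by positivity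
        refine div_le_div_of_nonneg_right ?_ (by positivity)
        nlinarith
      have hr : 0 ≤ (p - 1) * |w t| ^ p + |deriv w t| ^ p := le_trans (abs_nonneg _) a
      calc deriv (fun t => |w t| ^ p) t * H t
          ≤ ((p - 1) * |w t| ^ p + |deriv w t| ^ p) * H t :=
            mul_le_mul_of_nonneg_right ((le_abs_self _).trans a) hH0
        _ ≤ ((p - 1) * |w t| ^ p + |deriv w t| ^ p) * (y / n * g t) :=
            mul_le_mul_of_nonneg_left hHg hr
        _ = _ := by ring
  rw [intervalIntegral.integral_const_mul, intervalIntegral.integral_add (iw.const_mul _) id,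
    intervalIntegral.integral_const_mul] at key
  linarith

/-- Replacing the tail of a weight by a shorter tail with power-like decay and not too much more
mass preserves the Hardy inequality. -/
theorem Hardy.drop {p lam T : ℝ} (hp : 1 < p) (hlam : 0 ≤ lam) {f g : ℝ → ℝ}
    (hf : Continuous f) (hg : Continuous g) (hg0 : ∀ t, 0 ≤ g t) (h : Hardy p lam T f)
    {n : ℕ} (hn : 1 ≤ n) {s y b : ℝ} (hs : 0 ≤ s) (hsT : s ≤ T) (hy : 0 ≤ y) (hb : 0 ≤ b)
    (hy1 : 2 * p * y ≤ 1) (hy2 : 2 * lam * y ≤ 1)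
    (hfg : ∀ t ∈ Icc 0 s, f t = g t)
    (hgb : ∀ t ∈ Icc s (s + y), g t = b * (s + y - t) ^ (n - 1))
    (hmass : (1 + 2 * p * y) * (b * y ^ n / n) ≤ ∫ t in s..T, f t) :
    Hardy p lam (s + y) g := by
  rintro w ⟨K, hK⟩ hw0
  have hp0 : 0 < p := by linarith
  have hsy : s ≤ s + y := by linarith
  have hn1 : (1:ℝ) ≤ n := by exact_mod_cast hn
  have h1 := h.truncate hp0 hf hs hsT ⟨K, hK⟩ hw0
  have e1 : ∫ t in (0:ℝ)..s, |w t| ^ p * f t = ∫ t in (0:ℝ)..s, |w t| ^ p * g t := by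
    refine intervalIntegral.integral_congr fun t ht => ?_
    rw [uIcc_of_le hs] at ht
    simp only [hfg t ht]
  have e2 : ∫ t in (0:ℝ)..s, |deriv w t| ^ p * f t = ∫ t in (0:ℝ)..s, |deriv w t| ^ p * g t := by
    refine intervalIntegral.integral_congr fun t ht => ?_
    rw [uIcc_of_le hs] at ht
    simp only [hfg t ht]
  rw [e1, e2] at h1
  rw [← intervalIntegral.integral_add_adjacent_intervals (b := s)
      (intervalIntegrable_rpow_mul hp0.le hK.continuous hg _ _)
      (intervalIntegrable_rpow_mul hp0.le hK.continuous hg _ _),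
    ← intervalIntegral.integral_add_adjacent_intervals (b := s)
      (intervalIntegrable_deriv_rpow_mul hp0.le hK hg _ _)
      (intervalIntegrable_deriv_rpow_mul hp0.le hK hg _ _)]
  have h2 := integral_rpow_mul_le_of_power_weight hp hn hy hb hg hgb hK
  have hI : 0 ≤ ∫ t in s..(s + y), |w t| ^ p * g t :=
    intervalIntegral.integral_nonneg hsy fun t _ =>
      mul_nonneg (Real.rpow_nonneg (abs_nonneg _) _) (hg0 t)
  have hN : 0 ≤ ∫ t in s..(s + y), |deriv w t| ^ p * g t :=
    intervalIntegral.integral_nonneg hsy fun t _ =>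
      mul_nonneg (Real.rpow_nonneg (abs_nonneg _) _) (hg0 t)
  set I := ∫ t in s..(s + y), |w t| ^ p * g t
  set N := ∫ t in s..(s + y), |deriv w t| ^ p * g t
  have hW : 0 ≤ |w s| ^ p := Real.rpow_nonneg (abs_nonneg _) _
  set W := |w s| ^ p
  set A := b * y ^ n / n
  have hA : 0 ≤ A := by positivity
  have h3 : I ≤ W * A + y * (p * I + N) := by
    have q : y / n ≤ y := div_le_self hy hn1
    have : y / n * ((p - 1) * I + N) ≤ y * (p * I + N) :=
      mul_le_mul q (by nlinarith) (by nlinarith) hy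
    linarith
  have h4 : lam * I ≤ lam * (W * ∫ t in s..T, f t) + N := by
    have h5 := mul_le_mul_of_nonneg_left hmass (mul_nonneg hlam hW)
    have h6 : (1 - p * y) * I ≤ W * A + y * N := by linarith
    have hpy : 0 ≤ p * y := by positivity
    have h7 := mul_le_mul_of_nonneg_left h6 (mul_nonneg hlam (by linarith : 0 ≤ 1 + 2 * p * y))
    have h8 : I ≤ (1 + 2 * p * y) * ((1 - p * y) * I) := by
      have : 0 ≤ p * y * (1 - 2 * p * y) * I := by
        apply mul_nonneg (mul_nonneg hpy (by linarith)) hI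
      nlinarith
    have h9 := mul_le_mul_of_nonneg_left h8 hlam
    have h10 : lam * (1 + 2 * p * y) * (y * N) ≤ N := by
      have : lam * (1 + 2 * p * y) * y ≤ 1 := by
        have : 0 ≤ lam * y := by positivity
        nlinarith
      nlinarith
    nlinarith
  nlinarith

theorem tendsto_intervalIntegral_weight {M B C : ℝ} {h : ℝ → ℝ} (hh : Measurable h)
    (hC : ∀ t ∈ Icc 0 M, |h t| ≤ C) {F : ℕ → ℝ → ℝ} {f : ℝ → ℝ} (hF : ∀ k, Continuous (F k))
    (hB : ∀ k, ∀ t ∈ Icc 0 M, |F k t| ≤ B)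
    (hlim : ∀ t ∈ Icc 0 M, Tendsto (fun k => F k t) atTop (𝓝 (f t)))
    {T : ℕ → ℝ} {T0 : ℝ} (hT : ∀ k, T k ∈ Icc 0 M) (hT0 : Tendsto T atTop (𝓝 T0)) :
    Tendsto (fun k => ∫ t in (0:ℝ)..(T k), h t * F k t) atTop
      (𝓝 (∫ t in (0:ℝ)..T0, h t * f t)) := by
  have hT0M : T0 ∈ Icc 0 M := isClosed_Icc.mem_of_tendsto hT0 (Eventually.of_forall hT)
  have conv : ∀ S ∈ Icc 0 M, ∀ g : ℝ → ℝ, ∫ t in (0:ℝ)..S, g t =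
      ∫ t in (0:ℝ)..M, (Iic S).indicator g t := by
    intro S hS g
    rw [intervalIntegral.integral_of_le hS.1, intervalIntegral.integral_of_le (hS.1.trans hS.2),
      setIntegral_indicator measurableSet_Iic]
    congr 2
    ext t
    simp only [mem_Ioc, mem_inter_iff, mem_Iic]
    exact ⟨fun ⟨a, b⟩ => ⟨⟨a, b.trans hS.2⟩, b⟩, fun ⟨⟨a, _⟩, b⟩ => ⟨a, b⟩⟩
  rw [conv T0 hT0M]
  simp_rw [fun k => conv (T k) (hT k) (fun t => h t * F k t)]
  have hM : 0 ≤ M := hT0M.1.trans hT0M.2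
  refine intervalIntegral.tendsto_integral_filter_of_dominated_convergence (fun _ => C * B)
    ?_ ?_ ?_ ?_
  · refine Eventually.of_forall fun k => ?_
    exact ((hh.mul (hF k).measurable).indicator measurableSet_Iic).aestronglyMeasurable
  · refine Eventually.of_forall fun k => Eventually.of_forall fun t ht => ?_
    rw [uIoc_of_le hM] at ht
    have ht' := Ioc_subset_Icc_self ht
    refine (norm_indicator_le_norm_self _ _).trans ?_
    rw [Real.norm_eq_abs, abs_mul]
    have := hC t ht'
    exact mul_le_mul this (hB k t ht') (abs_nonneg _) ((abs_nonneg _).trans this)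
  · exact intervalIntegrable_const
  · have : ∀ᵐ t : ℝ, t ≠ T0 := by
      rw [ae_iff]; simp
    filter_upwards [this] with t ht htM
    rw [uIoc_of_le hM] at htM
    have ht' := Ioc_subset_Icc_self htM
    have h1 := (hlim t ht').const_mul (h t)
    rcases lt_or_gt_of_ne ht with h2 | h2
    · rw [indicator_of_mem (by exact h2.le)]
      refine h1.congr' ?_
      filter_upwards [hT0.eventually (Ioi_mem_nhds h2)] with k hk
      rw [indicator_of_mem]
      exact le_of_lt hk
    · rw [indicator_of_notMem (by simpa using h2)]
      refine tendsto_const_nhds.congr' ?_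
      filter_upwards [hT0.eventually (Iio_mem_nhds h2)] with k hk
      rw [indicator_of_notMem]
      simpa using hk

theorem Hardy.of_tendsto {p M B : ℝ} (hp : 0 ≤ p) {F : ℕ → ℝ → ℝ} {f : ℝ → ℝ}
    (hF : ∀ k, Continuous (F k))
    (hB : ∀ k, ∀ t ∈ Icc 0 M, |F k t| ≤ B)
    (hlim : ∀ t ∈ Icc 0 M, Tendsto (fun k => F k t) atTop (𝓝 (f t)))
    {T lam : ℕ → ℝ} {T0 lam0 : ℝ} (hT : ∀ k, T k ∈ Icc 0 M) (hT0 : Tendsto T atTop (𝓝 T0))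
    (hlam : Tendsto lam atTop (𝓝 lam0)) (h : ∀ k, Hardy p (lam k) (T k) (F k)) :
    Hardy p lam0 T0 f := by
  rintro w ⟨K, hK⟩ hw0
  obtain ⟨C, hC⟩ := isCompact_Icc.exists_bound_of_continuousOn (s := Icc 0 M)
    (f := fun t => |w t| ^ p) (hK.continuous.abs.rpow_const fun _ => Or.inr hp).continuousOn
  have a := tendsto_intervalIntegral_weight (M := M) (h := fun t => |w t| ^ p)
    (hK.continuous.abs.rpow_const fun _ => Or.inr hp).measurable hC hF hB hlim hT hT0
  have b := tendsto_intervalIntegral_weight (M := M) (C := (K:ℝ) ^ p)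
    (h := fun t => |deriv w t| ^ p)
    (((measurable_deriv w).abs).pow_const p) (fun t _ => by
      have h2 : |deriv w t| ≤ K := by
        have := norm_deriv_le_of_lipschitz (x₀ := t) hK
        simpa using this
      rw [abs_of_nonneg (by positivity)]
      exact Real.rpow_le_rpow (abs_nonneg _) h2 hp) hF hB hlim hT hT0
  exact le_of_tendsto_of_tendsto' (hlam.mul a) b fun k => h k w ⟨K, hK⟩ hw0

/-- The weight `cn * x ^ (n - 1) * y ^ (n - 1)` on the complex plane. -/
def weight (n : ℕ) (cn : ℝ) (z : ℂ) : ℝ := cn * z.re ^ (n - 1) * z.im ^ (n - 1)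

/-- The closed first quadrant of the complex plane. -/
def quad : Set ℂ := {z | 0 ≤ z.re ∧ 0 ≤ z.im}

theorem continuous_weight (n : ℕ) (cn : ℝ) : Continuous (weight n cn) := by
  unfold weight
  fun_prop

theorem weight_nonneg {n : ℕ} {cn : ℝ} (hcn : 0 ≤ cn) {z : ℂ} (hz : z ∈ quad) :
    0 ≤ weight n cn z := by
  have := hz.1
  have := hz.2
  unfold weight
  positivity

/-- Admissible `1`-Lipschitz curves in `X` from `z0` reaching `Z` at time `T`, whose weight
satisfies the Hardy inequality with constant `lam`. -/
structure Adm (n : ℕ) (cn p lam : ℝ) (X Z : Set ℂ) (z0 : ℂ) (T : ℝ) (γ : ℝ → ℂ) : Prop where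
  lip : LipschitzWith 1 γ
  start : γ 0 = z0
  mem : ∀ t, γ t ∈ X
  nonneg : 0 ≤ T
  fin : γ T ∈ Z
  hardy : Hardy p lam T (fun t => weight n cn (γ t))

theorem norm_sub_le_of_lip {γ : ℝ → ℂ} (h : LipschitzWith 1 γ) (s t : ℝ) :
    ‖γ s - γ t‖ ≤ |s - t| := by
  have := h.dist_le_mul s t
  rwa [NNReal.coe_one, one_mul, Real.dist_eq, dist_eq_norm] at this

theorem lipschitzWith_one_of_norm_sub_le {γ : ℝ → ℂ}
    (h : ∀ s t, s ≤ t → ‖γ t - γ s‖ ≤ t - s) : LipschitzWith 1 γ := by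
  refine LipschitzWith.of_dist_le_mul fun x y => ?_
  rw [NNReal.coe_one, one_mul, Real.dist_eq, dist_eq_norm]
  rcases le_total x y with hxy | hxy
  · rw [norm_sub_rev, abs_sub_comm, abs_of_nonneg (by linarith)]
    exact h x y hxy
  · rw [abs_of_nonneg (by linarith)]
    exact h y x hxy

theorem Adm.continuous_weight_comp {n : ℕ} {cn : ℝ} {γ : ℝ → ℂ} (h : LipschitzWith 1 γ) :
    Continuous (fun t => weight n cn (γ t)) :=
  (continuous_weight n cn).comp h.continuous

/-- Compactness of the admissible classes. -/
theorem Adm.exists_limit {n : ℕ} {cn p : ℝ} (hp : 0 ≤ p) {X Z : Set ℂ} (hX : IsClosed X)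
    (hZ : IsClosed Z) {z0 : ℂ} {M : ℝ} {T lam : ℕ → ℝ} {lam0 : ℝ} {γ : ℕ → ℝ → ℂ}
    (h : ∀ k, Adm n cn p (lam k) X Z z0 (T k) (γ k)) (hM : ∀ k, T k ≤ M)
    (hlam : Tendsto lam atTop (𝓝 lam0)) :
    ∃ T0 γ0, Adm n cn p lam0 X Z z0 T0 γ0 ∧ ∃ φ : ℕ → ℕ, StrictMono φ ∧
      Tendsto (T ∘ φ) atTop (𝓝 T0) := by
  have hM0 : 0 ≤ M := (h 0).nonneg.trans (hM 0)
  obtain ⟨T0, hT0M, φ, hφ, hT0⟩ := isCompact_Icc.tendsto_subseq (s := Icc 0 M)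
    (fun k => ⟨(h k).nonneg, hM k⟩)
  have hb : ∀ k, ∀ t ∈ Icc 0 M, ‖γ k t‖ ≤ ‖z0‖ + M := by
    intro k t ht
    have := norm_sub_le_of_lip (h k).lip t 0
    rw [(h k).start, sub_zero, abs_of_nonneg ht.1] at this
    have h2 := norm_le_norm_add_norm_sub' (γ k t) z0
    linarith [ht.2]
  let g : ℕ → BoundedContinuousFunction (Icc 0 M) ℂ := fun k =>
    BoundedContinuousFunction.mkOfCompact ⟨fun t => γ k t, (h k).lip.continuous.comp
      continuous_subtype_val⟩
  have hcomp : IsCompact (closure (range g)) := by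
    refine BoundedContinuousFunction.arzela_ascoli (Metric.closedBall (0:ℂ) (‖z0‖ + M))
      (isCompact_closedBall _ _) _ ?_ ?_
    · rintro f t ⟨k, rfl⟩
      rw [mem_closedBall_zero_iff]
      exact hb k t t.2
    · refine Metric.equicontinuous_of_continuity_modulus id tendsto_id _ ?_
      rintro x y ⟨f, k, rfl⟩
      have := (h k).lip.dist_le_mul x y
      simpa [g, Subtype.dist_eq] using this
  obtain ⟨g0, -, ψ, hψ, hg0⟩ := hcomp.tendsto_subseq
    (fun k => subset_closure (mem_range_self (φ k)))
  have hlimIcc : ∀ t : Icc 0 M, Tendsto (fun k => γ (φ (ψ k)) t) atTop (𝓝 (g0 t)) := by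
    intro t
    have :=
      ((continuous_eval_const (F := BoundedContinuousFunction (Icc 0 M) ℂ) t).tendsto g0).comp hg0
    simpa [g, Function.comp_def] using this
  set γ0 : ℝ → ℂ := IccExtend hM0 g0 with hγ0
  have hγ0t : ∀ t, γ0 t = g0 (projIcc 0 M hM0 t) := fun t => rfl
  have hlim : ∀ t ∈ Icc 0 M, Tendsto (fun k => γ (φ (ψ k)) t) atTop (𝓝 (γ0 t)) := by
    intro t ht
    rw [hγ0t, projIcc_of_mem hM0 ht]
    exact hlimIcc ⟨t, ht⟩
  have hlip : LipschitzWith 1 γ0 := by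
    have l0 : LipschitzWith 1 g0 := by
      refine LipschitzWith.of_dist_le_mul fun x y => ?_
      refine le_of_tendsto' ((hlimIcc x).dist (hlimIcc y)) fun k => ?_
      exact (h (φ (ψ k))).lip.dist_le_mul x y
    have := l0.comp (LipschitzWith.projIcc hM0)
    rwa [mul_one] at this
  have hT0' : Tendsto (T ∘ (φ ∘ ψ)) atTop (𝓝 T0) := hT0.comp hψ.tendsto_atTop
  refine ⟨T0, γ0, ⟨hlip, ?_, ?_, hT0M.1, ?_, ?_⟩, φ ∘ ψ, hφ.comp hψ, hT0'⟩
  · refine tendsto_nhds_unique (hlim 0 ⟨le_rfl, hM0⟩) ?_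
    simp only [(h _).start]
    exact tendsto_const_nhds
  · intro t
    exact hX.mem_of_tendsto (hlimIcc (projIcc 0 M hM0 t))
      (Eventually.of_forall fun k => (h _).mem _)
  · refine hZ.mem_of_tendsto (b := atTop) (f := fun k => γ (φ (ψ k)) (T (φ (ψ k)))) ?_
      (Eventually.of_forall fun k => (h _).fin)
    have h1 := hlim T0 hT0M
    rw [← sub_zero (γ0 T0)]
    have h2 : Tendsto (fun k => γ (φ (ψ k)) T0 - γ (φ (ψ k)) (T (φ (ψ k)))) atTop (𝓝 0) := by
      refine squeeze_zero_norm (a := fun k => |T0 - T (φ (ψ k))|)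
        (fun k => norm_sub_le_of_lip (h _).lip _ _) ?_
      have := (tendsto_const_nhds (x := T0)).sub hT0'
      rw [sub_self] at this
      simpa using this.abs
    simpa using h1.sub h2
  · obtain ⟨B, hB⟩ := (isCompact_closedBall (0:ℂ) (‖z0‖ + M)).exists_bound_of_continuousOn
      (continuous_weight n cn).continuousOn
    refine Hardy.of_tendsto hp (M := M) (B := B) (F := fun k t => weight n cn (γ (φ (ψ k)) t))
      (T := T ∘ (φ ∘ ψ)) (lam := lam ∘ (φ ∘ ψ))
      (fun k => Adm.continuous_weight_comp (h _).lip) (fun k t ht => ?_) (fun t ht => ?_)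
      (fun k => ⟨(h _).nonneg, hM _⟩) hT0' (hlam.comp (hφ.comp hψ).tendsto_atTop)
      (fun k => (h _).hardy)
    · exact hB _ (by rw [mem_closedBall_zero_iff]; exact hb _ t ht)
    · exact ((continuous_weight n cn).tendsto _).comp (hlim t ht)

/-- Admissible curves of minimal length exist. -/
theorem Adm.exists_minimal {n : ℕ} {cn p : ℝ} (hp : 0 ≤ p) {X Z : Set ℂ} (hX : IsClosed X)
    (hZ : IsClosed Z) {z0 : ℂ} {lam T1 : ℝ} {γ1 : ℝ → ℂ} (h1 : Adm n cn p lam X Z z0 T1 γ1) :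
    ∃ T γ, Adm n cn p lam X Z z0 T γ ∧ ∀ T' γ', Adm n cn p lam X Z z0 T' γ' → T ≤ T' := by
  set S : Set ℝ := {T | ∃ γ, Adm n cn p lam X Z z0 T γ}
  have hS : S.Nonempty := ⟨T1, γ1, h1⟩
  have hbd : BddBelow S := ⟨0, fun T ⟨γ, hγ⟩ => hγ.nonneg⟩
  obtain ⟨u, hu, hulim, huS⟩ := exists_seq_tendsto_sInf hS hbd
  choose γ hγ using huS
  obtain ⟨T0, γ0, h0, φ, hφ, hφlim⟩ := Adm.exists_limit hp hX hZ hγ (M := u 0)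
    (fun k => hu (Nat.zero_le k)) (tendsto_const_nhds (x := lam))
  have hT0 : T0 = sInf S := tendsto_nhds_unique hφlim (hulim.comp hφ.tendsto_atTop)
  exact ⟨T0, γ0, h0, fun _ S hS => hT0 ▸ csInf_le hbd ⟨S, hS⟩⟩

/-- Concatenation of two curves at time `s`. -/
def glue (s : ℝ) (f g : ℝ → ℂ) (t : ℝ) : ℂ := if t ≤ s then f t else g t

theorem glue_of_le {s : ℝ} {f g : ℝ → ℂ} {t : ℝ} (h : t ≤ s) : glue s f g t = f t := if_pos h

theorem glue_of_ge {s : ℝ} {f g : ℝ → ℂ} (hfg : f s = g s) {t : ℝ} (h : s ≤ t) :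
    glue s f g t = g t := by
  rcases h.eq_or_lt with rfl | h
  · rw [glue_of_le le_rfl, hfg]
  · exact if_neg (not_le.2 h)

theorem glue_norm_sub_le {s : ℝ} {f g : ℝ → ℂ} (hfg : f s = g s)
    (hf : ∀ a b, a ≤ b → b ≤ s → ‖f b - f a‖ ≤ b - a)
    (hg : ∀ a b, s ≤ a → a ≤ b → ‖g b - g a‖ ≤ b - a) : LipschitzWith 1 (glue s f g) := by
  refine lipschitzWith_one_of_norm_sub_le fun a b hab => ?_
  rcases le_total b s with hb | hb
  · rw [glue_of_le hb, glue_of_le (hab.trans hb)]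
    exact hf a b hab hb
  rcases le_total a s with ha | ha
  · rw [glue_of_le ha, glue_of_ge hfg hb]
    have := norm_add_le (g b - g s) (f s - f a)
    rw [← hfg, sub_add_sub_cancel] at this
    rw [hfg] at this
    have h1 := hf a s ha le_rfl
    have h2 := hg s b le_rfl hb
    rw [hfg] at h1
    linarith
  · rw [glue_of_ge hfg ha, glue_of_ge hfg hb]
    exact hg a b ha hab

theorem lipschitzWith_glue {s : ℝ} {f g : ℝ → ℂ} (hfg : f s = g s)
    (hf : LipschitzWith 1 f) (hg : LipschitzWith 1 g) : LipschitzWith 1 (glue s f g) := by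
  refine glue_norm_sub_le hfg (fun a b hab _ => ?_) (fun a b _ hab => ?_)
  · simpa [abs_of_nonneg (sub_nonneg.2 hab)] using norm_sub_le_of_lip hf b a
  · simpa [abs_of_nonneg (sub_nonneg.2 hab)] using norm_sub_le_of_lip hg b a

theorem weight_le_of_ratio {n : ℕ} {cn a : ℝ} (hcn : 0 ≤ cn) (ha : 0 ≤ a) {z z' : ℂ}
    (hz : z ∈ quad) (hz' : z' ∈ quad) (hre : z'.re ≤ (1 + a) * z.re)
    (him : z'.im ≤ (1 + a) * z.im) :
    weight n cn z' ≤ (1 + a) ^ (2 * (n - 1)) * weight n cn z := by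
  unfold weight
  have h1 := pow_le_pow_left₀ hz'.1 hre (n - 1)
  have h2 := pow_le_pow_left₀ hz'.2 him (n - 1)
  have h0 := hz'.2
  have h00 := hz.1
  calc cn * z'.re ^ (n - 1) * z'.im ^ (n - 1)
      ≤ cn * ((1 + a) * z.re) ^ (n - 1) * ((1 + a) * z.im) ^ (n - 1) := by gcongr
    _ = _ := by rw [mul_pow, mul_pow, two_mul, pow_add]; ring

/-- An admissible curve of minimal length. -/
structure Mini (n : ℕ) (cn p lam : ℝ) (X Z : Set ℂ) (z0 : ℂ) (T : ℝ) (γ : ℝ → ℂ) : Prop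
    extends Adm n cn p lam X Z z0 T γ where
  time_le : ∀ T' γ', Adm n cn p lam X Z z0 T' γ' → T ≤ T'

theorem Mini.notMem {n : ℕ} {cn p lam : ℝ} {X Z : Set ℂ} {z0 : ℂ} {T : ℝ} {γ : ℝ → ℂ}
    (hcn : 0 ≤ cn) (hp : 0 < p) (hlam : 0 ≤ lam) (hX : X ⊆ quad)
    (h : Mini n cn p lam X Z z0 T γ) {t : ℝ} (ht : 0 ≤ t) (htT : t < T) : γ t ∉ Z := fun hZ =>
  absurd (h.time_le t γ ⟨h.lip, h.start, h.mem, ht, hZ, h.hardy.mono_time hp hlam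
    (Adm.continuous_weight_comp h.lip) (fun _ => weight_nonneg hcn (hX (h.mem _))) ht htT.le⟩)
    (not_le.2 htT)

theorem Mini.injOn {n : ℕ} {cn p lam : ℝ} {X Z : Set ℂ} {z0 : ℂ} {T : ℝ} {γ : ℝ → ℂ}
    (hcn : 0 ≤ cn) (hp : 1 < p) (hlam : 0 ≤ lam) (hX : X ⊆ quad)
    (h : Mini n cn p lam X Z z0 T γ) : InjOn γ (Icc 0 T) := by
  have key : ∀ s t, 0 ≤ s → s < t → t ≤ T → γ s ≠ γ t := by
    intro s t hs hst htT heq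
    have hl : 0 < t - s := by linarith
    have hshift : LipschitzWith 1 (fun τ => γ (τ + (t - s))) :=
      lipschitzWith_one_of_norm_sub_le fun a b hab => by
        have := norm_sub_le_of_lip h.lip (b + (t - s)) (a + (t - s))
        rwa [add_sub_add_right_eq_sub, abs_of_nonneg (by linarith)] at this
    have hgl : γ s = (fun τ => γ (τ + (t - s))) s := by
      simp only [heq]; congr 1; ring
    have hlip := lipschitzWith_glue hgl h.lip hshift
    refine absurd (h.time_le (T - (t - s) + 0) (glue s γ fun τ => γ (τ + (t - s)))
      ⟨hlip, ?_, ?_, by linarith, ?_, ?_⟩) (not_le.2 (by linarith))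
    · rw [glue_of_le hs, h.start]
    · intro τ
      unfold glue
      split_ifs
      exacts [h.mem _, h.mem _]
    · rw [glue_of_ge hgl (by linarith)]
      have : T - (t - s) + 0 + (t - s) = T := by ring
      simp only [this]
      exact h.fin
    · refine Hardy.squeeze hp.le hlam (Adm.continuous_weight_comp h.lip)
        (Adm.continuous_weight_comp hlip) h.hardy hs hl (by linarith) le_rfl ?_ ?_ ?_ ?_
      · intro τ hτ
        rw [glue_of_le hτ.2]
      · intro τ hτ
        have e : τ - (t - s) + 0 + (t - s) = τ := by ring
        rw [glue_of_ge hgl (by linarith [hτ.1])]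
        simp only [e]
      · intro τ hτ
        rw [zero_div, Real.zero_rpow (by linarith), zero_mul]
        refine weight_nonneg hcn (hX ?_)
        unfold glue
        split_ifs
        exacts [h.mem _, h.mem _]
      · intro τ hτ
        rw [zero_div, zero_mul]
        exact weight_nonneg hcn (hX (h.mem _))
  intro s hs t ht heq
  rcases lt_trichotomy s t with hst | hst | hst
  · exact absurd heq (key s t hs.1 hst ht.2)
  · exact hst
  · exact absurd heq.symm (key t s ht.1 hst hs.2)

/-- Minimal curves deviate from their chords by a quadratic amount only. -/
theorem Mini.chord {n : ℕ} {cn p lam : ℝ} {X Z : Set ℂ} {z0 : ℂ} {T : ℝ} {γ : ℝ → ℂ}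
    (hn : 1 ≤ n) (hcn : 0 ≤ cn) (hp : 2 ≤ p) (hlam : 0 ≤ lam) (hX : X ⊆ quad)
    (hconv : Convex ℝ X) (h : Mini n cn p lam X Z z0 T γ) {s t m : ℝ} (hs : 0 ≤ s) (hst : s ≤ t)
    (htT : t ≤ T) (hm : 0 < m) (hre : m ≤ (γ s).re) (him : m ≤ (γ s).im)
    (hl : t - s ≤ m / 2) :
    (t - s) * (1 - 8 * n / m * (t - s)) ≤ ‖γ t - γ s‖ := by
  by_contra! hlt
  rcases hst.eq_or_lt with rfl | hst
  · simp at hlt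
  set l := t - s with hldef
  have hl0 : 0 < l := by simp only [hldef]; linarith
  set q := 1 - 8 * n / m * l with hq
  have hn1 : (1:ℝ) ≤ n := by exact_mod_cast hn
  have hlq : 0 < l * q := (norm_nonneg _).trans_lt hlt
  have hq0 : 0 < q := (pos_iff_pos_of_mul_pos hlq).1 hl0
  have hq1 : q < 1 := by
    have : 0 < 8 * n / m * l := by positivity
    simp only [hq]; linarith
  set d := l * q with hd
  have hdl : d < l := by simp only [hd]; nlinarith
  have hdq : d / l = q := by simp only [hd]; field_simp
  set line : ℝ → ℂ := fun τ => γ s + (((τ - s) / d : ℝ) : ℂ) * (γ t - γ s) with hline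
  have hlines : γ s = line s := by simp [hline]
  have hlip_line : LipschitzWith 1 line := lipschitzWith_one_of_norm_sub_le fun a b hab => by
    have : line b - line a = (((b - a) / d : ℝ) : ℂ) * (γ t - γ s) := by
      simp only [hline]; push_cast; ring
    rw [this, norm_mul, Complex.norm_real, Real.norm_eq_abs, abs_of_nonneg (by
      apply div_nonneg <;> linarith), div_mul_eq_mul_div, div_le_iff₀ hlq]
    apply mul_le_mul_of_nonneg_left hlt.le; linarith
  set sh : ℝ → ℂ := fun τ => γ (τ - d + l) with hsh
  have hlip_sh : LipschitzWith 1 sh := lipschitzWith_one_of_norm_sub_le fun a b hab => by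
    have := norm_sub_le_of_lip h.lip (b - d + l) (a - d + l)
    rwa [add_sub_add_right_eq_sub, sub_sub_sub_cancel_right, abs_of_nonneg (by linarith)] at this
  have hg2 : line (s + d) = sh (s + d) := by
    have e1 : s + d - d + l = t := by simp only [hldef]; ring
    simp only [hline, hsh, e1, add_sub_cancel_left, div_self hlq.ne']
    simp
  set γ2 := glue (s + d) line sh with hγ2
  have hg1 : γ s = γ2 s := by rw [hγ2, glue_of_le (by linarith)]; exact hlines
  have hlip2 : LipschitzWith 1 γ2 := lipschitzWith_glue hg2 hlip_line hlip_sh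
  set γ1 := glue s γ γ2 with hγ1
  have hlip1 : LipschitzWith 1 γ1 := lipschitzWith_glue hg1 h.lip hlip2
  have hmem : ∀ τ, γ1 τ ∈ X := by
    intro τ
    rcases le_total τ s with h1 | h1
    · rw [hγ1, glue_of_le h1]; exact h.mem _
    rcases le_total τ (s + d) with h2 | h2
    · rw [hγ1, glue_of_ge hg1 h1, hγ2, glue_of_le h2]
      have := hconv.add_smul_sub_mem (h.mem s) (h.mem t) (t := (τ - s) / d)
        ⟨div_nonneg (by linarith) hlq.le, (div_le_one hlq).2 (by linarith)⟩
      rwa [Complex.real_smul] at this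
    · rw [hγ1, glue_of_ge hg1 h1, hγ2, glue_of_ge hg2 h2]; exact h.mem _
  have ratio : ∀ z z' : ℂ, z ∈ quad → z' ∈ quad → ‖z - γ s‖ ≤ l → ‖z' - γ s‖ ≤ l →
      q * weight n cn z' ≤ weight n cn z := by
    intro z z' hz hz' h1 h2
    have a1 := (Complex.abs_re_le_norm (z - γ s)).trans h1
    have a2 := (Complex.abs_im_le_norm (z - γ s)).trans h1
    have a3 := (Complex.abs_re_le_norm (z' - γ s)).trans h2
    have a4 := (Complex.abs_im_le_norm (z' - γ s)).trans h2
    rw [Complex.sub_re, abs_le] at a1 a3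
    rw [Complex.sub_im, abs_le] at a2 a4
    have hml : 4 * l / m * m = 4 * l := by field_simp
    have hlm0 : 0 ≤ 4 * l / m := by positivity
    have b1 : z'.re ≤ (1 + 4 * l / m) * z.re := by
      have : m / 2 ≤ z.re := by linarith
      nlinarith
    have b2 : z'.im ≤ (1 + 4 * l / m) * z.im := by
      have : m / 2 ≤ z.im := by linarith
      nlinarith
    have b3 := weight_le_of_ratio (n := n) hcn hlm0 hz hz' b1 b2
    have b4 : q * (1 + 4 * l / m) ^ (2 * (n - 1)) ≤ 1 := by
      have c1 : q ≤ Real.exp (-(8 * n / m * l)) := by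
        have := Real.add_one_le_exp (-(8 * n / m * l))
        simp only [hq]; linarith
      have c2 : (1 + 4 * l / m) ^ (2 * (n - 1)) ≤ Real.exp (8 * n / m * l) := by
        have c3 : 1 + 4 * l / m ≤ Real.exp (4 * l / m) := by
          have := Real.add_one_le_exp (4 * l / m)
          linarith
        refine (pow_le_pow_left₀ (by linarith) c3 _).trans ?_
        rw [← Real.exp_nat_mul]
        apply Real.exp_le_exp.2
        have c4 : ((2 * (n - 1) : ℕ) : ℝ) ≤ 2 * n := by
          have : 2 * (n - 1) ≤ 2 * n := by omega
          exact_mod_cast this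
        calc ((2 * (n - 1) : ℕ) : ℝ) * (4 * l / m) ≤ 2 * n * (4 * l / m) :=
              mul_le_mul_of_nonneg_right c4 hlm0
          _ = _ := by ring
      calc q * (1 + 4 * l / m) ^ (2 * (n - 1))
          ≤ Real.exp (-(8 * n / m * l)) * Real.exp (8 * n / m * l) :=
            mul_le_mul c1 c2 (by positivity) (Real.exp_pos _).le
        _ = 1 := by rw [← Real.exp_add]; simp
    have b5 := weight_nonneg (n := n) hcn hz
    calc q * weight n cn z' ≤ q * ((1 + 4 * l / m) ^ (2 * (n - 1)) * weight n cn z) :=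
          mul_le_mul_of_nonneg_left b3 hq0.le
      _ = (q * (1 + 4 * l / m) ^ (2 * (n - 1))) * weight n cn z := by ring
      _ ≤ 1 * weight n cn z := mul_le_mul_of_nonneg_right b4 b5
      _ = _ := one_mul _
  have near1 : ∀ τ ∈ Icc s (s + l), ‖γ τ - γ s‖ ≤ l := fun τ hτ => by
    have := norm_sub_le_of_lip h.lip τ s
    rw [abs_of_nonneg (by linarith [hτ.1])] at this
    linarith [hτ.2]
  have near2 : ∀ τ ∈ Icc s (s + l), ‖γ1 (s + d / l * (τ - s)) - γ s‖ ≤ l := fun τ hτ => by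
    have h0 : 0 ≤ q * (τ - s) := mul_nonneg hq0.le (by linarith [hτ.1])
    have h1 : γ1 s = γ s := by rw [hγ1, glue_of_le le_rfl]
    have := norm_sub_le_of_lip hlip1 (s + d / l * (τ - s)) s
    rw [h1, hdq, add_sub_cancel_left, abs_of_nonneg h0] at this
    rw [hdq]
    nlinarith [hτ.2]
  refine absurd (h.time_le (T - l + d) γ1 ⟨hlip1, ?_, hmem, by simp only [hldef]; linarith, ?_, ?_⟩)
    (not_le.2 (by linarith))
  · rw [hγ1, glue_of_le hs, h.start]
  · rw [hγ1, glue_of_ge hg1 (by simp only [hldef]; linarith), hγ2,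
      glue_of_ge hg2 (by simp only [hldef]; linarith)]
    have : T - l + d - d + l = T := by ring
    simp only [hsh, this]
    exact h.fin
  · refine Hardy.squeeze (by linarith) hlam (Adm.continuous_weight_comp h.lip)
      (Adm.continuous_weight_comp hlip1) h.hardy hs hl0 (by simp only [hldef]; linarith) hlq.le
      ?_ ?_ ?_ ?_
    · intro τ hτ
      rw [hγ1, glue_of_le hτ.2]
    · intro τ hτ
      rw [hγ1, glue_of_ge hg1 (by linarith [hτ.1]), hγ2, glue_of_ge hg2 (by linarith [hτ.1])]
      have : τ - l + d - d + l = τ := by ring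
      simp only [hsh, this]
    · intro τ hτ
      have h1 := ratio _ _ (hX (hmem (s + d / l * (τ - s)))) (hX (h.mem τ)) (near2 τ hτ)
        (near1 τ hτ)
      refine le_trans (mul_le_mul_of_nonneg_right ?_ (weight_nonneg hcn (hX (h.mem τ)))) h1
      rw [hdq]
      calc q ^ (p - 1) ≤ q ^ (1:ℝ) :=
            Real.rpow_le_rpow_of_exponent_ge hq0 hq1.le (by linarith)
        _ = q := Real.rpow_one q
    · intro τ hτ
      have h1 := ratio _ _ (hX (h.mem τ)) (hX (hmem (s + d / l * (τ - s)))) (near1 τ hτ)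
        (near2 τ hτ)
      rwa [hdq] at h1 ⊢

/-- The boundary of the first quadrant. -/
def bdry : Set ℂ := {z | z ∈ quad ∧ z.re * z.im = 0}

/-- The closed wedge `0 ≤ y ≤ x`. -/
def wedge : Set ℂ := {z | 0 ≤ z.im ∧ z.im ≤ z.re}

theorem wedge_subset_quad : wedge ⊆ quad := fun _ hz => ⟨hz.1.trans hz.2, hz.1⟩

theorem isClosed_quad : IsClosed quad :=
  (isClosed_le continuous_const Complex.continuous_re).inter
    (isClosed_le continuous_const Complex.continuous_im)

theorem isClosed_bdry : IsClosed bdry :=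
  isClosed_quad.inter (isClosed_eq (Complex.continuous_re.mul Complex.continuous_im)
    continuous_const)

theorem convex_quad : Convex ℝ quad := by
  intro x hx y hy a b ha hb _
  have := hx.1
  have := hx.2
  have := hy.1
  have := hy.2
  constructor
  · simp only [Complex.add_re, Complex.real_smul, Complex.re_ofReal_mul]; positivity
  · simp only [Complex.add_im, Complex.real_smul, Complex.im_ofReal_mul]; positivity

theorem weight_eq (n : ℕ) (cn : ℝ) (z : ℂ) : weight n cn z = cn * (z.re * z.im) ^ (n - 1) := by
  unfold weight
  rw [mul_pow, mul_assoc]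

theorem normSq_sub_eq (z w : ℂ) : ‖z - w‖ ^ 2 = (z.re - w.re) ^ 2 + (z.im - w.im) ^ 2 := by
  rw [← Complex.normSq_eq_norm_sq, Complex.normSq_apply]
  simp only [Complex.sub_re, Complex.sub_im]
  ring

theorem norm_sub_le_norm_sub {z w z' w' : ℂ}
    (h : (z'.re - w'.re) ^ 2 + (z'.im - w'.im) ^ 2 ≤ (z.re - w.re) ^ 2 + (z.im - w.im) ^ 2) :
    ‖z' - w'‖ ≤ ‖z - w‖ := by
  refine le_of_sq_le_sq ?_ (norm_nonneg _) 
  rwa [normSq_sub_eq, normSq_sub_eq]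

/-- Modification of an admissible curve preserving the product of the coordinates. -/
theorem Adm.of_mul_eq {n : ℕ} {cn p lam : ℝ} {z0 : ℂ} {T : ℝ} {γ γ' : ℝ → ℂ}
    (h : Adm n cn p lam quad bdry z0 T γ) (hlip : LipschitzWith 1 γ') (h0 : γ' 0 = z0)
    (hmem : ∀ t, γ' t ∈ quad) (hv : ∀ t, (γ' t).re * (γ' t).im = (γ t).re * (γ t).im) :
    Adm n cn p lam quad bdry z0 T γ' where
  lip := hlip
  start := h0
  mem := hmem
  nonneg := h.nonneg
  fin := ⟨hmem T, by rw [hv]; exact h.fin.2⟩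
  hardy := h.hardy.congr h.nonneg fun t _ => by simp only [weight_eq, hv]

/-- Reflection of the quadrant into the wedge. -/
def foldDiag (z : ℂ) : ℂ := ⟨max z.re z.im, min z.re z.im⟩

theorem norm_foldDiag_sub_le (z w : ℂ) : ‖foldDiag z - foldDiag w‖ ≤ ‖z - w‖ := by
  apply norm_sub_le_norm_sub
  simp only [foldDiag]
  rcases le_total z.re z.im with h1 | h1 <;> rcases le_total w.re w.im with h2 | h2 <;>
    simp only [h1, h2, max_eq_left, max_eq_right, min_eq_left, min_eq_right] <;> nlinarith

theorem Adm.exists_wedge {n : ℕ} {cn p lam R : ℝ} {T : ℝ} {γ : ℝ → ℂ}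
    (h : Adm n cn p lam quad bdry ⟨R, R⟩ T γ) :
    ∃ γ', Adm n cn p lam quad bdry ⟨R, R⟩ T γ' ∧ ∀ t, γ' t ∈ wedge := by
  have hw : ∀ t, foldDiag (γ t) ∈ wedge := fun t =>
    ⟨le_min (h.mem t).1 (h.mem t).2, min_le_max⟩
  refine ⟨fun t => foldDiag (γ t), h.of_mul_eq ?_ ?_ (fun t => wedge_subset_quad (hw t)) ?_, hw⟩
  · refine lipschitzWith_one_of_norm_sub_le fun s t hst => ?_
    have := norm_sub_le_of_lip h.lip t s
    rw [abs_of_nonneg (by linarith)] at this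
    exact (norm_foldDiag_sub_le _ _).trans this
  · rw [h.start]; simp [foldDiag]
  · intro t
    simp only [foldDiag]
    rw [max_mul_min]

theorem dist_sq_le_of_hyperbolic {a b c d a' b' c' d' : ℝ}
    (ha' : 0 ≤ a') (hb' : 0 ≤ b') (hc' : 0 ≤ c') (hd' : 0 ≤ d')
    (hv1 : a' * b' = a * b) (hv2 : c' * d' = c * d)
    (hu1 : 0 ≤ a ^ 2 - b ^ 2) (hu2 : 0 ≤ c ^ 2 - d ^ 2)
    (h1 : a ^ 2 - b ^ 2 ≤ a' ^ 2 - b' ^ 2) (h2 : c ^ 2 - d ^ 2 ≤ c' ^ 2 - d' ^ 2)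
    (h12 : ((a' ^ 2 - b' ^ 2) - (c' ^ 2 - d' ^ 2)) ^ 2 ≤
      ((a ^ 2 - b ^ 2) - (c ^ 2 - d ^ 2)) ^ 2) :
    (a' - c') ^ 2 + (b' - d') ^ 2 ≤ (a - c) ^ 2 + (b - d) ^ 2 := by
  have r1 : a ^ 2 + b ^ 2 ≤ a' ^ 2 + b' ^ 2 := by
    refine le_of_sq_le_sq ?_ (by positivity)
    have e1 : (a ^ 2 + b ^ 2) ^ 2 = (a ^ 2 - b ^ 2) ^ 2 + 4 * (a * b) ^ 2 := by ring
    have e2 : (a' ^ 2 + b' ^ 2) ^ 2 = (a' ^ 2 - b' ^ 2) ^ 2 + 4 * (a' * b') ^ 2 := by ring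
    rw [e1, e2, hv1]
    have := pow_le_pow_left₀ hu1 h1 2
    linarith
  have r2 : c ^ 2 + d ^ 2 ≤ c' ^ 2 + d' ^ 2 := by
    refine le_of_sq_le_sq ?_ (by positivity)
    have e1 : (c ^ 2 + d ^ 2) ^ 2 = (c ^ 2 - d ^ 2) ^ 2 + 4 * (c * d) ^ 2 := by ring
    have e2 : (c' ^ 2 + d' ^ 2) ^ 2 = (c' ^ 2 - d' ^ 2) ^ 2 + 4 * (c' * d') ^ 2 := by ring
    rw [e1, e2, hv2]
    have := pow_le_pow_left₀ hu2 h2 2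
    linarith
  have r3 : a * c + b * d ≤ a' * c' + b' * d' := by
    refine le_of_sq_le_sq ?_ (by positivity)
    have e1 : (a * c + b * d) ^ 2 = ((a ^ 2 + b ^ 2) * (c ^ 2 + d ^ 2) +
      (a ^ 2 - b ^ 2) * (c ^ 2 - d ^ 2)) / 2 + 2 * (a * b) * (c * d) := by ring
    have e2 : (a' * c' + b' * d') ^ 2 = ((a' ^ 2 + b' ^ 2) * (c' ^ 2 + d' ^ 2) +
      (a' ^ 2 - b' ^ 2) * (c' ^ 2 - d' ^ 2)) / 2 + 2 * (a' * b') * (c' * d') := by ring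
    rw [e1, e2, hv1, hv2]
    have q1 := mul_le_mul r1 r2 (by positivity) (by positivity)
    have q2 := mul_le_mul h1 h2 hu2 (hu1.trans h1)
    linarith
  set S := (a + c) ^ 2 + (b + d) ^ 2
  set S' := (a' + c') ^ 2 + (b' + d') ^ 2
  have hSS : S ≤ S' := by simp only [S, S']; nlinarith
  have hS'0 : 0 ≤ S' := by positivity
  have hprod : ((a' - c') ^ 2 + (b' - d') ^ 2) * S' ≤ ((a - c) ^ 2 + (b - d) ^ 2) * S := by
    have e1 : ((a - c) ^ 2 + (b - d) ^ 2) * S =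
      ((a ^ 2 - b ^ 2) - (c ^ 2 - d ^ 2)) ^ 2 + 4 * (a * b - c * d) ^ 2 := by simp only [S]; ring
    have e2 : ((a' - c') ^ 2 + (b' - d') ^ 2) * S' =
      ((a' ^ 2 - b' ^ 2) - (c' ^ 2 - d' ^ 2)) ^ 2 + 4 * (a' * b' - c' * d') ^ 2 := by
      simp only [S']; ring
    rw [e1, e2, hv1, hv2]
    linarith
  rcases hS'0.eq_or_lt with h0 | h0
  · have z1 : a' + c' = 0 := by
      have : (a' + c') ^ 2 = 0 := by
        have := sq_nonneg (b' + d'); have := sq_nonneg (a' + c'); simp only [S'] at h0; linarith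
      exact pow_eq_zero_iff two_ne_zero |>.1 this
    have z2 : b' + d' = 0 := by
      have : (b' + d') ^ 2 = 0 := by
        have := sq_nonneg (b' + d'); have := sq_nonneg (a' + c'); simp only [S'] at h0; linarith
      exact pow_eq_zero_iff two_ne_zero |>.1 this
    have : a' = 0 := by linarith
    have : c' = 0 := by linarith
    have : b' = 0 := by linarith
    have : d' = 0 := by linarith
    subst_vars
    simp only [sub_zero, ne_eq, OfNat.ofNat_ne_zero, not_false_eq_true, zero_pow, add_zero]
    positivity
  · refine le_of_mul_le_mul_right (hprod.trans ?_) h0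
    exact mul_le_mul_of_nonneg_left hSS (by positivity)

/-- The point of the wedge with given values of `x ^ 2 - y ^ 2 = 2 u` and `x * y = v`. -/
def hyperbolicPoint (u v : ℝ) : ℂ :=
  ⟨√(√(u ^ 2 + v ^ 2) + u), √(√(u ^ 2 + v ^ 2) - u)⟩

theorem abs_le_sqrt_sq_add (u v : ℝ) : |u| ≤ √(u ^ 2 + v ^ 2) := by
  apply Real.abs_le_sqrt
  have := sq_nonneg v
  linarith

theorem hyperbolicPoint_mul {u v : ℝ} (hv : 0 ≤ v) :
    (hyperbolicPoint u v).re * (hyperbolicPoint u v).im = v := by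
  have h := abs_le.1 (abs_le_sqrt_sq_add u v)
  simp only [hyperbolicPoint]
  rw [← Real.sqrt_mul (by linarith)]
  have : (√(u ^ 2 + v ^ 2) + u) * (√(u ^ 2 + v ^ 2) - u) = v ^ 2 := by
    have := Real.sq_sqrt (by positivity : 0 ≤ u ^ 2 + v ^ 2)
    linarith
  rw [this, Real.sqrt_sq hv]

theorem hyperbolicPoint_sq_sub (u v : ℝ) :
    (hyperbolicPoint u v).re ^ 2 - (hyperbolicPoint u v).im ^ 2 = 2 * u := by
  have h := abs_le.1 (abs_le_sqrt_sq_add u v)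
  simp only [hyperbolicPoint]
  rw [Real.sq_sqrt (by linarith), Real.sq_sqrt (by linarith)]
  ring

theorem hyperbolicPoint_mem {u : ℝ} (hu : 0 ≤ u) (v : ℝ) : hyperbolicPoint u v ∈ wedge :=
  ⟨Real.sqrt_nonneg _, Real.sqrt_le_sqrt (by linarith)⟩

theorem hyperbolicPoint_self {z : ℂ} (hz : z ∈ quad) :
    hyperbolicPoint ((z.re ^ 2 - z.im ^ 2) / 2) (z.re * z.im) = z := by
  have e : ((z.re ^ 2 - z.im ^ 2) / 2) ^ 2 + (z.re * z.im) ^ 2 =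
    ((z.re ^ 2 + z.im ^ 2) / 2) ^ 2 := by ring
  apply Complex.ext
  · simp only [hyperbolicPoint, e]
    rw [Real.sqrt_sq (by positivity)]
    have : (z.re ^ 2 + z.im ^ 2) / 2 + (z.re ^ 2 - z.im ^ 2) / 2 = z.re ^ 2 := by ring
    rw [this, Real.sqrt_sq hz.1]
  · simp only [hyperbolicPoint, e]
    rw [Real.sqrt_sq (by positivity)]
    have : (z.re ^ 2 + z.im ^ 2) / 2 - (z.re ^ 2 - z.im ^ 2) / 2 = z.im ^ 2 := by ring
    rw [this, Real.sqrt_sq hz.2]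

/-- Reflection of the wedge along the hyperbola `(x ^ 2 - y ^ 2) / 2 = η`. -/
def foldHyp (η : ℝ) (z : ℂ) : ℂ :=
  hyperbolicPoint (η + |(z.re ^ 2 - z.im ^ 2) / 2 - η|) (z.re * z.im)

theorem foldHyp_mem {η : ℝ} (hη : 0 ≤ η) (z : ℂ) : foldHyp η z ∈ wedge :=
  hyperbolicPoint_mem (by positivity) _

theorem foldHyp_mul {η : ℝ} {z : ℂ} (hz : z ∈ wedge) :
    (foldHyp η z).re * (foldHyp η z).im = z.re * z.im :=
  hyperbolicPoint_mul (mul_nonneg (wedge_subset_quad hz).1 (wedge_subset_quad hz).2)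

theorem foldHyp_of_le {η : ℝ} {z : ℂ} (hz : z ∈ wedge) (h : η ≤ (z.re ^ 2 - z.im ^ 2) / 2) :
    foldHyp η z = z := by
  unfold foldHyp
  rw [abs_of_nonneg (by linarith), add_sub_cancel, hyperbolicPoint_self (wedge_subset_quad hz)]

theorem le_foldHyp {η : ℝ} (z : ℂ) :
    η ≤ ((foldHyp η z).re ^ 2 - (foldHyp η z).im ^ 2) / 2 := by
  unfold foldHyp
  rw [hyperbolicPoint_sq_sub]
  have := abs_nonneg ((z.re ^ 2 - z.im ^ 2) / 2 - η)
  linarith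

theorem norm_foldHyp_sub_le {η : ℝ} (hη : 0 ≤ η) {z w : ℂ} (hz : z ∈ wedge) (hw : w ∈ wedge) :
    ‖foldHyp η z - foldHyp η w‖ ≤ ‖z - w‖ := by
  apply norm_sub_le_norm_sub
  have mz := wedge_subset_quad (foldHyp_mem hη z)
  have mw := wedge_subset_quad (foldHyp_mem hη w)
  have uz : 0 ≤ z.re ^ 2 - z.im ^ 2 := by
    have := pow_le_pow_left₀ hz.1 hz.2 2; linarith
  have uw : 0 ≤ w.re ^ 2 - w.im ^ 2 := by
    have := pow_le_pow_left₀ hw.1 hw.2 2; linarith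
  have ez : (foldHyp η z).re ^ 2 - (foldHyp η z).im ^ 2 =
    2 * (η + |(z.re ^ 2 - z.im ^ 2) / 2 - η|) := hyperbolicPoint_sq_sub _ _
  have ew : (foldHyp η w).re ^ 2 - (foldHyp η w).im ^ 2 =
    2 * (η + |(w.re ^ 2 - w.im ^ 2) / 2 - η|) := hyperbolicPoint_sq_sub _ _
  refine dist_sq_le_of_hyperbolic mz.1 mz.2 mw.1 mw.2 (foldHyp_mul hz) (foldHyp_mul hw) uz uw
    ?_ ?_ ?_
  · rw [ez]; have := le_abs_self ((z.re ^ 2 - z.im ^ 2) / 2 - η); linarith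
  · rw [ew]; have := le_abs_self ((w.re ^ 2 - w.im ^ 2) / 2 - η); linarith
  · rw [ez, ew, ← sq_abs, ← sq_abs (z.re ^ 2 - z.im ^ 2 - (w.re ^ 2 - w.im ^ 2))]
    refine pow_le_pow_left₀ (abs_nonneg _) ?_ 2
    have h := abs_abs_sub_abs_le_abs_sub ((z.re ^ 2 - z.im ^ 2) / 2 - η)
      ((w.re ^ 2 - w.im ^ 2) / 2 - η)
    have e1 : 2 * (η + |(z.re ^ 2 - z.im ^ 2) / 2 - η|) -
        2 * (η + |(w.re ^ 2 - w.im ^ 2) / 2 - η|) =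
        2 * (|(z.re ^ 2 - z.im ^ 2) / 2 - η| - |(w.re ^ 2 - w.im ^ 2) / 2 - η|) := by ring
    have e2 : z.re ^ 2 - z.im ^ 2 - (w.re ^ 2 - w.im ^ 2) =
        2 * ((z.re ^ 2 - z.im ^ 2) / 2 - η - ((w.re ^ 2 - w.im ^ 2) / 2 - η)) := by ring
    rw [e1, e2, abs_mul, abs_mul]
    exact mul_le_mul_of_nonneg_left h (abs_nonneg _)

/-- After reaching the hyperbola `u = η` an admissible curve may be reflected along it. -/
theorem Adm.exists_foldHyp {n : ℕ} {cn p lam : ℝ} {z0 : ℂ} {T : ℝ} {γ : ℝ → ℂ}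
    (h : Adm n cn p lam quad bdry z0 T γ) (hw : ∀ t, γ t ∈ wedge) {η t1 : ℝ} (hη : 0 ≤ η)
    (ht1 : 0 ≤ t1) (hu : ((γ t1).re ^ 2 - (γ t1).im ^ 2) / 2 = η) :
    ∃ γ', Adm n cn p lam quad bdry z0 T γ' ∧ (∀ t, γ' t ∈ wedge) ∧ (∀ t ≤ t1, γ' t = γ t) ∧
      ∀ t, t1 ≤ t → η ≤ ((γ' t).re ^ 2 - (γ' t).im ^ 2) / 2 := by
  have hg : γ t1 = foldHyp η (γ t1) := (foldHyp_of_le (hw t1) hu.ge).symm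
  have hlip : LipschitzWith 1 (fun t => foldHyp η (γ t)) :=
    lipschitzWith_one_of_norm_sub_le fun s t hst => by
      have := norm_sub_le_of_lip h.lip t s
      rw [abs_of_nonneg (by linarith)] at this
      exact (norm_foldHyp_sub_le hη (hw _) (hw _)).trans this
  have hmem : ∀ t, glue t1 γ (fun t => foldHyp η (γ t)) t ∈ wedge := by
    intro t
    unfold glue
    split_ifs
    exacts [hw t, foldHyp_mem hη _]
  refine ⟨glue t1 γ (fun t => foldHyp η (γ t)), h.of_mul_eq (lipschitzWith_glue hg h.lip hlip) ?_
    (fun t => wedge_subset_quad (hmem t)) ?_, hmem, fun t ht => glue_of_le ht, fun t ht => ?_⟩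
  · rw [glue_of_le ht1, h.start]
  · intro t
    unfold glue
    split_ifs
    exacts [rfl, foldHyp_mul (hw t)]
  · rw [glue_of_ge hg ht]
    exact le_foldHyp _

/-- The diagonal ray. -/
def diagRay : Set ℂ := {z | 0 ≤ z.re ∧ z.im = z.re}

/-- The unit speed parametrization of the diagonal from `(R, R)` towards the origin. -/
def diagCurve (R τ : ℝ) : ℂ := ⟨R - τ / √2, R - τ / √2⟩

theorem diagRay_subset_quad : diagRay ⊆ quad := fun _ hz => ⟨hz.1, hz.2 ▸ hz.1⟩

theorem isClosed_diagRay : IsClosed diagRay :=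
  (isClosed_le continuous_const Complex.continuous_re).inter
    (isClosed_eq Complex.continuous_im Complex.continuous_re)

theorem convex_diagRay : Convex ℝ diagRay := by
  intro x hx y hy a b ha hb _
  have := hx.1
  have := hy.1
  have := hx.2
  have := hy.2
  constructor
  · simp only [Complex.add_re, Complex.real_smul, Complex.re_ofReal_mul]; positivity
  · simp only [Complex.add_re, Complex.add_im, Complex.real_smul, Complex.re_ofReal_mul,
      Complex.im_ofReal_mul, *]

theorem continuous_diagCurve (R : ℝ) : Continuous (diagCurve R) := by
  have : diagCurve R = fun τ => ((R - τ / √2 : ℝ) : ℂ) + ((R - τ / √2 : ℝ) : ℂ) * Complex.I := by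
    funext τ
    apply Complex.ext <;> simp [diagCurve]
  rw [this]
  fun_prop

/-- A function with quadratically small increments is constant. -/
theorem eq_of_quadratic_increments {φ : ℝ → ℝ} {T K h0 : ℝ} (hφ : Continuous φ)
    (hh0 : 0 < h0)
    (h : ∀ s t, 0 ≤ s → s ≤ t → t ≤ T → t - s ≤ h0 → |φ t - φ s| ≤ K * (t - s) ^ 2) :
    ∀ t ∈ Icc 0 T, φ t = φ 0 := by
  refine constant_of_has_deriv_right_zero hφ.continuousOn fun s hs => ?_
  rw [hasDerivWithinAt_iff_isLittleO]
  refine Asymptotics.IsBigO.trans_isLittleO (g := fun t => (t - s) ^ 2) ?_ ?_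
  · refine Asymptotics.IsBigO.of_bound K ?_
    have : Icc s (min T (s + h0)) ∈ 𝓝[Ici s] s :=
      Icc_mem_nhdsGE (lt_min hs.2 (by linarith))
    filter_upwards [this] with t ht
    have := h s t hs.1 ht.1 (ht.2.trans (min_le_left _ _))
      (by linarith [ht.2.trans (min_le_right _ _)])
    simpa using this
  · have : (fun t : ℝ => (t - s) ^ 2) =o[𝓝 s] fun t => t - s := by
      have h1 : (fun t : ℝ => (t - s) * (t - s)) =o[𝓝 s] fun t => (1:ℝ) * (t - s) := by
        refine Asymptotics.IsLittleO.mul_isBigO ?_ (Asymptotics.isBigO_refl _ _)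
        rw [Asymptotics.isLittleO_one_iff]
        have : Tendsto (fun t : ℝ => t - s) (𝓝 s) (𝓝 (s - s)) :=
          (continuous_id.sub continuous_const).tendsto s
        rwa [sub_self] at this
      simpa [sq] using h1
    exact this.mono nhdsWithin_le_nhds

theorem norm_sub_of_mem_diagRay {z w : ℂ} (hz : z ∈ diagRay) (hw : w ∈ diagRay) :
    ‖z - w‖ = √2 * |z.re - w.re| := by
  have h : ‖z - w‖ ^ 2 = (√2 * |z.re - w.re|) ^ 2 := by
    rw [normSq_sub_eq, hz.2, hw.2, mul_pow, sq_abs, Real.sq_sqrt (by norm_num)]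
    ring
  exact (sq_eq_sq₀ (norm_nonneg _) (by positivity)).1 h

/-- If some curve on the diagonal is admissible, then so is the straight one. -/
theorem hardy_diagCurve_of_adm {n : ℕ} {cn p lam R r0 : ℝ} (hn : 1 ≤ n) (hcn : 0 ≤ cn)
    (hp : 2 ≤ p) (hlam : 0 ≤ lam) (hr0 : 0 < r0) (hR : r0 < R) {T1 : ℝ} {γ1 : ℝ → ℂ}
    (h1 : Adm n cn p lam diagRay {⟨r0, r0⟩} ⟨R, R⟩ T1 γ1) :
    Hardy p lam (√2 * (R - r0)) (fun τ => weight n cn (diagCurve R τ)) := by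
  obtain ⟨T, γ, hA, hmin⟩ := Adm.exists_minimal (by linarith) isClosed_diagRay
    isClosed_singleton h1
  have hM : Mini n cn p lam diagRay {⟨r0, r0⟩} ⟨R, R⟩ T γ := ⟨hA, hmin⟩
  have hs2 : 0 < √2 := by positivity
  have hinj := hM.injOn hcn (by linarith) hlam diagRay_subset_quad
  set r : ℝ → ℝ := fun t => (γ t).re with hr
  have hrc : Continuous r := Complex.continuous_re.comp hM.lip.continuous
  have hrinj : InjOn r (Icc 0 T) := by
    intro a ha b hb hab
    refine hinj ha hb (Complex.ext hab ?_)
    rw [(hM.mem a).2, (hM.mem b).2]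
    exact hab
  have hr0' : r 0 = R := by simp [hr, hM.start]
  have hrT : r T = r0 := by
    have := hM.fin
    rw [mem_singleton_iff] at this
    simp [hr, this]
  have hanti : StrictAntiOn r (Icc 0 T) := by
    rcases hrc.continuousOn.strictMonoOn_of_injOn_Icc' hM.nonneg hrinj with h | h
    · have := h.monotoneOn (left_mem_Icc.2 hM.nonneg) (right_mem_Icc.2 hM.nonneg) hM.nonneg
      rw [hr0', hrT] at this
      linarith
    · exact h
  have hge : ∀ t ∈ Icc 0 T, r0 ≤ r t := fun t ht => by
    rw [← hrT]
    exact hanti.antitoneOn ht (right_mem_Icc.2 hM.nonneg) ht.2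
  have hnorm : ∀ s t, 0 ≤ s → s ≤ t → t ≤ T → ‖γ t - γ s‖ = √2 * (r s - r t) := by
    intro s t hs hst htT
    rw [norm_sub_of_mem_diagRay (hM.mem _) (hM.mem _), abs_sub_comm, abs_of_nonneg]
    have := hanti.antitoneOn ⟨hs, hst.trans htT⟩ ⟨hs.trans hst, htT⟩ hst
    simp only [hr] at this
    linarith
  have hconst := eq_of_quadratic_increments (φ := fun t => √2 * r t + t) (T := T)
    (K := 8 * n / r0) (h0 := r0 / 2) (by fun_prop) (by positivity) (by
      intro s t hs hst htT hl
      have h1 := hM.chord hn hcn hp hlam diagRay_subset_quad convex_diagRay hs hst htT hr0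
        (hge s ⟨hs, hst.trans htT⟩) (by rw [(hM.mem s).2]; exact hge s ⟨hs, hst.trans htT⟩) hl
      have h2 := norm_sub_le_of_lip hM.lip t s
      rw [abs_of_nonneg (by linarith)] at h2
      rw [hnorm s t hs hst htT] at h1 h2
      rw [abs_le]
      constructor
      · have : 0 ≤ 8 * n / r0 * (t - s) ^ 2 := by positivity
        linarith
      · linarith)
  have hform : ∀ t ∈ Icc 0 T, r t = R - t / √2 := by
    intro t ht
    have := hconst t ht
    simp only [hr0', add_zero] at this
    field_simp
    linarith
  have hT : T = √2 * (R - r0) := by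
    have := hform T (right_mem_Icc.2 hM.nonneg)
    rw [hrT] at this
    have h2 : T / √2 = R - r0 := by linarith
    rw [← h2]; field_simp
  have hH := hM.hardy
  rw [hT] at hH
  refine hH.congr (by rw [← hT]; exact hM.nonneg) fun t ht => ?_
  rw [← hT] at ht
  congr 1
  have h3 := hform t ht
  apply Complex.ext
  · exact h3
  · rw [(hM.mem t).2]; exact h3

/-- Strictness of the failure of the Hardy inequality on the diagonal. -/
theorem exists_not_hardy_diagCurve {n : ℕ} {cn p lam0 R : ℝ} (hcn : 0 ≤ cn) (hp : 0 < p)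
    (hR : 0 < R)
    (h : ¬ Hardy p lam0 (√2 * R) (fun τ => weight n cn (diagCurve R τ))) :
    ∃ r0 κ, 0 < r0 ∧ r0 < R ∧ 1 < κ ∧ ∀ lam, lam0 ≤ lam →
      ¬ Hardy p (lam / κ ^ p) (√2 * (R - r0)) (fun τ => weight n cn (diagCurve R τ)) := by
  unfold Hardy at h
  push Not at h
  obtain ⟨w, ⟨K, hK⟩, hw0, hlt⟩ := h
  set f : ℝ → ℝ := fun τ => weight n cn (diagCurve R τ) with hf
  have hfc : Continuous f := (continuous_weight n cn).comp (continuous_diagCurve R)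
  have iw := fun a b => intervalIntegrable_rpow_mul hp.le hK.continuous hfc a b
  have id := fun a b => intervalIntegrable_deriv_rpow_mul hp.le hK hfc a b
  have c1 : Continuous (fun r0 : ℝ => ∫ t in (0:ℝ)..(√2 * (R - r0)), |w t| ^ p * f t) :=
    (intervalIntegral.continuous_primitive iw 0).comp (by fun_prop)
  have c2 : Continuous (fun r0 : ℝ => ∫ t in (0:ℝ)..(√2 * (R - r0)), |deriv w t| ^ p * f t) :=
    (intervalIntegral.continuous_primitive id 0).comp (by fun_prop)
  have ev1 : ∀ᶠ r0 in 𝓝[>] (0:ℝ), (∫ t in (0:ℝ)..(√2 * (R - r0)), |deriv w t| ^ p * f t) <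
      lam0 * ∫ t in (0:ℝ)..(√2 * (R - r0)), |w t| ^ p * f t := by
    refine Eventually.filter_mono nhdsWithin_le_nhds ?_
    refine c2.continuousAt.eventually_lt (continuous_const.mul c1).continuousAt ?_
    simpa using hlt
  have ev : ∀ᶠ r in 𝓝[>] (0:ℝ), r < R := nhdsWithin_le_nhds (Iio_mem_nhds hR)
  have ev0 : ∀ᶠ r in 𝓝[>] (0:ℝ), 0 < r := self_mem_nhdsWithin
  obtain ⟨r0, ⟨hr1, hr0⟩, hrR⟩ := ((ev1.and ev0).and ev).exists
  have ev2 : ∀ᶠ κ in 𝓝[>] (1:ℝ), (∫ t in (0:ℝ)..(√2 * (R - r0)), |deriv w t| ^ p * f t) <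
      lam0 / κ ^ p * ∫ t in (0:ℝ)..(√2 * (R - r0)), |w t| ^ p * f t := by
    refine Eventually.filter_mono nhdsWithin_le_nhds ?_
    have c3 : ContinuousAt (fun κ : ℝ => lam0 / κ ^ p) 1 := by
      refine continuousAt_const.div ?_ (by simp)
      exact Real.continuousAt_rpow_const _ _ (Or.inl one_ne_zero)
    refine continuousAt_const.eventually_lt (c3.mul continuousAt_const) ?_
    simpa using hr1
  have ev3 : ∀ᶠ κ in 𝓝[>] (1:ℝ), 1 < κ := self_mem_nhdsWithin
  obtain ⟨κ, hκ1, hκ⟩ := (ev2.and ev3).exists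
  refine ⟨r0, κ, hr0, hrR, hκ, fun lam hlam hH => ?_⟩
  have h1 := hH w ⟨K, hK⟩ hw0
  have hκ0 : 0 < κ := lt_trans one_pos hκ
  have hL : 0 ≤ √2 * (R - r0) := mul_nonneg (Real.sqrt_nonneg _) (sub_nonneg.2 (le_of_lt hrR))
  have h2 : 0 ≤ ∫ t in (0:ℝ)..(√2 * (R - r0)), |w t| ^ p * f t := by
    refine intervalIntegral.integral_nonneg hL fun t ht => ?_
    refine mul_nonneg (Real.rpow_nonneg (abs_nonneg _) _) (weight_nonneg hcn ?_)
    have : t / √2 ≤ R - r0 := by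
      rw [div_le_iff₀ (by positivity)]; linarith [ht.2]
    have hr0' : 0 < r0 := hr0
    exact ⟨by simp only [diagCurve]; linarith, by simp only [diagCurve]; linarith⟩
  have h3 : lam0 / κ ^ p ≤ lam / κ ^ p := by
    gcongr
  have := mul_le_mul_of_nonneg_right h3 h2
  linarith

theorem abs_sqrt_sub_sqrt_le {κ : ℝ} (hκ : 0 < κ) {z w : ℂ} (hz : 0 < z.re * z.im)
    (hw : 0 < w.re * w.im)
    (h1 : z.re ^ 2 + z.im ^ 2 ≤ κ ^ 2 * (2 * (z.re * z.im)))
    (h2 : w.re ^ 2 + w.im ^ 2 ≤ κ ^ 2 * (2 * (w.re * w.im))) :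
    √2 * |√(z.re * z.im) - √(w.re * w.im)| ≤ κ * ‖z - w‖ := by
  have nz : ‖z‖ ≤ κ * (√2 * √(z.re * z.im)) := by
    refine le_of_sq_le_sq ?_ (by positivity)
    have := normSq_sub_eq z 0
    simp only [sub_zero, Complex.zero_re, Complex.zero_im] at this
    rw [this, mul_pow, mul_pow, Real.sq_sqrt (by norm_num), Real.sq_sqrt hz.le]
    exact h1
  have nw : ‖w‖ ≤ κ * (√2 * √(w.re * w.im)) := by
    refine le_of_sq_le_sq ?_ (by positivity)
    have := normSq_sub_eq w 0
    simp only [sub_zero, Complex.zero_re, Complex.zero_im] at this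
    rw [this, mul_pow, mul_pow, Real.sq_sqrt (by norm_num), Real.sq_sqrt hw.le]
    exact h2
  have hv : 2 * |z.re * z.im - w.re * w.im| ≤ ‖z - w‖ * (‖z‖ + ‖w‖) := by
    have e : ((z - w) * (z + w)).im = 2 * (z.re * z.im - w.re * w.im) := by
      simp only [Complex.mul_im, Complex.sub_re, Complex.sub_im, Complex.add_re, Complex.add_im]
      ring
    have h3 := Complex.abs_im_le_norm ((z - w) * (z + w))
    rw [e, abs_mul, abs_two, norm_mul] at h3
    exact h3.trans (mul_le_mul_of_nonneg_left (norm_add_le _ _) (norm_nonneg _))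
  have hsz := Real.sqrt_pos.2 hz
  have hsw := Real.sqrt_pos.2 hw
  have qz := Real.sq_sqrt hz.le
  have qw := Real.sq_sqrt hw.le
  set a := √(z.re * z.im)
  set b := √(w.re * w.im)
  have hab : |z.re * z.im - w.re * w.im| = |a - b| * (a + b) := by
    rw [← qz, ← qw, show a ^ 2 - b ^ 2 = (a - b) * (a + b) by ring, abs_mul,
      abs_of_pos (by positivity : 0 < a + b)]
  rw [hab] at hv
  have h22 : √2 * √2 = 2 := Real.mul_self_sqrt (by norm_num)
  have hs2 : 0 < √2 := by positivity
  have h4 : ‖z - w‖ * (‖z‖ + ‖w‖) ≤ ‖z - w‖ * (κ * √2 * (a + b)) :=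
    mul_le_mul_of_nonneg_left (by linarith) (norm_nonneg _)
  have h5 : (√2 * (a + b)) * (√2 * |a - b|) ≤ (√2 * (a + b)) * (κ * ‖z - w‖) := by
    calc (√2 * (a + b)) * (√2 * |a - b|) = (√2 * √2) * (|a - b| * (a + b)) := by ring
      _ = 2 * (|a - b| * (a + b)) := by rw [h22]
      _ ≤ _ := hv.trans h4
      _ = _ := by ring
  exact le_of_mul_le_mul_left h5 (by positivity)

/-- An admissible curve which stays close to the diagonal projects to an admissible curve on the
diagonal. -/
theorem Adm.project_diag {n : ℕ} {cn p lam R r0 κ : ℝ} (hcn : 0 ≤ cn) (hp : 0 < p)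
    (hlam : 0 ≤ lam) (hR : 0 < R) (hr0 : 0 < r0) (hκ : 0 < κ) {T : ℝ} {γ : ℝ → ℂ}
    (h : Adm n cn p lam quad bdry ⟨R, R⟩ T γ) {t0 : ℝ} (ht0 : 0 ≤ t0) (ht0T : t0 ≤ T)
    (hv0 : (γ t0).re * (γ t0).im = r0 ^ 2)
    (hv : ∀ t ∈ Icc 0 t0, r0 ^ 2 ≤ (γ t).re * (γ t).im)
    (hκv : ∀ t ∈ Icc 0 t0,
      (γ t).re ^ 2 + (γ t).im ^ 2 ≤ κ ^ 2 * (2 * ((γ t).re * (γ t).im))) :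
    ∃ γ', Adm n cn p (lam / κ ^ p) diagRay {⟨r0, r0⟩} ⟨R, R⟩ (κ * t0) γ' := by
  set c : ℝ → ℝ := fun τ => max 0 (min (τ / κ) t0) with hc
  have hcmem : ∀ τ, c τ ∈ Icc 0 t0 := fun τ => ⟨le_max_left _ _, max_le ht0 (min_le_right _ _)⟩
  have hcof : ∀ t ∈ Icc 0 t0, c (κ * t) = t := fun t ht => by
    simp only [hc]
    rw [mul_div_cancel_left₀ _ hκ.ne', min_eq_left ht.2, max_eq_right ht.1]
  have hclip : ∀ s t, s ≤ t → |c t - c s| ≤ (t - s) / κ := by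
    intro s t hst
    have l1 : LipschitzWith 1 (fun x : ℝ => max 0 (min x t0)) :=
      (LipschitzWith.id.min_const t0).const_max 0
    have := l1.dist_le_mul (t / κ) (s / κ)
    rw [Real.dist_eq, Real.dist_eq, NNReal.coe_one, one_mul, ← sub_div,
      abs_of_nonneg (a := (t - s) / κ) (div_nonneg (by linarith) hκ.le)] at this
    exact this
  have hpos : ∀ t ∈ Icc 0 t0, 0 < (γ t).re * (γ t).im := fun t ht =>
    lt_of_lt_of_le (by positivity) (hv t ht)
  set γ' : ℝ → ℂ := fun τ => ⟨√((γ (c τ)).re * (γ (c τ)).im), √((γ (c τ)).re * (γ (c τ)).im)⟩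
    with hγ'
  have hmem : ∀ τ, γ' τ ∈ diagRay := fun τ => ⟨Real.sqrt_nonneg _, rfl⟩
  refine ⟨γ', ?_, ?_, hmem, by positivity, ?_, ?_⟩
  · refine lipschitzWith_one_of_norm_sub_le fun s t hst => ?_
    rw [norm_sub_of_mem_diagRay (hmem _) (hmem _)]
    refine (abs_sqrt_sub_sqrt_le hκ (hpos _ (hcmem t)) (hpos _ (hcmem s)) (hκv _ (hcmem t))
      (hκv _ (hcmem s))).trans ?_
    have h1 := (norm_sub_le_of_lip h.lip (c t) (c s)).trans (hclip s t hst)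
    calc κ * ‖γ (c t) - γ (c s)‖ ≤ κ * ((t - s) / κ) := mul_le_mul_of_nonneg_left h1 hκ.le
      _ = t - s := by field_simp
  · have := hcof 0 ⟨le_rfl, ht0⟩
    rw [mul_zero] at this
    simp only [hγ', this, h.start]
    rw [Real.sqrt_mul_self hR.le]
  · simp only [hγ', hcof t0 ⟨ht0, le_rfl⟩, hv0, Real.sqrt_sq hr0.le, mem_singleton_iff]
  · have h1 := h.hardy.mono_time hp hlam (Adm.continuous_weight_comp h.lip)
      (fun _ => weight_nonneg hcn (h.mem _)) ht0 ht0T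
    refine h1.rescale ht0 hκ fun t ht => ?_
    simp only [hγ', weight_eq, hcof t ht]
    rw [Real.mul_self_sqrt (hpos t ht).le]

/-- Admissible curves have to leave the diagonal early, hence can be reflected away from it. -/
theorem Adm.exists_far {n : ℕ} {cn p lam R r0 κ η : ℝ} (hn : 1 ≤ n) (hcn : 0 ≤ cn) (hp : 2 ≤ p)
    (hlam : 0 ≤ lam) (hr0 : 0 < r0) (hR : r0 < R) (hκ : 1 < κ) (hη : 0 < η)
    (hηκ : η ^ 2 = (κ ^ 4 - 1) * (r0 ^ 2) ^ 2)
    (hno : ¬ Hardy p (lam / κ ^ p) (√2 * (R - r0)) (fun τ => weight n cn (diagCurve R τ)))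
    {T : ℝ} {γ : ℝ → ℂ} (h : Adm n cn p lam quad bdry ⟨R, R⟩ T γ) :
    ∃ γ' t1, Adm n cn p lam quad bdry ⟨R, R⟩ T γ' ∧ (∀ t, γ' t ∈ wedge) ∧ t1 ∈ Icc 0 T ∧
      (∀ t ∈ Icc 0 t1, r0 ^ 2 ≤ (γ' t).re * (γ' t).im) ∧
      ∀ t, t1 ≤ t → η ≤ ((γ' t).re ^ 2 - (γ' t).im ^ 2) / 2 := by
  obtain ⟨γ, h, hw⟩ := h.exists_wedge
  have hR0 : 0 < R := hr0.trans hR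
  have hκ0 : 0 < κ := by linarith
  set v : ℝ → ℝ := fun t => (γ t).re * (γ t).im with hvdef
  set u : ℝ → ℝ := fun t => ((γ t).re ^ 2 - (γ t).im ^ 2) / 2 with hudef
  have hγc := h.lip.continuous
  have hrec : Continuous fun t => (γ t).re := Complex.continuous_re.comp hγc
  have himc : Continuous fun t => (γ t).im := Complex.continuous_im.comp hγc
  have hvc : Continuous v := hrec.mul himc
  have huc : Continuous u := ((hrec.pow 2).sub (himc.pow 2)).div_const 2
  have hv0 : v 0 = R ^ 2 := by simp [hvdef, h.start, sq]
  have hvT : v T = 0 := h.fin.2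
  have hu0 : u 0 = 0 := by simp [hudef, h.start]
  obtain ⟨t0, ht0, hvt0, hvge⟩ : ∃ t0 ∈ Icc 0 T, v t0 = r0 ^ 2 ∧
      ∀ t ∈ Icc 0 t0, r0 ^ 2 ≤ v t := by
    set S := Icc 0 T ∩ v ⁻¹' {r0 ^ 2} with hS
    have hSc : IsCompact S := isCompact_Icc.inter_right (isClosed_singleton.preimage hvc)
    have hivt : ∀ b ∈ Icc 0 T, v b ≤ r0 ^ 2 → ∃ a ∈ Icc 0 b, v a = r0 ^ 2 := by
      intro b hb hvb
      have := intermediate_value_Icc' hb.1 hvc.continuousOn (a := 0)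
      exact this ⟨hvb, by rw [hv0]; exact pow_le_pow_left₀ hr0.le hR.le 2⟩
    have hSne : S.Nonempty := by
      obtain ⟨a, ha, hva⟩ := hivt T (right_mem_Icc.2 h.nonneg) (by rw [hvT]; positivity)
      exact ⟨a, ha, hva⟩
    obtain ⟨t0, ht0⟩ := hSc.exists_isLeast hSne
    refine ⟨t0, ht0.1.1, ht0.1.2, fun t ht => ?_⟩
    by_contra! hlt
    have htT : t ∈ Icc 0 T := ⟨ht.1, ht.2.trans ht0.1.1.2⟩
    obtain ⟨a, ha, hva⟩ := hivt t htT hlt.le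
    have h1 := ht0.2 ⟨⟨ha.1, ha.2.trans htT.2⟩, hva⟩
    have : a = t := le_antisymm ha.2 (ht.2.trans h1)
    rw [← this, hva] at hlt
    exact lt_irrefl _ hlt
  obtain ⟨t2, ht2, hut2⟩ : ∃ t ∈ Icc 0 t0, η ≤ u t := by
    by_contra! hlt
    refine hno ?_
    obtain ⟨γ', hγ'⟩ := h.project_diag hcn (by linarith) hlam hR0 hr0 hκ0 ht0.1 ht0.2 hvt0 hvge
      (fun t ht => by
        refine le_of_sq_le_sq ?_ ?_
        · have e : ((γ t).re ^ 2 + (γ t).im ^ 2) ^ 2 = 4 * (u t ^ 2 + v t ^ 2) := by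
            simp only [hudef, hvdef]; ring
          have e2 : (κ ^ 2 * (2 * ((γ t).re * (γ t).im))) ^ 2 = 4 * (κ ^ 4 * v t ^ 2) := by
            simp only [hvdef]; ring
          rw [e, e2]
          have hu0 : 0 ≤ u t := by
            have := pow_le_pow_left₀ (hw t).1 (hw t).2 2
            simp only [hudef]; linarith
          have q1 := pow_le_pow_left₀ hu0 (hlt t ht).le 2
          have q2 := pow_le_pow_left₀ (by positivity) (hvge t ht) 2
          have q3 : 0 ≤ κ ^ 4 - 1 := by
            have := one_le_pow₀ hκ.le (n := 4); linarith
          have q4 := mul_le_mul_of_nonneg_left q2 q3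
          linarith
        · have h1 := hvge t ht
          have h2 : 0 ≤ v t := le_trans (by positivity) h1
          have : 0 ≤ (γ t).re * (γ t).im := h2
          positivity)
    exact hardy_diagCurve_of_adm hn hcn hp (by positivity) hr0 hR hγ'
  obtain ⟨t1, ht1, hut1⟩ : ∃ t1 ∈ Icc 0 t2, u t1 = η :=
    intermediate_value_Icc ht2.1 huc.continuousOn ⟨by rw [hu0]; exact hη.le, hut2⟩
  obtain ⟨γ', hA, hw', heq, hge⟩ := h.exists_foldHyp hw hη.le ht1.1 hut1
  refine ⟨γ', t1, hA, hw', ⟨ht1.1, ht1.2.trans (ht2.2.trans ht0.2)⟩, fun t ht => ?_, hge⟩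
  rw [heq t ht.2]
  exact hvge t ⟨ht.1, ht.2.trans (ht1.2.trans ht2.2)⟩

/-- A lower bound for the tail mass of a density which dominates a power of its tail mass. -/
theorem mul_pow_le_of_tail {n : ℕ} (hn : 1 ≤ n) {k s T : ℝ} (hk : 0 ≤ k) (hsT : s ≤ T)
    {f : ℝ → ℝ} (hf : Continuous f) (hpos : ∀ t ∈ Ico s T, 0 < f t)
    (h : ∀ t ∈ Ioo s T, k * (∫ r in t..T, f r) ^ (n - 1) ≤ f t ^ n) :
    k * (T - s) ^ n ≤ n ^ n * ∫ r in s..T, f r := by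
  have hn0 : (0:ℝ) < n := by exact_mod_cast hn
  set a : ℝ → ℝ := fun t => ∫ r in t..T, f r with ha
  have hapos : ∀ t ∈ Ico s T, 0 < a t := fun t ht =>
    intervalIntegral.intervalIntegral_pos_of_pos_on (hf.intervalIntegrable _ _)
      (fun r hr => hpos r ⟨ht.1.trans hr.1.le, hr.2⟩) ht.2
  have had : ∀ t, HasDerivAt a (-f t) t := fun t =>
    intervalIntegral.integral_hasDerivAt_left (hf.intervalIntegrable _ _)
      (hf.stronglyMeasurableAtFilter _ _) hf.continuousAt
  have hac : Continuous a := continuous_iff_continuousAt.2 fun t => (had t).continuousAt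
  set q : ℝ := k ^ (1 / (n:ℝ)) with hq
  have hq0 : 0 ≤ q := Real.rpow_nonneg hk _
  have hqn : q ^ n = k := by
    rw [hq, ← Real.rpow_natCast, ← Real.rpow_mul hk, one_div_mul_cancel hn0.ne', Real.rpow_one]
  set A : ℝ → ℝ := fun t => a t ^ (1 / (n:ℝ)) with hA
  have hAc : Continuous A := hac.rpow_const fun _ => Or.inr (by positivity)
  have hanti : AntitoneOn (fun t => A t + q / n * t) (Icc s T) := by
    refine antitoneOn_of_hasDerivWithinAt_nonpos (convex_Icc s T) (by fun_prop)
      (f' := fun t => -f t * (1 / (n:ℝ)) * a t ^ (1 / (n:ℝ) - 1) + q / n) ?_ ?_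
    · intro t ht
      rw [interior_Icc] at ht
      have h1 := (had t).rpow_const (p := 1 / (n:ℝ)) (Or.inl (hapos t ⟨ht.1.le, ht.2⟩).ne')
      exact ((h1.add ((hasDerivAt_id t).const_mul (q / n))).congr_deriv
        (by rw [mul_one])).hasDerivWithinAt
    · intro t ht
      rw [interior_Icc] at ht
      have hat := hapos t ⟨ht.1.le, ht.2⟩
      have hft := (hpos t ⟨ht.1.le, ht.2⟩).le
      have h3 : q ≤ f t * a t ^ (1 / (n:ℝ) - 1) := by
        refine le_of_pow_le_pow_left₀ (n := n) (by omega) (by positivity) ?_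
        rw [mul_pow, hqn, ← Real.rpow_natCast (a t ^ _), ← Real.rpow_mul hat.le]
        have e : (1 / (n:ℝ) - 1) * n = -((n - 1 : ℕ) : ℝ) := by
          rw [Nat.cast_sub hn]; field_simp; push_cast; ring
        rw [e, Real.rpow_neg hat.le, Real.rpow_natCast, ← div_eq_mul_inv,
          le_div_iff₀ (by positivity)]
        exact h t ht
      have : -f t * (1 / (n:ℝ)) * a t ^ (1 / (n:ℝ) - 1) + q / n =
        (q - f t * a t ^ (1 / (n:ℝ) - 1)) / n := by field_simp; ring
      rw [this]
      exact div_nonpos_of_nonpos_of_nonneg (by linarith) hn0.le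
  have h4 := hanti (left_mem_Icc.2 hsT) (right_mem_Icc.2 hsT) hsT
  have h5 : 0 ≤ A T := by
    have : a T = 0 := by simp [ha]
    simp only [hA, this]; positivity
  have h6 : q * (T - s) ≤ n * A s := by
    have : q / n * (T - s) ≤ A s := by simp only at h4; linarith
    have h7 := mul_le_mul_of_nonneg_left this hn0.le
    calc q * (T - s) = n * (q / n * (T - s)) := by field_simp
      _ ≤ _ := h7
  have h8 := pow_le_pow_left₀ (mul_nonneg hq0 (by linarith)) h6 n
  have has : 0 ≤ a s := by
    rcases hsT.eq_or_lt with rfl | hlt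
    · simp [ha]
    · exact (hapos s ⟨le_rfl, hlt⟩).le
  rw [mul_pow, mul_pow, hqn] at h8
  have h9 : A s ^ n = a s := by
    simp only [hA]
    rw [← Real.rpow_natCast, ← Real.rpow_mul has, one_div_mul_cancel hn0.ne', Real.rpow_one]
  rwa [h9] at h8

theorem le_of_abs_re_sub {z w : ℂ} {r : ℝ} (h : ‖z - w‖ ≤ r) :
    |z.re - w.re| ≤ r ∧ |z.im - w.im| ≤ r := by
  have h1 := Complex.abs_re_le_norm (z - w)
  have h2 := Complex.abs_im_le_norm (z - w)
  rw [Complex.sub_re] at h1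
  rw [Complex.sub_im] at h2
  exact ⟨h1.trans h, h2.trans h⟩

/-- Dropping vertically to the boundary is never profitable along a minimal curve. -/
theorem Mini.tail_le {n : ℕ} {cn p lam : ℝ} {z0 : ℂ} {T : ℝ} {γ : ℝ → ℂ} (hn : 1 ≤ n)
    (hcn : 0 ≤ cn) (hp : 1 < p) (hlam : 0 ≤ lam) (h : Mini n cn p lam quad bdry z0 T γ)
    (hT0 : (γ T).im = 0) {s : ℝ} (hs : 0 ≤ s) (hsT : s ≤ T)
    (hy1 : 2 * p * (γ s).im ≤ 1) (hy2 : 2 * lam * (γ s).im ≤ 1) :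
    ∫ t in s..T, weight n cn (γ t) ≤
      (1 + 2 * p * (γ s).im) * (cn * (γ s).re ^ (n - 1) * (γ s).im ^ n / n) := by
  have hn0 : (0:ℝ) < n := by exact_mod_cast hn
  set x := (γ s).re with hx
  set y := (γ s).im with hy
  have hx0 : 0 ≤ x := (h.mem s).1
  have hy0 : 0 ≤ y := (h.mem s).2
  rcases lt_or_ge (s + y) T with hlt | hge
  · by_contra! hmass
    set d : ℝ → ℂ := fun t => ⟨x, max 0 (s + y - t)⟩ with hd
    have hds : γ s = d s := by
      simp only [hd]
      rw [add_sub_cancel_left, max_eq_right hy0]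
    have hdl : LipschitzWith 1 d := by
      refine lipschitzWith_one_of_norm_sub_le fun a b hab => ?_
      refine le_of_sq_le_sq ?_ (by linarith)
      rw [normSq_sub_eq]
      simp only [hd, sub_self]
      have := abs_max_sub_max_le_abs (s + y - b) (s + y - a) 0
      rw [max_comm _ (0:ℝ), max_comm _ (0:ℝ)] at this
      have h2 := sq_le_sq' (neg_le_of_abs_le this) (le_of_abs_le this)
      rw [sq_abs] at h2
      linarith [h2, show (s + y - b - (s + y - a)) ^ 2 = (b - a) ^ 2 by ring]
    have hgl : LipschitzWith 1 (glue s γ d) := lipschitzWith_glue hds h.lip hdl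
    have hgm : ∀ t, glue s γ d t ∈ quad := by
      intro t
      rcases le_total t s with ht | ht
      · rw [glue_of_le ht]; exact h.mem t
      · rw [glue_of_ge hds ht]; exact ⟨hx0, le_max_left _ _⟩
    have hH : Hardy p lam (s + y) fun t => weight n cn (glue s γ d t) := by
      refine Hardy.drop hp hlam (Adm.continuous_weight_comp h.lip)
        (Adm.continuous_weight_comp hgl) (fun t => weight_nonneg hcn (hgm t)) h.hardy hn hs hsT
        hy0 (b := cn * x ^ (n - 1)) (by positivity) hy1 hy2 ?_ ?_ ?_
      · intro t ht
        simp only [glue_of_le ht.2]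
      · intro t ht
        show weight n cn (glue s γ d t) = _
        rw [glue_of_ge hds ht.1]
        simp only [hd, weight]
        rw [max_eq_right (by linarith [ht.2])]
      · exact hmass.le
    have hA : Adm n cn p lam quad bdry z0 (s + y) (glue s γ d) := by
      refine ⟨hgl, ?_, hgm, by linarith, ?_, hH⟩
      · rw [glue_of_le hs, h.start]
      · rw [glue_of_ge hds (by linarith)]
        simp only [hd, sub_self, max_self]
        exact ⟨⟨hx0, le_rfl⟩, mul_zero _⟩
    linarith [h.time_le _ _ hA]
  · have hTs : T - s = y := by
      refine le_antisymm (by linarith) ?_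
      have := (le_of_abs_re_sub (norm_sub_le_of_lip h.lip s T)).2
      rw [hT0, sub_zero, abs_sub_comm, abs_of_nonneg (a := T - s) (by linarith)] at this
      exact (le_abs_self _).trans this
    have hw : ∀ t ∈ Icc s T, weight n cn (γ t) = cn * x ^ (n - 1) * (T - t) ^ (n - 1) := by
      intro t ht
      have h1 := norm_sub_le_of_lip h.lip t s
      rw [abs_of_nonneg (by linarith [ht.1])] at h1
      have h2 := norm_sub_le_of_lip h.lip t T
      rw [abs_sub_comm, abs_of_nonneg (by linarith [ht.2])] at h2
      have h3 := (le_of_abs_re_sub h1).2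
      have h4 := (le_of_abs_re_sub h2).2
      rw [hT0, sub_zero] at h4
      have h5 : (γ t).im = T - t := by
        refine le_antisymm ((le_abs_self _).trans h4) ?_
        have := (abs_le.1 h3).1
        linarith
      have h6 := pow_le_pow_left₀ (norm_nonneg _) h1 2
      rw [normSq_sub_eq, h5] at h6
      have h7 : ((γ t).re - x) ^ 2 ≤ 0 := by
        have : (T - t - y) ^ 2 = (t - s) ^ 2 := by rw [← hTs]; ring
        linarith
      have h8 : (γ t).re = x := by
        have := pow_eq_zero_iff (two_ne_zero) |>.1 (le_antisymm h7 (sq_nonneg _))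
        linarith
      simp only [weight, h5, h8]
    have e : ∫ t in s..T, weight n cn (γ t) = cn * x ^ (n - 1) * y ^ n / n := by
      rw [intervalIntegral.integral_congr (g := fun t => cn * x ^ (n - 1) * (T - t) ^ (n - 1))
        (fun t ht => hw t (by rwa [uIcc_of_le hsT] at ht))]
      rw [intervalIntegral.integral_const_mul,
        intervalIntegral.integral_comp_sub_left (fun t => t ^ (n - 1)), integral_pow, hTs, sub_self]
      have : n - 1 + 1 = n := by omega
      rw [this, Nat.cast_sub hn, zero_pow (by omega)]
      push_cast
      rw [sub_add_cancel, sub_zero]; ring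
    rw [e]
    have : 0 ≤ cn * x ^ (n - 1) * y ^ n / n := by positivity
    nlinarith [mul_nonneg (mul_nonneg (by linarith : 0 ≤ 2 * p) hy0) this]

theorem Adm.le_time {n : ℕ} {cn p lam R : ℝ} {T : ℝ} {γ : ℝ → ℂ}
    (h : Adm n cn p lam quad bdry ⟨R, R⟩ T γ) : R ≤ T := by
  have h1 := norm_sub_le_of_lip h.lip T 0
  rw [h.start, sub_zero, abs_of_nonneg h.nonneg] at h1
  obtain ⟨h2, h3⟩ := le_of_abs_re_sub h1
  rcases mul_eq_zero.1 h.fin.2 with h0 | h0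
  · rw [h0] at h2; simp only at h2; linarith [(abs_le.1 h2).1]
  · rw [h0] at h3; simp only at h3; linarith [(abs_le.1 h3).1]

/-- Two sided bounds of the weight on the initial piece of a curve. -/
theorem Adm.weight_bounds {n : ℕ} {cn p lam R : ℝ} (hcn : 0 ≤ cn) (hR : 0 < R) {T : ℝ}
    {γ : ℝ → ℂ} (h : Adm n cn p lam quad bdry ⟨R, R⟩ T γ) {t : ℝ} (ht : t ∈ Icc 0 (R / 2)) :
    cn * ((R / 2) ^ 2) ^ (n - 1) ≤ weight n cn (γ t) ∧
      weight n cn (γ t) ≤ cn * ((3 * R / 2) ^ 2) ^ (n - 1) := by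
  have h1 := norm_sub_le_of_lip h.lip t 0
  rw [h.start, sub_zero, abs_of_nonneg ht.1] at h1
  obtain ⟨h2, h3⟩ := le_of_abs_re_sub (h1.trans ht.2)
  simp only at h2 h3
  have a1 := (abs_le.1 h2).1
  have a2 := (abs_le.1 h2).2
  have b1 := (abs_le.1 h3).1
  have b2 := (abs_le.1 h3).2
  have x0 := (h.mem t).1
  have y0 := (h.mem t).2
  rw [weight_eq]
  have c1 : (R / 2) ^ 2 ≤ (γ t).re * (γ t).im := by
    rw [sq]; exact mul_le_mul (by linarith) (by linarith) (by linarith) x0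
  have c2 : (γ t).re * (γ t).im ≤ (3 * R / 2) ^ 2 := by
    rw [sq]; exact mul_le_mul (by linarith) (by linarith) y0 (by linarith)
  have c3 : 0 ≤ (γ t).re * (γ t).im := mul_nonneg x0 y0
  constructor <;> gcongr

theorem Adm.initial_bounds {n : ℕ} {cn p lam R : ℝ} (hcn : 0 ≤ cn) (hp : 0 < p) (hR : 0 < R)
    (hlam : 0 ≤ lam) {T : ℝ} {γ : ℝ → ℂ} (h : Adm n cn p lam quad bdry ⟨R, R⟩ T γ) :
    lam * (cn * ((R / 2) ^ 2) ^ (n - 1) * ((R / 2) ^ (p + 1) / (p + 1)) +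
        (R / 2) ^ p * ∫ t in (R / 2)..T, weight n cn (γ t)) ≤
      cn * ((3 * R / 2) ^ 2) ^ (n - 1) * (R / 2) ∧
    ∫ t in (0:ℝ)..(R / 2), weight n cn (γ t) ≤ cn * ((3 * R / 2) ^ 2) ^ (n - 1) * (R / 2) := by
  have hfc := Adm.continuous_weight_comp (n := n) (cn := cn) h.lip
  have h0 : (0:ℝ) ≤ R / 2 := by positivity
  have hup : ∫ t in (0:ℝ)..(R / 2), weight n cn (γ t) ≤
      cn * ((3 * R / 2) ^ 2) ^ (n - 1) * (R / 2) := by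
    have := intervalIntegral.integral_mono_on (μ := volume) h0 (hfc.intervalIntegrable 0 (R / 2))
      (continuous_const.intervalIntegrable 0 (R / 2)) fun t ht => (h.weight_bounds hcn hR ht).2
    rw [intervalIntegral.integral_const, sub_zero, smul_eq_mul, mul_comm] at this
    exact this
  refine ⟨le_trans ?_ ((h.hardy.id_le hp hfc h0 (by linarith [h.le_time])).trans hup), hup⟩
  refine mul_le_mul_of_nonneg_left ?_ hlam
  gcongr
  have hl : cn * ((R / 2) ^ 2) ^ (n - 1) * ((R / 2) ^ (p + 1) / (p + 1)) =
      ∫ t in (0:ℝ)..(R / 2), |t| ^ p * (cn * ((R / 2) ^ 2) ^ (n - 1)) := by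
    rw [intervalIntegral.integral_mul_const, mul_comm]
    congr 1
    rw [intervalIntegral.integral_congr (g := fun t => t ^ p) (fun t ht => by
      rw [uIcc_of_le h0] at ht
      simp only [abs_of_nonneg ht.1]), integral_rpow (Or.inl (by linarith)),
      Real.zero_rpow (by linarith), sub_zero]
  rw [hl]
  refine intervalIntegral.integral_mono_on h0
    (intervalIntegrable_rpow_mul hp.le continuous_id continuous_const _ _)
    (intervalIntegrable_rpow_mul hp.le continuous_id hfc _ _) fun t ht => ?_
  exact mul_le_mul_of_nonneg_left (h.weight_bounds hcn hR ht).1 (by positivity)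

/-- The eigenvalues of admissible curves are uniformly bounded. -/
theorem exists_eigenvalue_bound (n : ℕ) {cn p R : ℝ} (hcn : 0 < cn) (hp : 0 < p) (hR : 0 < R) :
    ∃ L, ∀ lam T γ, 0 ≤ lam → Adm n cn p lam quad bdry ⟨R, R⟩ T γ → lam ≤ L := by
  set b := cn * ((R / 2) ^ 2) ^ (n - 1) * ((R / 2) ^ (p + 1) / (p + 1)) with hb
  have hb0 : 0 < b := by positivity
  refine ⟨cn * ((3 * R / 2) ^ 2) ^ (n - 1) * (R / 2) / b, fun lam T γ hlam h => ?_⟩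
  rw [le_div_iff₀ hb0]
  refine le_trans ?_ (h.initial_bounds hcn.le hp hR hlam).1
  refine mul_le_mul_of_nonneg_left ?_ hlam
  have : 0 ≤ ∫ t in (R / 2)..T, weight n cn (γ t) :=
    intervalIntegral.integral_nonneg (by linarith [h.le_time]) fun t _ =>
      weight_nonneg hcn.le (h.mem t)
  have : 0 ≤ (R / 2) ^ p * ∫ t in (R / 2)..T, weight n cn (γ t) := by positivity
  linarith

/-- The total masses of admissible curves are uniformly bounded. -/
theorem exists_mass_bound (n : ℕ) {cn p lam0 R : ℝ} (hcn : 0 < cn) (hp : 0 < p) (hR : 0 < R)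
    (hlam0 : 0 < lam0) :
    ∃ a0 > 0, ∀ lam T γ, lam0 ≤ lam → Adm n cn p lam quad bdry ⟨R, R⟩ T γ →
      ∀ s ∈ Icc 0 T, ∫ t in s..T, weight n cn (γ t) ≤ a0 := by
  set B := cn * ((3 * R / 2) ^ 2) ^ (n - 1) * (R / 2) with hB
  have hB0 : 0 < B := by positivity
  refine ⟨B + B / (lam0 * (R / 2) ^ p), by positivity, fun lam T γ hlam h s hs => ?_⟩
  have hl : 0 < lam := hlam0.trans_le hlam
  obtain ⟨h1, h2⟩ := h.initial_bounds hcn.le hp hR hl.le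
  have hfc := Adm.continuous_weight_comp (n := n) (cn := cn) h.lip
  have hii := fun a b => hfc.intervalIntegrable (μ := volume) a b
  set A := ∫ t in (R / 2)..T, weight n cn (γ t) with hA
  have hA0 : 0 ≤ A := intervalIntegral.integral_nonneg (by linarith [h.le_time]) fun t _ =>
      weight_nonneg hcn.le (h.mem t)
  have h3 : A ≤ B / (lam0 * (R / 2) ^ p) := by
    rw [le_div_iff₀ (by positivity)]
    have e1 : lam0 * ((R / 2) ^ p * A) ≤ lam * ((R / 2) ^ p * A) := by gcongr
    have e2 : 0 ≤ lam * (cn * ((R / 2) ^ 2) ^ (n - 1) * ((R / 2) ^ (p + 1) / (p + 1))) := by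
      positivity
    rw [mul_add] at h1
    linarith
  have h4 : 0 ≤ ∫ t in (0:ℝ)..s, weight n cn (γ t) :=
    intervalIntegral.integral_nonneg hs.1 fun t _ => weight_nonneg hcn.le (h.mem t)
  have h5 := intervalIntegral.integral_add_adjacent_intervals (hii 0 s) (hii s T)
  have h6 := intervalIntegral.integral_add_adjacent_intervals (hii 0 (R / 2)) (hii (R / 2) T)
  linarith

/-- An admissible curve which, after time `t1`, stays in a region `η ≤ (x² - y²) / 2`, and before
time `t1` stays in a region `δ ≤ x y`. -/
structure Far (δ η T : ℝ) (γ : ℝ → ℂ) (t1 : ℝ) : Prop where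
  nonneg : 0 ≤ t1
  le : t1 ≤ T
  mul_ge : ∀ t ∈ Icc 0 t1, δ ≤ (γ t).re * (γ t).im
  sub_ge : ∀ t, t1 ≤ t → η ≤ ((γ t).re ^ 2 - (γ t).im ^ 2) / 2

theorem Far.sqrt_le {δ η T : ℝ} {γ : ℝ → ℂ} {t1 : ℝ} (h : Far δ η T γ t1)
    (hm : ∀ t, γ t ∈ quad) {t : ℝ} (ht : t1 ≤ t) : √(2 * η) ≤ (γ t).re := by
  refine Real.sqrt_le_iff.2 ⟨(hm t).1, ?_⟩
  have := h.sub_ge t ht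
  nlinarith [sq_nonneg (γ t).im]

theorem Far.im_eq_zero {δ η T : ℝ} (hη : 0 < η) {γ : ℝ → ℂ} {t1 : ℝ} (h : Far δ η T γ t1)
    (hm : ∀ t, γ t ∈ quad) (hT : γ T ∈ bdry) : (γ T).im = 0 := by
  rcases mul_eq_zero.1 hT.2 with h0 | h0
  · have := h.sqrt_le hm h.le
    rw [h0] at this
    have : 0 < √(2 * η) := Real.sqrt_pos.2 (by linarith)
    linarith
  · exact h0

theorem Mini.coord_pos {n : ℕ} {cn p lam : ℝ} {z0 : ℂ} {T : ℝ} {γ : ℝ → ℂ}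
    (hcn : 0 ≤ cn) (hp : 0 < p) (hlam : 0 ≤ lam) (h : Mini n cn p lam quad bdry z0 T γ) {t : ℝ}
    (ht : 0 ≤ t) (htT : t < T) : 0 < (γ t).re ∧ 0 < (γ t).im := by
  have h1 := h.notMem hcn hp hlam subset_rfl ht htT
  have hm := h.mem t
  constructor
  · refine lt_of_le_of_ne hm.1 fun h0 => h1 ⟨hm, ?_⟩
    rw [← h0, zero_mul]
  · refine lt_of_le_of_ne hm.2 fun h0 => h1 ⟨hm, ?_⟩
    rw [← h0, mul_zero]

/-- The lengths of far minimal curves are uniformly bounded. -/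
theorem exists_time_bound {n : ℕ} (hn : 1 ≤ n) {cn p lam0 L δ η R : ℝ} (hcn : 0 < cn) (hp : 1 < p)
    (hR : 0 < R) (hlam0 : 0 < lam0) (hδ : 0 < δ) (hη : 0 < η) :
    ∃ M, ∀ lam T γ t1, lam0 ≤ lam → lam ≤ L → Mini n cn p lam quad bdry ⟨R, R⟩ T γ →
      Far δ η T γ t1 → T ≤ M := by
  obtain ⟨a0, ha0, hmass⟩ := exists_mass_bound n (p := p) hcn (by linarith) hR hlam0
  obtain ⟨m, rfl⟩ : ∃ m, n = m + 1 := ⟨n - 1, by omega⟩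
  set N : ℝ := ((m + 1 : ℕ) : ℝ) with hN
  have hN0 : 0 < N := by positivity
  set x0 := √(2 * η) with hx0
  have hx0p : 0 < x0 := Real.sqrt_pos.2 (by linarith)
  set y1 := 1 / (2 * (p + |L|)) with hy1
  have hpL : 0 < p + |L| := by positivity
  have hy1p : 0 < y1 := by positivity
  set k1 := (cn * (x0 * y1) ^ m) ^ (m + 1) / a0 ^ m with hk1
  set k2 := cn * (N / 2) ^ m * x0 ^ m with hk2
  have hk1p : 0 < k1 := by positivity
  have hk2p : 0 < k2 := by positivity
  set k := min k1 k2 with hk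
  have hkp : 0 < k := lt_min hk1p hk2p
  refine ⟨a0 / (cn * δ ^ m) + (1 + N ^ (m + 1) * a0 / k), fun lam T γ t1 hl hL h hF => ?_⟩
  have hlam : 0 ≤ lam := hlam0.le.trans hl
  have hfc := Adm.continuous_weight_comp (n := m + 1) (cn := cn) h.lip
  have hii := fun a b => hfc.intervalIntegrable (μ := volume) a b
  have hw0 : ∀ t, 0 ≤ weight (m + 1) cn (γ t) := fun t => weight_nonneg hcn.le (h.mem t)
  have hma := hmass lam T γ hl h.toAdm
  have b1 : t1 ≤ a0 / (cn * δ ^ m) := by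
    rw [le_div_iff₀ (by positivity)]
    have h1 := intervalIntegral.integral_mono_on (μ := volume) hF.nonneg
      (continuous_const.intervalIntegrable 0 t1) (hii 0 t1) (f := fun _ => cn * δ ^ m)
      fun t ht => by
        rw [weight_eq]
        have := hF.mul_ge t ht
        show cn * δ ^ m ≤ cn * ((γ t).re * (γ t).im) ^ m
        gcongr
    rw [intervalIntegral.integral_const, sub_zero, smul_eq_mul] at h1
    have h2 := intervalIntegral.integral_add_adjacent_intervals (hii 0 t1) (hii t1 T)
    have h3 : 0 ≤ ∫ t in t1..T, weight (m + 1) cn (γ t) :=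
      intervalIntegral.integral_nonneg hF.le fun t _ => hw0 t
    have h4 := hma 0 ⟨le_rfl, h.nonneg⟩
    linarith
  have hT0 := hF.im_eq_zero hη h.mem h.fin
  have b2 : k * (T - t1) ^ (m + 1) ≤ N ^ (m + 1) * ∫ t in t1..T, weight (m + 1) cn (γ t) := by
    refine mul_pow_le_of_tail hn hkp.le hF.le hfc ?_ ?_
    · intro t ht
      obtain ⟨h1, h2⟩ := h.coord_pos hcn.le (by linarith) hlam (hF.nonneg.trans ht.1) ht.2
      rw [weight_eq]; positivity
    · intro t ht
      have ht0 : 0 ≤ t := hF.nonneg.trans ht.1.le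
      obtain ⟨h1, h2⟩ := h.coord_pos hcn.le (by linarith) hlam ht0 ht.2
      have hx := hF.sqrt_le h.mem ht.1.le
      have ha : 0 ≤ ∫ r in t..T, weight (m + 1) cn (γ r) :=
        intervalIntegral.integral_nonneg ht.2.le fun t _ => hw0 t
      rw [Nat.add_sub_cancel]
      rcases le_total y1 (γ t).im with hy | hy
      · have h3 := hma t ⟨ht0, ht.2.le⟩
        calc k * (∫ r in t..T, weight (m + 1) cn (γ r)) ^ m ≤ k1 * a0 ^ m := by
              gcongr; exact min_le_left _ _
          _ = (cn * (x0 * y1) ^ m) ^ (m + 1) := by rw [hk1]; field_simp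
          _ ≤ _ := by
            rw [weight_eq, Nat.add_sub_cancel]; gcongr
      · have hq : ∀ c, c ≤ p + |L| → 2 * c * (γ t).im ≤ 1 := by
          intro c hc
          calc 2 * c * (γ t).im ≤ 2 * (p + |L|) * y1 := by gcongr
            _ = 1 := by rw [hy1]; field_simp
        have e1 := hq p (by linarith [abs_nonneg L])
        have e2 := hq lam (by linarith [le_abs_self L])
        have h3 := h.tail_le hn hcn.le hp hlam hT0 ht0 ht.2.le e1 e2
        rw [Nat.add_sub_cancel] at h3
        set x := (γ t).re
        set y := (γ t).im
        have h4 : ∫ r in t..T, weight (m + 1) cn (γ r) ≤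
            2 * (cn * x ^ m * y ^ (m + 1) / N) := by
          refine h3.trans ?_
          have : 0 ≤ cn * x ^ m * y ^ (m + 1) / N := by positivity
          exact mul_le_mul_of_nonneg_right (by linarith) this
        calc k * (∫ r in t..T, weight (m + 1) cn (γ r)) ^ m
            ≤ (cn * (N / 2) ^ m * x ^ m) * (2 * (cn * x ^ m * y ^ (m + 1) / N)) ^ m := by
              gcongr
              refine (min_le_right _ _).trans ?_
              rw [hk2]; gcongr
          _ = cn * x ^ m * ((N / 2) * (2 * (cn * x ^ m * y ^ (m + 1) / N))) ^ m := by
              rw [mul_pow (N / 2)]; ring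
          _ = cn * x ^ m * (cn * x ^ m * y ^ (m + 1)) ^ m := by
              congr 2; field_simp
          _ = _ := by
              rw [weight_eq, Nat.add_sub_cancel]; ring
  have b3 : T - t1 ≤ 1 + N ^ (m + 1) * a0 / k := by
    have h4 : (T - t1) ^ (m + 1) ≤ N ^ (m + 1) * a0 / k := by
      rw [le_div_iff₀ hkp, mul_comm]
      exact b2.trans (mul_le_mul_of_nonneg_left (hma t1 ⟨hF.nonneg, hF.le⟩) (by positivity))
    rcases le_total (T - t1) 1 with h5 | h5
    · have : 0 ≤ N ^ (m + 1) * a0 / k := by positivity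
      linarith
    · linarith [le_self_pow₀ h5 (n := m + 1) (by omega)]
  linarith

/-- There is a largest eigenvalue among admissible curves, and a minimal curve realizing it which
stays away from the diagonal near its endpoint. -/
theorem exists_maximal {n : ℕ} (hn : 1 ≤ n) {cn p lam0 R : ℝ} (hcn : 0 < cn) (hp : 2 ≤ p)
    (hR : 0 < R) (hlam0 : 0 < lam0) (h0 : ∃ T γ, Adm n cn p lam0 quad bdry ⟨R, R⟩ T γ)
    (hno : ¬ Hardy p lam0 (√2 * R) (fun τ => weight n cn (diagCurve R τ))) :
    ∃ δ η lam T γ t1, 0 < δ ∧ 0 < η ∧ lam0 ≤ lam ∧ Mini n cn p lam quad bdry ⟨R, R⟩ T γ ∧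
      Far δ η T γ t1 ∧
      ∀ lam' T' γ', 0 ≤ lam' → Adm n cn p lam' quad bdry ⟨R, R⟩ T' γ' → lam' ≤ lam := by
  have hp0 : 0 < p := by linarith
  obtain ⟨r0, κ, hr0, hr0R, hκ, hno'⟩ := exists_not_hardy_diagCurve hcn.le hp0 hR hno
  obtain ⟨L, hL⟩ := exists_eigenvalue_bound n hcn hp0 hR
  set η := √((κ ^ 4 - 1) * (r0 ^ 2) ^ 2) with hη
  have hκ4 : 0 < κ ^ 4 - 1 := by linarith [one_lt_pow₀ hκ (n := 4) (by norm_num)]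
  have hη0 : 0 < η := Real.sqrt_pos.2 (by positivity)
  have hη2 : η ^ 2 = (κ ^ 4 - 1) * (r0 ^ 2) ^ 2 := Real.sq_sqrt (by positivity)
  have hmini : ∀ lam, lam0 ≤ lam → (∃ T γ, Adm n cn p lam quad bdry ⟨R, R⟩ T γ) →
      ∃ T γ t1, Mini n cn p lam quad bdry ⟨R, R⟩ T γ ∧ Far (r0 ^ 2) η T γ t1 := by
    rintro lam hlam ⟨T1, γ1, h1⟩
    obtain ⟨T, γ, h, hmin⟩ := Adm.exists_minimal hp0.le isClosed_quad isClosed_bdry h1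
    obtain ⟨γ', t1, h', -, ht1, hv, hu⟩ := h.exists_far hn hcn.le hp (hlam0.le.trans hlam) hr0
      hr0R hκ hη0 hη2 (hno' lam hlam)
    exact ⟨T, γ', t1, ⟨h', hmin⟩, ⟨ht1.1, ht1.2, hv, hu⟩⟩
  set S := {lam | lam0 ≤ lam ∧ ∃ T γ, Adm n cn p lam quad bdry ⟨R, R⟩ T γ} with hS
  have hSne : S.Nonempty := ⟨lam0, le_rfl, h0⟩
  have hSb : BddAbove S := ⟨L, fun lam h => by
    obtain ⟨h1, T, γ, h2⟩ := h
    exact hL lam T γ (hlam0.le.trans h1) h2⟩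
  obtain ⟨u, -, hut, huS⟩ := exists_seq_tendsto_sSup hSne hSb
  have hge : lam0 ≤ sSup S := le_csSup hSb ⟨le_rfl, h0⟩
  choose T γ t1 hM hF using fun k => hmini (u k) (huS k).1 (huS k).2
  obtain ⟨M, hMb⟩ := exists_time_bound hn (L := L) hcn (by linarith : 1 < p) hR hlam0
    (by positivity : 0 < r0 ^ 2) hη0
  have hTM : ∀ k, T k ≤ M := fun k =>
    hMb (u k) (T k) (γ k) (t1 k) (huS k).1
      (hL _ _ _ (hlam0.le.trans (huS k).1) (hM k).toAdm) (hM k) (hF k)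
  obtain ⟨T0, γ0, hA, -⟩ := Adm.exists_limit hp0.le isClosed_quad isClosed_bdry
    (fun k => (hM k).toAdm) hTM hut
  obtain ⟨T', γ', t1', hM', hF'⟩ := hmini (sSup S) hge ⟨T0, γ0, hA⟩
  refine ⟨r0 ^ 2, η, sSup S, T', γ', t1', by positivity, hη0, hge, hM', hF', ?_⟩
  intro lam' T1 γ1 hl hA1
  rcases le_total lam' lam0 with h | h
  · exact h.trans hge
  · exact le_csSup hSb ⟨h, T1, γ1, hA1⟩

open scoped RealInnerProductSpace in
theorem norm_slope_sub_le_of_half {γ : ℝ → ℂ} (hl : LipschitzWith 1 γ) {K s t a b : ℝ}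
    (h : (t - s) * (1 - K * (t - s)) ≤ ‖γ t - γ s‖) (hK : 0 ≤ K)
    (hsa : s ≤ a) (hab : a < b) (hbt : b ≤ t) (hlen : t - s ≤ 2 * (b - a)) :
    ‖slope γ a b - slope γ s t‖ ≤ √(6 * (K * (t - s))) := by
  refine Real.le_sqrt_of_sq_le ?_
  set l := b - a with hl'
  set L := t - s with hL'
  have l0 : 0 < l := by linarith
  have L0 : 0 < L := by linarith
  have nA : ‖γ b - γ a‖ ≤ l := by
    have := norm_sub_le_of_lip hl b a; rwa [abs_of_pos l0] at this
  have nB : ‖γ t - γ s‖ ≤ L := by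
    have := norm_sub_le_of_lip hl t s; rwa [abs_of_pos L0] at this
  have nC : ‖(γ t - γ s) - (γ b - γ a)‖ ≤ L - l := by
    have h1 := norm_sub_le_of_lip hl t b
    have h2 := norm_sub_le_of_lip hl a s
    rw [abs_of_nonneg (by linarith)] at h1 h2
    calc ‖(γ t - γ s) - (γ b - γ a)‖ = ‖(γ t - γ b) + (γ a - γ s)‖ := by congr 1; ring
      _ ≤ ‖γ t - γ b‖ + ‖γ a - γ s‖ := norm_add_le _ _
      _ ≤ _ := by simp only [hl', hL']; linarith
  set A := γ b - γ a
  set B := γ t - γ s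
  have e1 : slope γ a b = l⁻¹ • A := by rw [slope_def_module]
  have e2 : slope γ s t = L⁻¹ • B := by rw [slope_def_module]
  have hin : ‖B‖ ^ 2 - (L - l) * ‖B‖ ≤ ⟪A, B⟫ := by
    have h1 : ⟪A, B⟫ = ‖B‖ ^ 2 - ⟪B - A, B⟫ := by
      rw [inner_sub_left B A B, real_inner_self_eq_norm_sq]; ring
    have h2 := (real_inner_le_norm (B - A) B).trans
      (mul_le_mul_of_nonneg_right nC (norm_nonneg B))
    linarith
  have n1 : ‖l⁻¹ • A‖ ≤ 1 := by
    rw [norm_smul, norm_inv, Real.norm_of_nonneg l0.le, inv_mul_le_iff₀ l0]; linarith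
  have n2 : ‖L⁻¹ • B‖ ≤ 1 := by
    rw [norm_smul, norm_inv, Real.norm_of_nonneg L0.le, inv_mul_le_iff₀ L0]; linarith
  have hi : 1 - 3 * (K * L) ≤ ⟪l⁻¹ • A, L⁻¹ • B⟫ := by
    rw [real_inner_smul_left, real_inner_smul_right]
    set u := ‖B‖ / L with hu
    set v := (‖B‖ - L + l) / l with hv
    have hBu : ‖B‖ = u * L := by rw [hu]; field_simp
    have u1 : u ≤ 1 := by rw [hu, div_le_one L0]; exact nB
    have v1 : v ≤ 1 := by rw [hv, div_le_one l0]; linarith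
    have u2 : 1 - K * L ≤ u := by rw [hu, le_div_iff₀ L0]; linarith
    have v2 : 1 - 2 * (K * L) ≤ v := by
      rw [hv, le_div_iff₀ l0]
      have := mul_le_mul_of_nonneg_left hlen (mul_nonneg hK L0.le)
      nlinarith
    have huv : u * v ≤ l⁻¹ * (L⁻¹ * ⟪A, B⟫) := by
      calc u * v = l⁻¹ * (L⁻¹ * (‖B‖ ^ 2 - (L - l) * ‖B‖)) := by
            rw [hu, hv]; field_simp; ring
        _ ≤ _ := by gcongr
    nlinarith [mul_nonneg (sub_nonneg.2 u1) (sub_nonneg.2 v1)]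
  rw [e1, e2, norm_sub_sq_real]
  have q1 := pow_le_one₀ (norm_nonneg _) n1 (n := 2)
  have q2 := pow_le_one₀ (norm_nonneg _) n2 (n := 2)
  linarith

/-- In an almost straight piece of a curve all secants have about the same direction. -/
theorem norm_slope_sub_le {γ : ℝ → ℂ} (hl : LipschitzWith 1 γ) {K a b : ℝ} (hK : 0 ≤ K)
    (hab : a < b) (k : ℕ) : ∀ {s t : ℝ}, s ≤ a → b ≤ t → t - s ≤ 2 ^ k * (b - a) →
      (∀ u v, s ≤ u → u ≤ v → v ≤ t → (v - u) * (1 - K * (v - u)) ≤ ‖γ v - γ u‖) →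
      ‖slope γ a b - slope γ s t‖ ≤ 10 * √(K * (t - s)) := by
  have s6 : √6 ≤ 2.45 := by rw [Real.sqrt_le_left (by norm_num)]; norm_num
  have half : ∀ {s t a b : ℝ}, s ≤ a → a < b → b ≤ t → t - s ≤ 2 * (b - a) →
      (t - s) * (1 - K * (t - s)) ≤ ‖γ t - γ s‖ →
      ‖slope γ a b - slope γ s t‖ ≤ 2.45 * √(K * (t - s)) := by
    intro s t a b hsa hab hbt hlen h
    refine (norm_slope_sub_le_of_half hl h hK hsa hab hbt hlen).trans ?_
    rw [Real.sqrt_mul (by norm_num)]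
    gcongr
  induction k with
  | zero =>
    intro s t hsa hbt hlen h
    have h1 := half hsa hab hbt (by linarith) (h s t le_rfl (by linarith) le_rfl)
    linarith [Real.sqrt_nonneg (K * (t - s))]
  | succ k ih =>
    intro s t hsa hbt hlen h
    rcases le_total (t - s) (2 * (b - a)) with hle | hle
    · have h1 := half hsa hab hbt hle (h s t le_rfl (by linarith) le_rfl)
      linarith [Real.sqrt_nonneg (K * (t - s))]
    · obtain ⟨s', hs1, hs2, hs3, hs4⟩ : ∃ s', s ≤ s' ∧ s' ≤ a ∧ b ≤ s' + (t - s) / 2 ∧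
          s' + (t - s) / 2 ≤ t := by
        rcases le_total a ((s + t) / 2) with h1 | h1
        · refine ⟨max s (b - (t - s) / 2), le_max_left _ _, max_le hsa (by linarith), ?_, ?_⟩
          · linarith [le_max_right s (b - (t - s) / 2)]
          · have : max s (b - (t - s) / 2) ≤ t - (t - s) / 2 := max_le (by linarith) (by linarith)
            linarith
        · exact ⟨(s + t) / 2, by linarith, h1, by linarith, by linarith⟩
      have e : s' + (t - s) / 2 - s' = (t - s) / 2 := by ring
      have h1 := ih hs2 hs3 (by rw [e]; rw [pow_succ] at hlen; linarith)
        fun u v hu huv hv => h u v (hs1.trans hu) huv (hv.trans hs4)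
      have h2 := half hs1 (by linarith : s' < s' + (t - s) / 2) hs4 (by linarith)
        (h s t le_rfl (by linarith) le_rfl)
      rw [e] at h1
      have h3 : √(K * ((t - s) / 2)) ≤ 0.71 * √(K * (t - s)) := by
        rw [Real.sqrt_le_left (by positivity), mul_pow, Real.sq_sqrt (by
          have : 0 ≤ t - s := by linarith
          positivity)]
        have : 0 ≤ K * (t - s) := mul_nonneg hK (by linarith)
        nlinarith
      calc ‖slope γ a b - slope γ s t‖ ≤ ‖slope γ a b - slope γ s' (s' + (t - s) / 2)‖ +
            ‖slope γ s' (s' + (t - s) / 2) - slope γ s t‖ := norm_sub_le_norm_sub_add_norm_sub _ _ _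
        _ ≤ 10 * (0.71 * √(K * (t - s))) + 2.45 * √(K * (t - s)) := by linarith
        _ ≤ _ := by linarith [Real.sqrt_nonneg (K * (t - s))]

/-- `γ` is almost straight on `[s, t]`. -/
def Straight (K : ℝ) (γ : ℝ → ℂ) (s t : ℝ) : Prop :=
  ∀ u v, s ≤ u → u ≤ v → v ≤ t → (v - u) * (1 - K * (v - u)) ≤ ‖γ v - γ u‖

theorem Straight.mono {K : ℝ} {γ : ℝ → ℂ} {s t s' t' : ℝ} (h : Straight K γ s t) (hs : s ≤ s')
    (ht : t' ≤ t) : Straight K γ s' t' :=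
  fun u v hu huv hv => h u v (hs.trans hu) huv (hv.trans ht)

theorem Straight.norm_slope_sub_le {γ : ℝ → ℂ} (hl : LipschitzWith 1 γ) {K s t a b : ℝ}
    (hK : 0 ≤ K) (h : Straight K γ s t) (hsa : s ≤ a) (hab : a < b) (hbt : b ≤ t) :
    ‖slope γ a b - slope γ s t‖ ≤ 10 * √(K * (t - s)) := by
  obtain ⟨k, hk⟩ := pow_unbounded_of_one_lt ((t - s) / (b - a)) (one_lt_two)
  rw [div_lt_iff₀ (by linarith)] at hk
  exact QuarterPlane.norm_slope_sub_le hl hK hab k hsa hbt hk.le h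

theorem Straight.norm_slope_sub_le' {γ : ℝ → ℂ} (hl : LipschitzWith 1 γ) {K s t a b : ℝ}
    (hK : 0 ≤ K) (h : Straight K γ s t) (ha : a ∈ Icc s t) (hb : b ∈ Icc s t) (hab : a ≠ b) :
    ‖slope γ a b - slope γ s t‖ ≤ 10 * √(K * (t - s)) := by
  rcases hab.lt_or_gt with h1 | h1
  · exact h.norm_slope_sub_le hl hK ha.1 h1 hb.2
  · rw [slope_comm]
    exact h.norm_slope_sub_le hl hK hb.1 h1 ha.2

theorem tendsto_sqrt_window (K : ℝ) : Tendsto (fun r : ℝ => 10 * √(K * (2 * r))) (𝓝 0) (𝓝 0) := by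
  have : Continuous fun r : ℝ => 10 * √(K * (2 * r)) := by fun_prop
  simpa using this.tendsto 0

/-- A locally almost straight curve is differentiable. -/
theorem Straight.exists_hasDerivAt {γ : ℝ → ℂ} (hl : LipschitzWith 1 γ) {K t r : ℝ}
    (hK : 0 ≤ K) (hr : 0 < r) (h : Straight K γ (t - r) (t + r)) : ∃ d, HasDerivAt γ d t := by
  have hc : Cauchy (map (slope γ t) (𝓝[≠] t)) := by
    rw [Metric.cauchy_iff]
    refine ⟨inferInstance, fun ε hε => ?_⟩
    have ev1 : ∀ᶠ x in 𝓝[>] (0:ℝ), 10 * √(K * (2 * x)) < ε / 2 :=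
      ((tendsto_sqrt_window K).eventually_lt_const (half_pos hε)).filter_mono nhdsWithin_le_nhds
    have ev2 : ∀ᶠ x in 𝓝[>] (0:ℝ), x ∈ Ioo 0 r := Ioo_mem_nhdsGT hr
    obtain ⟨r', hr'1, hr'0, hr'2⟩ := (ev1.and ev2).exists
    have h' : Straight K γ (t - r') (t + r') := h.mono (by linarith) (by linarith)
    refine ⟨slope γ t '' (Icc (t - r') (t + r') ∩ {t}ᶜ), image_mem_map (inter_mem
      (mem_nhdsWithin_of_mem_nhds (Icc_mem_nhds (by linarith) (by linarith)))
      self_mem_nhdsWithin), ?_⟩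
    rintro _ ⟨b, ⟨hb, hbt⟩, rfl⟩ _ ⟨c, ⟨hc, hct⟩, rfl⟩
    have htm : t ∈ Icc (t - r') (t + r') := ⟨by linarith, by linarith⟩
    have e1 := h'.norm_slope_sub_le' hl hK htm hb (Ne.symm hbt)
    have e2 := h'.norm_slope_sub_le' hl hK htm hc (Ne.symm hct)
    rw [show t + r' - (t - r') = 2 * r' by ring] at e1 e2
    rw [dist_eq_norm]
    calc _ ≤ ‖slope γ t b - slope γ (t - r') (t + r')‖ +
          ‖slope γ (t - r') (t + r') - slope γ t c‖ := norm_sub_le_norm_sub_add_norm_sub _ _ _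
      _ < ε := by rw [norm_sub_rev (slope γ (t - r') (t + r'))]; linarith
  obtain ⟨d, hd⟩ := cauchy_map_iff_exists_tendsto.1 hc
  exact ⟨d, hasDerivAt_iff_tendsto_slope.2 hd⟩

theorem Straight.norm_deriv_sub_le {γ : ℝ → ℂ} (hl : LipschitzWith 1 γ) {K s t a : ℝ} {d : ℂ}
    (hK : 0 ≤ K) (h : Straight K γ s t) (ha : s ≤ a) (hat : a < t) (hd : HasDerivAt γ d a) :
    ‖d - slope γ s t‖ ≤ 10 * √(K * (t - s)) := by
  have h1 : Tendsto (slope γ a) (𝓝[>] a) (𝓝 d) :=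
    (hasDerivAt_iff_tendsto_slope.1 hd).mono_left (nhdsWithin_mono _ fun x hx => ne_of_gt hx)
  refine le_of_tendsto (h1.sub_const _).norm ?_
  filter_upwards [Ioo_mem_nhdsGT hat] with b hb
  exact h.norm_slope_sub_le hl hK ha hb.1 hb.2.le

theorem Straight.norm_deriv {γ : ℝ → ℂ} (hl : LipschitzWith 1 γ) {K s t : ℝ} {d : ℂ}
    (h : Straight K γ s t) (hst : s < t) (hd : HasDerivAt γ d s) : ‖d‖ = 1 := by
  have h1 : Tendsto (fun b => ‖slope γ s b‖) (𝓝[>] s) (𝓝 ‖d‖) :=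
    ((hasDerivAt_iff_tendsto_slope.1 hd).mono_left
      (nhdsWithin_mono _ fun x hx => ne_of_gt hx)).norm
  have hn : ∀ b, s < b → ‖slope γ s b‖ = ‖γ b - γ s‖ / (b - s) := fun b hb => by
    rw [slope_def_module, norm_smul, norm_inv, Real.norm_of_nonneg (by linarith)]
    rw [inv_mul_eq_div]
  refine le_antisymm (le_of_tendsto h1 ?_) ?_
  · filter_upwards [self_mem_nhdsWithin] with b hb
    have hb' : s < b := hb
    rw [hn b hb, div_le_one (by linarith)]
    have := norm_sub_le_of_lip hl b s
    rwa [abs_of_nonneg (by linarith)] at this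
  · have h2 : Tendsto (fun b => 1 - K * (b - s)) (𝓝[>] s) (𝓝 1) := by
      have : Continuous fun b => 1 - K * (b - s) := by fun_prop
      have h3 := (this.tendsto s).mono_left (nhdsWithin_le_nhds (s := Ioi s))
      simpa using h3
    refine le_of_tendsto_of_tendsto h2 h1 ?_
    filter_upwards [Ioo_mem_nhdsGT hst] with b hb
    rw [hn b hb.1, le_div_iff₀ (by linarith [hb.1]), mul_comm]
    exact h s b le_rfl hb.1.le hb.2.le

theorem Mini.straight {n : ℕ} {cn p lam : ℝ} {z0 : ℂ} {T : ℝ} {γ : ℝ → ℂ}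
    (hn : 1 ≤ n) (hcn : 0 ≤ cn) (hp : 2 ≤ p) (hlam : 0 ≤ lam)
    (h : Mini n cn p lam quad bdry z0 T γ) {s t m : ℝ} (hs : 0 ≤ s) (htT : t ≤ T) (hm : 0 < m)
    (hre : ∀ u ∈ Icc s t, m ≤ (γ u).re) (him : ∀ u ∈ Icc s t, m ≤ (γ u).im)
    (hst : t - s ≤ m / 2) : Straight (8 * n / m) γ s t := by
  intro u v hu huv hv
  exact h.chord hn hcn hp hlam subset_rfl convex_quad (hs.trans hu) huv (hv.trans htT) hm
    (hre u ⟨hu, huv.trans hv⟩) (him u ⟨hu, huv.trans hv⟩) (by linarith)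

theorem Mini.exists_window {n : ℕ} {cn p lam : ℝ} {z0 : ℂ} {T : ℝ} {γ : ℝ → ℂ}
    (hn : 1 ≤ n) (hcn : 0 ≤ cn) (hp : 2 ≤ p) (hlam : 0 ≤ lam)
    (h : Mini n cn p lam quad bdry z0 T γ) {t : ℝ} (ht : 0 ≤ t) (htT : t < T) :
    ∃ K r, 0 ≤ K ∧ 0 < r ∧ t + r ≤ T ∧ ∀ s, 0 ≤ s → t - r ≤ s → Straight K γ s (t + r) := by
  obtain ⟨hx, hy⟩ := h.coord_pos hcn (by linarith) hlam ht htT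
  set m := min (γ t).re (γ t).im / 2 with hm
  have hm0 : 0 < m := half_pos (lt_min hx hy)
  have hmx : 2 * m ≤ (γ t).re := by rw [hm]; linarith [min_le_left (γ t).re (γ t).im]
  have hmy : 2 * m ≤ (γ t).im := by rw [hm]; linarith [min_le_right (γ t).re (γ t).im]
  set r := min (m / 4) (T - t) with hr
  have hr0 : 0 < r := lt_min (by positivity) (by linarith)
  have hr1 : r ≤ m / 4 := min_le_left _ _
  have hr2 : r ≤ T - t := min_le_right _ _
  refine ⟨8 * n / m, r, by positivity, hr0, by linarith, fun s hs hts => ?_⟩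
  have hu : ∀ u ∈ Icc s (t + r), m ≤ (γ u).re ∧ m ≤ (γ u).im := by
    intro u hu
    have h1 : ‖γ u - γ t‖ ≤ r := (norm_sub_le_of_lip h.lip u t).trans
      (abs_le.2 ⟨by linarith [hu.1], by linarith [hu.2]⟩)
    obtain ⟨h2, h3⟩ := le_of_abs_re_sub h1
    have h4 := (abs_le.1 h2).1
    have h5 := (abs_le.1 h3).1
    exact ⟨by linarith, by linarith⟩
  exact h.straight hn hcn hp hlam hs (by linarith) hm0 (fun u q => (hu u q).1)
    (fun u q => (hu u q).2) (by linarith)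

theorem Mini.hasDerivAt {n : ℕ} {cn p lam : ℝ} {z0 : ℂ} {T : ℝ} {γ : ℝ → ℂ}
    (hn : 1 ≤ n) (hcn : 0 ≤ cn) (hp : 2 ≤ p) (hlam : 0 ≤ lam)
    (h : Mini n cn p lam quad bdry z0 T γ) {t : ℝ} (ht : t ∈ Ioo 0 T) :
    HasDerivAt γ (deriv γ t) t := by
  obtain ⟨K, r, hK, hr, hrT, hs⟩ := h.exists_window hn hcn hp hlam ht.1.le ht.2
  have h1 : Straight K γ (t - min r t) (t + min r t) :=
    (hs _ (sub_nonneg.2 (min_le_right _ _)) (by linarith [min_le_left r t])).mono le_rfl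
      (by linarith [min_le_left r t])
  obtain ⟨d, hd⟩ := h1.exists_hasDerivAt h.lip hK (lt_min hr ht.1)
  exact hd.differentiableAt.hasDerivAt

theorem Mini.norm_deriv {n : ℕ} {cn p lam : ℝ} {z0 : ℂ} {T : ℝ} {γ : ℝ → ℂ}
    (hn : 1 ≤ n) (hcn : 0 ≤ cn) (hp : 2 ≤ p) (hlam : 0 ≤ lam)
    (h : Mini n cn p lam quad bdry z0 T γ) {t : ℝ} (ht : t ∈ Ioo 0 T) : ‖deriv γ t‖ = 1 := by
  obtain ⟨K, r, hK, hr, hrT, hs⟩ := h.exists_window hn hcn hp hlam ht.1.le ht.2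
  exact (hs t ht.1.le (by linarith)).norm_deriv h.lip (by linarith)
    (h.hasDerivAt hn hcn hp hlam ht)

theorem Mini.continuousOn_deriv {n : ℕ} {cn p lam : ℝ} {z0 : ℂ} {T : ℝ} {γ : ℝ → ℂ}
    (hn : 1 ≤ n) (hcn : 0 ≤ cn) (hp : 2 ≤ p) (hlam : 0 ≤ lam)
    (h : Mini n cn p lam quad bdry z0 T γ) : ContinuousOn (deriv γ) (Ioo 0 T) := by
  refine fun t ht => ContinuousAt.continuousWithinAt ?_
  obtain ⟨K, r, hK, hr, hrT, hs⟩ := h.exists_window hn hcn hp hlam ht.1.le ht.2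
  rw [Metric.continuousAt_iff]
  intro ε hε
  have ev1 : ∀ᶠ x in 𝓝[>] (0:ℝ), 10 * √(K * (2 * x)) < ε / 2 :=
    ((tendsto_sqrt_window K).eventually_lt_const (half_pos hε)).filter_mono nhdsWithin_le_nhds
  have ev2 : ∀ᶠ x in 𝓝[>] (0:ℝ), x ∈ Ioo 0 (min r t) := Ioo_mem_nhdsGT (lt_min hr ht.1)
  obtain ⟨r', hr'1, hr'0, hr'2⟩ := (ev1.and ev2).exists
  obtain ⟨hr'3, hr'4⟩ := lt_min_iff.1 hr'2
  have h1 : Straight K γ (t - r') (t + r') :=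
    (hs _ (by linarith) (by linarith)).mono le_rfl (by linarith)
  refine ⟨r', hr'0, fun {x} hx => ?_⟩
  rw [Real.dist_eq] at hx
  have hx1 := (abs_lt.1 hx).1
  have hx2 := (abs_lt.1 hx).2
  have e1 := h1.norm_deriv_sub_le h.lip hK (by linarith) (by linarith)
    (h.hasDerivAt hn hcn hp hlam (t := x) ⟨by linarith, by linarith⟩)
  have e2 := h1.norm_deriv_sub_le h.lip hK (by linarith) (by linarith)
    (h.hasDerivAt hn hcn hp hlam ht)
  rw [show t + r' - (t - r') = 2 * r' by ring] at e1 e2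
  rw [dist_eq_norm]
  calc _ ≤ ‖deriv γ x - slope γ (t - r') (t + r')‖ +
        ‖slope γ (t - r') (t + r') - deriv γ t‖ := norm_sub_le_norm_sub_add_norm_sub _ _ _
    _ < ε := by rw [norm_sub_rev (slope γ (t - r') (t + r'))]; linarith

theorem Mini.exists_tendsto_deriv {n : ℕ} {cn p lam : ℝ} {z0 : ℂ} {T : ℝ} {γ : ℝ → ℂ}
    (hn : 1 ≤ n) (hcn : 0 ≤ cn) (hp : 2 ≤ p) (hlam : 0 ≤ lam)
    (h : Mini n cn p lam quad bdry z0 T γ) (hT : 0 < T) :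
    ∃ d, Tendsto (deriv γ) (𝓝[>] 0) (𝓝 d) := by
  obtain ⟨K, r, hK, hr, hrT, hs⟩ := h.exists_window hn hcn hp hlam le_rfl hT
  refine cauchy_map_iff_exists_tendsto.1 ?_
  rw [Metric.cauchy_iff]
  refine ⟨inferInstance, fun ε hε => ?_⟩
  have ev1 : ∀ᶠ x in 𝓝[>] (0:ℝ), 10 * √(K * (2 * x)) < ε / 2 :=
    ((tendsto_sqrt_window K).eventually_lt_const (half_pos hε)).filter_mono nhdsWithin_le_nhds
  have ev2 : ∀ᶠ x in 𝓝[>] (0:ℝ), x ∈ Ioo 0 (r / 2) := Ioo_mem_nhdsGT (half_pos hr)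
  obtain ⟨r', hr'1, hr'0, hr'2⟩ := (ev1.and ev2).exists
  have h1 : Straight K γ 0 (2 * r') := (hs 0 le_rfl (by linarith)).mono le_rfl (by linarith)
  refine ⟨deriv γ '' Ioo 0 (2 * r'), image_mem_map (Ioo_mem_nhdsGT (by linarith)), ?_⟩
  rintro _ ⟨b, hb, rfl⟩ _ ⟨c, hc, rfl⟩
  have e1 := h1.norm_deriv_sub_le h.lip hK hb.1.le hb.2
    (h.hasDerivAt hn hcn hp hlam ⟨hb.1, by linarith [hb.2]⟩)
  have e2 := h1.norm_deriv_sub_le h.lip hK hc.1.le hc.2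
    (h.hasDerivAt hn hcn hp hlam ⟨hc.1, by linarith [hc.2]⟩)
  rw [sub_zero] at e1 e2
  rw [dist_eq_norm]
  calc _ ≤ ‖deriv γ b - slope γ 0 (2 * r')‖ +
        ‖slope γ 0 (2 * r') - deriv γ c‖ := norm_sub_le_norm_sub_add_norm_sub _ _ _
    _ < ε := by rw [norm_sub_rev (slope γ 0 (2 * r'))]; linarith

/-- A minimal curve hits the boundary perpendicularly. -/
theorem Mini.eventually_im_ge {n : ℕ} {cn p lam : ℝ} {z0 : ℂ} {T : ℝ} {γ : ℝ → ℂ}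
    (hn : 1 ≤ n) (hcn : 0 < cn) (hp : 2 ≤ p) (hlam : 0 ≤ lam)
    (h : Mini n cn p lam quad bdry z0 T γ) (hT : 0 < T) (hT0 : (γ T).im = 0)
    (hTx : 0 < (γ T).re) {ρ : ℝ} (hρ : 0 < ρ) (hρ1 : ρ < 1) :
    ∀ᶠ s in 𝓝[<] T, (1 - ρ) * (T - s) ≤ (γ s).im := by
  obtain ⟨m, rfl⟩ : ∃ m, n = m + 1 := ⟨n - 1, by omega⟩
  set X := (γ T).re with hX
  set N : ℝ := ((m + 1 : ℕ) : ℝ) with hN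
  have hN0 : 0 < N := by positivity
  have hfc := Adm.continuous_weight_comp (n := m + 1) (cn := cn) h.lip
  have ev1 : ∀ᶠ s in 𝓝[<] T, s ∈ Ioo (max 0 (T - X)) T :=
    Ioo_mem_nhdsLT (max_lt hT (by linarith))
  have ev2 : ∀ᶠ s in 𝓝[<] T, 2 * p * (T - s) < 1 := by
    have : Continuous fun s : ℝ => 2 * p * (T - s) := by fun_prop
    have h1 := (this.tendsto T).mono_left (nhdsWithin_le_nhds (s := Iio T))
    rw [sub_self, mul_zero] at h1
    exact h1.eventually_lt_const one_pos
  have ev3 : ∀ᶠ s in 𝓝[<] T, 2 * lam * (T - s) < 1 := by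
    have : Continuous fun s : ℝ => 2 * lam * (T - s) := by fun_prop
    have h1 := (this.tendsto T).mono_left (nhdsWithin_le_nhds (s := Iio T))
    rw [sub_self, mul_zero] at h1
    exact h1.eventually_lt_const one_pos
  have ev4 : ∀ᶠ s in 𝓝[<] T, ((1 - ρ) * (1 + 2 * p * (T - s))) ^ (m + 1) * (X + (T - s)) ^ m <
      (X - (T - s)) ^ m := by
    refine Eventually.filter_mono nhdsWithin_le_nhds ?_
    have c1 : Continuous fun s : ℝ =>
      ((1 - ρ) * (1 + 2 * p * (T - s))) ^ (m + 1) * (X + (T - s)) ^ m := by fun_prop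
    have c2 : Continuous fun s : ℝ => (X - (T - s)) ^ m := by fun_prop
    refine c1.continuousAt.eventually_lt c2.continuousAt ?_
    rw [sub_self, mul_zero, add_zero, mul_one, add_zero, sub_zero]
    have h1 : (1 - ρ) ^ (m + 1) < 1 := pow_lt_one₀ (by linarith) (by linarith) (by omega)
    have h2 : 0 < X ^ m := by positivity
    nlinarith
  filter_upwards [ev1, ev2, ev3, ev4] with s hs h2p h2l h4
  have hs0 : 0 < s := (le_max_left _ _).trans_lt hs.1
  have hsX : T - s < X := by linarith [(le_max_right 0 (T - X)).trans_lt hs.1]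
  have hsT : s < T := hs.2
  set ℓ := T - s with hℓ
  have hℓ0 : 0 < ℓ := by linarith
  set c := 1 + 2 * p * ℓ with hc
  have hc0 : 0 < c := by positivity
  have hbd : ∀ t ∈ Icc s T, X - ℓ ≤ (γ t).re ∧ (γ t).re ≤ X + ℓ ∧ (γ t).im ≤ ℓ := by
    intro t ht
    have h1 := norm_sub_le_of_lip h.lip t T
    rw [abs_sub_comm, abs_of_nonneg (by linarith [ht.2])] at h1
    obtain ⟨h2, h3⟩ := le_of_abs_re_sub (h1.trans (by linarith [ht.1] : T - t ≤ ℓ))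
    rw [hT0, sub_zero] at h3
    exact ⟨by linarith [(abs_le.1 h2).1], by linarith [(abs_le.1 h2).2], (abs_le.1 h3).2⟩
  have htail : ∀ t ∈ Icc s T, ∫ r in t..T, weight (m + 1) cn (γ r) ≤
      c * (cn * (γ t).re ^ m * (γ t).im ^ (m + 1) / N) := by
    intro t ht
    obtain ⟨b1, b2, b3⟩ := hbd t ht
    have b4 := (h.mem t).1
    have b5 := (h.mem t).2
    have q : ∀ c : ℝ, 0 ≤ c → 2 * c * (γ t).im ≤ 2 * c * ℓ := fun c hc =>
      mul_le_mul_of_nonneg_left b3 (by positivity)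
    have h1 := h.tail_le hn hcn.le (by linarith) hlam hT0 (by linarith [ht.1]) ht.2
      ((q p (by linarith)).trans h2p.le) ((q lam hlam).trans h2l.le)
    refine h1.trans ?_
    rw [Nat.add_sub_cancel]
    refine mul_le_mul_of_nonneg_right ?_ (by positivity)
    linarith [q p (by linarith)]
  have b2 : ((N / c) ^ m * (cn * (X - ℓ) ^ m)) * (T - s) ^ (m + 1) ≤
      N ^ (m + 1) * ∫ t in s..T, weight (m + 1) cn (γ t) := by
    have hXl : 0 < X - ℓ := by linarith
    refine mul_pow_le_of_tail hn (by positivity) hsT.le hfc ?_ ?_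
    · intro t ht
      obtain ⟨h1, h2⟩ := h.coord_pos hcn.le (by linarith) hlam (hs0.le.trans ht.1) ht.2
      rw [weight_eq]; positivity
    · intro t ht
      have ht' : t ∈ Icc s T := ⟨ht.1.le, ht.2.le⟩
      obtain ⟨b1, b2, b3⟩ := hbd t ht'
      have h3 := htail t ht'
      have ha : 0 ≤ ∫ r in t..T, weight (m + 1) cn (γ r) :=
        intervalIntegral.integral_nonneg ht.2.le fun t _ => weight_nonneg hcn.le (h.mem t)
      rw [Nat.add_sub_cancel]
      have b4 := (h.mem t).1
      have b5 := (h.mem t).2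
      set x := (γ t).re
      set y := (γ t).im
      calc (N / c) ^ m * (cn * (X - ℓ) ^ m) * (∫ r in t..T, weight (m + 1) cn (γ r)) ^ m
          ≤ (N / c) ^ m * (cn * x ^ m) * (c * (cn * x ^ m * y ^ (m + 1) / N)) ^ m := by
            gcongr
        _ = cn * x ^ m * ((N / c) * (c * (cn * x ^ m * y ^ (m + 1) / N))) ^ m := by
            rw [mul_pow (N / c)]; ring
        _ = cn * x ^ m * (cn * x ^ m * y ^ (m + 1)) ^ m := by
            congr 2; field_simp
        _ = _ := by rw [weight_eq, Nat.add_sub_cancel]; ring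
  have h5 := htail s ⟨le_rfl, hsT.le⟩
  obtain ⟨-, h6, -⟩ := hbd s ⟨le_rfl, hsT.le⟩
  have hx0 := (h.mem s).1
  have hy0 := (h.mem s).2
  set x := (γ s).re
  set y := (γ s).im
  have h7 : (X - ℓ) ^ m * ℓ ^ (m + 1) ≤ (X + ℓ) ^ m * (c * y) ^ (m + 1) := by
    have e1 := b2.trans (mul_le_mul_of_nonneg_left h5 (by positivity))
    have e2 : N ^ (m + 1) * (c * (cn * x ^ m * y ^ (m + 1) / N)) ≤
        N ^ (m + 1) * (c * (cn * (X + ℓ) ^ m * y ^ (m + 1) / N)) := by gcongr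
    have e3 := e1.trans e2
    have e4 : (N / c) ^ m * cn * ((X - ℓ) ^ m * ℓ ^ (m + 1)) ≤
        (N / c) ^ m * cn * ((X + ℓ) ^ m * (c * y) ^ (m + 1)) := by
      calc _ = (N / c) ^ m * (cn * (X - ℓ) ^ m) * ℓ ^ (m + 1) := by ring
        _ ≤ _ := e3
        _ = _ := by
          rw [div_pow, mul_pow c, pow_succ N, pow_succ c]
          field_simp
    exact le_of_mul_le_mul_left e4 (by positivity)
  by_contra! hlt
  have hXl : 0 < X + ℓ := by linarith
  have h8 : (X + ℓ) ^ m * (c * y) ^ (m + 1) ≤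
      (X + ℓ) ^ m * (c * ((1 - ρ) * ℓ)) ^ (m + 1) := by gcongr
  have h9 : (X - ℓ) ^ m * ℓ ^ (m + 1) ≤
      (((1 - ρ) * c) ^ (m + 1) * (X + ℓ) ^ m) * ℓ ^ (m + 1) := by
    refine (h7.trans h8).trans (le_of_eq ?_)
    rw [mul_pow, mul_pow, mul_pow]; ring
  have h10 := le_of_mul_le_mul_right h9 (by positivity)
  linarith

theorem Mini.tendsto_deriv {n : ℕ} {cn p lam : ℝ} {z0 : ℂ} {T : ℝ} {γ : ℝ → ℂ}
    (hn : 1 ≤ n) (hcn : 0 < cn) (hp : 2 ≤ p) (hlam : 0 ≤ lam)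
    (h : Mini n cn p lam quad bdry z0 T γ) (hT : 0 < T) (hT0 : (γ T).im = 0)
    (hTx : 0 < (γ T).re) : Tendsto (deriv γ) (𝓝[<] T) (𝓝 (-Complex.I)) := by
  rw [Metric.tendsto_nhds]
  intro ε hε
  have hw : Tendsto (fun e : ℝ => 10 * √(16 * n * e)) (𝓝[>] 0) (𝓝 0) := by
    have : Continuous fun r : ℝ => 10 * √(16 * n * r) := by fun_prop
    have h1 := (this.tendsto 0).mono_left (nhdsWithin_le_nhds (s := Ioi 0))
    simpa using h1
  have ev1 : ∀ᶠ e in 𝓝[>] (0:ℝ), e ∈ Ioo (0:ℝ) (1 / 4) := Ioo_mem_nhdsGT (by norm_num)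
  obtain ⟨e, ⟨he0, he4⟩, he⟩ := (ev1.and (hw.eventually_lt_const (half_pos hε))).exists
  have hw2 : Tendsto (fun ρ : ℝ => √(4 * ρ / e)) (𝓝[>] 0) (𝓝 0) := by
    have : Continuous fun ρ : ℝ => √(4 * ρ / e) := by fun_prop
    have h1 := (this.tendsto 0).mono_left (nhdsWithin_le_nhds (s := Ioi 0))
    simpa using h1
  have ev2 : ∀ᶠ e in 𝓝[>] (0:ℝ), e ∈ Ioo (0:ℝ) (1 / 2) := Ioo_mem_nhdsGT (by norm_num)
  obtain ⟨ρ, ⟨hρ0, hρ2⟩, hρ⟩ := (ev2.and (hw2.eventually_lt_const (half_pos hε))).exists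
  set X := (γ T).re with hX
  have ev3 : ∀ᶠ s in 𝓝[<] T, s ∈ Ioo (max 0 (T - X / 2)) T :=
    Ioo_mem_nhdsLT (max_lt hT (by linarith))
  filter_upwards [ev3, h.eventually_im_ge hn hcn hp hlam hT hT0 hTx hρ0 (by linarith)]
    with s hs hys
  have hs0 : 0 < s := (le_max_left _ _).trans_lt hs.1
  have hsT : s < T := hs.2
  have hsX : T - s < X / 2 := by linarith [(le_max_right 0 (T - X / 2)).trans_lt hs.1]
  have hbd : ∀ t ∈ Icc s T, X - (T - t) ≤ (γ t).re ∧ (γ t).im ≤ T - t := by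
    intro t ht
    have h1 := norm_sub_le_of_lip h.lip t T
    rw [abs_sub_comm, abs_of_nonneg (by linarith [ht.2])] at h1
    obtain ⟨h2, h3⟩ := le_of_abs_re_sub h1
    rw [hT0, sub_zero] at h3
    exact ⟨by linarith [(abs_le.1 h2).1], (abs_le.1 h3).2⟩
  have hyl := (hbd s ⟨le_rfl, hsT.le⟩).2
  set y := (γ s).im with hy
  have hy0 : 0 < y := lt_of_lt_of_le (mul_pos (by linarith) (by linarith)) hys
  have hy2 : (T - s) / 2 ≤ y := by nlinarith
  set a := e * y with ha
  have ha0 : 0 < a := mul_pos he0 hy0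
  have ha4 : a ≤ y / 4 := by nlinarith
  have hst : Straight (8 * n / (y / 2)) γ s (s + a) := by
    refine h.straight hn hcn.le hp hlam hs0.le (by linarith) (by linarith) ?_ ?_ (by linarith)
    · intro u hu
      have := (hbd u ⟨hu.1, by linarith [hu.2]⟩).1
      linarith [hu.1]
    · intro u hu
      have h1 := norm_sub_le_of_lip h.lip u s
      rw [abs_of_nonneg (by linarith [hu.1])] at h1
      have h2 := (abs_le.1 (le_of_abs_re_sub h1).2).1
      linarith [hu.2]
  have d1 := hst.norm_deriv_sub_le h.lip (by positivity) le_rfl (by linarith)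
    (h.hasDerivAt hn hcn.le hp hlam ⟨hs0, hsT⟩)
  rw [show 8 * (n:ℝ) / (y / 2) * (s + a - s) = 16 * n * e by
    rw [ha]; field_simp; ring] at d1
  have d2 : ‖slope γ s (s + a) - -Complex.I‖ ≤ √(4 * ρ / e) := by
    refine Real.le_sqrt_of_sq_le ?_
    have e1 : slope γ s (s + a) = a⁻¹ • (γ (s + a) - γ s) := by
      rw [slope_def_module, add_sub_cancel_left]
    have n1 : ‖slope γ s (s + a)‖ ≤ 1 := by
      have := norm_sub_le_of_lip h.lip (s + a) s
      rw [add_sub_cancel_left, abs_of_pos ha0] at this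
      rw [e1, norm_smul, norm_inv, Real.norm_of_nonneg ha0.le, inv_mul_le_iff₀ ha0]
      linarith
    have i1 : (slope γ s (s + a)).im ≤ -1 + 2 * ρ / e := by
      have h1 := (hbd (s + a) ⟨by linarith, by linarith⟩).2
      rw [e1, Complex.smul_im, Complex.sub_im, smul_eq_mul, inv_mul_le_iff₀ ha0]
      have h2 : a * (-1 + 2 * ρ / e) = -a + 2 * ρ * y := by rw [ha]; field_simp
      rw [h2]
      have h3 : ρ * ((T - s) / 2) ≤ ρ * y := mul_le_mul_of_nonneg_left hy2 hρ0.le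
      linarith
    set S := slope γ s (s + a)
    have n2 := pow_le_one₀ (norm_nonneg _) n1 (n := 2)
    have n3 := normSq_sub_eq S 0
    rw [sub_zero] at n3
    rw [normSq_sub_eq]
    simp only [Complex.zero_re, Complex.zero_im, Complex.neg_re, Complex.neg_im, Complex.I_re,
      Complex.I_im] at n3 ⊢
    have : 4 * ρ / e = 2 * (2 * ρ / e) := by ring
    nlinarith
  rw [dist_eq_norm]
  calc _ ≤ ‖deriv γ s - slope γ s (s + a)‖ + ‖slope γ s (s + a) - -Complex.I‖ :=
        norm_sub_le_norm_sub_add_norm_sub _ _ _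
    _ < ε := by linarith

/-- A minimal curve is continuously differentiable up to its endpoint. -/
theorem Mini.exists_continuous_deriv {n : ℕ} {cn p lam : ℝ} {z0 : ℂ} {T : ℝ} {γ : ℝ → ℂ}
    (hn : 1 ≤ n) (hcn : 0 < cn) (hp : 2 ≤ p) (hlam : 0 ≤ lam)
    (h : Mini n cn p lam quad bdry z0 T γ) (hT : 0 < T) (hT0 : (γ T).im = 0)
    (hTx : 0 < (γ T).re) :
    ∃ D : ℝ → ℂ, Continuous D ∧ (∀ t ∈ Icc 0 T, γ t = z0 + ∫ r in (0:ℝ)..t, D r) ∧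
      (∀ t ∈ Icc 0 T, ‖D t‖ = 1) ∧ D T = -Complex.I := by
  have hd := h.continuousOn_deriv hn hcn.le hp hlam
  obtain ⟨d0, hd0⟩ := h.exists_tendsto_deriv hn hcn.le hp hlam hT
  have hdT := h.tendsto_deriv hn hcn hp hlam hT hT0 hTx
  have hE := continuousOn_Icc_extendFrom_Ioo hd hd0 hdT
  set E := extendFrom (Ioo 0 T) (deriv γ) with hEdef
  have hEeq : ∀ t ∈ Ioo 0 T, E t = deriv γ t := fun t ht =>
    extendFrom_eq (subset_closure ht) (hd t ht)
  set D := IccExtend hT.le (domRestrict (Icc 0 T) E) with hDdef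
  have hDc : Continuous D := (continuousOn_iff_continuous_domRestrict.1 hE).Icc_extend'
  have hDE : ∀ t ∈ Icc 0 T, D t = E t := fun t ht => by
    rw [hDdef, IccExtend_of_mem _ _ ht, domRestrict_apply]
  refine ⟨D, hDc, ?_, ?_, ?_⟩
  · intro t ht
    have h1 := intervalIntegral.integral_eq_sub_of_hasDerivAt_of_le (f := γ) (f' := D) ht.1
      h.lip.continuous.continuousOn (fun x hx => by
        have hx' : x ∈ Ioo 0 T := ⟨hx.1, hx.2.trans_le ht.2⟩
        rw [hDE x ⟨hx'.1.le, hx'.2.le⟩, hEeq x hx']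
        exact h.hasDerivAt hn hcn.le hp hlam hx') (hDc.intervalIntegrable _ _)
    rw [h1, h.start]; ring
  · have hcl : IsClosed {t | ‖D t‖ = 1} := isClosed_eq hDc.norm continuous_const
    have hsub : Ioo 0 T ⊆ {t | ‖D t‖ = 1} := fun t ht => by
      show ‖D t‖ = 1
      rw [hDE t ⟨ht.1.le, ht.2.le⟩, hEeq t ht]
      exact h.norm_deriv hn hcn.le hp hlam ht
    have := hcl.closure_subset_iff.2 hsub
    rw [closure_Ioo hT.ne] at this
    exact fun t ht => this ht
  · rw [hDE T ⟨hT.le, le_rfl⟩, hEdef]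
    exact eq_lim_at_right_extendFrom_Ioo hT hdT

section Rayleigh

variable {n : ℕ} {cn p L : ℝ} {α : ℝ → ℝ × ℝ} {g v w : ℝ → ℝ}

theorem Fvol_nonneg (n : ℕ) (hcn : 0 ≤ cn) {z : ℝ × ℝ} (hz : z ∈ Pset) : 0 ≤ Fvol n cn z := by
  have := hz.1
  have := hz.2
  unfold Fvol
  positivity

theorem lipschitzWith_mul_left (hL : 0 ≤ L) :
    LipschitzWith (Real.toNNReal L) (fun t : ℝ => L * t) := by
  refine LipschitzWith.of_dist_le_mul fun x y => ?_
  rw [Real.dist_eq, Real.dist_eq, ← mul_sub, abs_mul, Real.coe_toNNReal _ hL, abs_of_nonneg hL]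

theorem numG_eq (hα : ∀ t ∈ Icc (0:ℝ) 1, gSpeed α t = L)
    (hg : ∀ t ∈ Icc (0:ℝ) 1, g (L * t) = Fvol n cn (α t))
    (hw : ∀ t ∈ Icc (0:ℝ) 1, w t = v (L * t)) {t : ℝ} (ht : t ∈ Ioo (0:ℝ) 1) :
    numG n cn p (Icc 0 1) α w t =
      |deriv (fun s => v (L * s)) t| ^ p * (g (L * t) * L ^ (1 - p)) := by
  have ht' := Ioo_subset_Icc_self ht
  have h1 := hα t ht'
  rw [gSpeed] at h1
  have h2 : w =ᶠ[𝓝 t] fun s => v (L * s) := by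
    filter_upwards [Icc_mem_nhds ht.1 ht.2] with s hs using hw s hs
  rw [numG, h1, derivWithin_of_mem_nhds (Icc_mem_nhds ht.1 ht.2), h2.deriv_eq, hg t ht', mul_assoc]

theorem denG_eq (hα : ∀ t ∈ Icc (0:ℝ) 1, gSpeed α t = L)
    (hg : ∀ t ∈ Icc (0:ℝ) 1, g (L * t) = Fvol n cn (α t))
    (hw : ∀ t ∈ Icc (0:ℝ) 1, w t = v (L * t)) {t : ℝ} (ht : t ∈ Icc (0:ℝ) 1) :
    denG n cn p (Icc 0 1) α w t = L * (|v (L * t)| ^ p * g (L * t)) := by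
  have h1 := hα t ht
  rw [gSpeed] at h1
  rw [denG, h1, hg t ht, hw t ht]
  ring

theorem integral_numG (hL : 0 < L) (hα : ∀ t ∈ Icc (0:ℝ) 1, gSpeed α t = L)
    (hg : ∀ t ∈ Icc (0:ℝ) 1, g (L * t) = Fvol n cn (α t))
    (hw : ∀ t ∈ Icc (0:ℝ) 1, w t = v (L * t)) :
    ∫ t in (0:ℝ)..1, numG n cn p (Icc 0 1) α w t = ∫ t in (0:ℝ)..L, |deriv v t| ^ p * g t := by
  have h1 := intervalIntegral.mul_integral_comp_mul_add (a := (0:ℝ)) (b := 1)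
    (f := fun t => |deriv v t| ^ p * g t) (c := L) (d := 0)
  simp only [add_zero, mul_zero, mul_one] at h1
  rw [← h1, ← intervalIntegral.integral_const_mul, intervalIntegral.integral_of_le zero_le_one,
    intervalIntegral.integral_of_le zero_le_one, integral_Ioc_eq_integral_Ioo,
    integral_Ioc_eq_integral_Ioo]
  refine setIntegral_congr_fun measurableSet_Ioo fun t ht => ?_
  rw [numG_eq hα hg hw ht, deriv_comp_mul_left, smul_eq_mul, abs_mul, abs_of_pos hL,
    Real.mul_rpow hL.le (abs_nonneg _)]
  have h2 : L ^ p * L ^ (1 - p) = L := by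
    rw [← Real.rpow_add hL, add_sub_cancel, Real.rpow_one]
  linear_combination |deriv v (L * t)| ^ p * g (L * t) * h2

theorem integral_denG (hα : ∀ t ∈ Icc (0:ℝ) 1, gSpeed α t = L)
    (hg : ∀ t ∈ Icc (0:ℝ) 1, g (L * t) = Fvol n cn (α t))
    (hw : ∀ t ∈ Icc (0:ℝ) 1, w t = v (L * t)) :
    ∫ t in (0:ℝ)..1, denG n cn p (Icc 0 1) α w t = ∫ t in (0:ℝ)..L, |v t| ^ p * g t := by
  have h1 := intervalIntegral.mul_integral_comp_mul_add (a := (0:ℝ)) (b := 1)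
    (f := fun t => |v t| ^ p * g t) (c := L) (d := 0)
  simp only [add_zero, mul_zero, mul_one] at h1
  rw [← h1, ← intervalIntegral.integral_const_mul]
  refine intervalIntegral.integral_congr fun t ht => ?_
  rw [uIcc_of_le zero_le_one] at ht
  exact denG_eq hα hg hw ht

theorem intervalIntegrable_numG (hp : 0 ≤ p) (hL : 0 < L)
    (hα : ∀ t ∈ Icc (0:ℝ) 1, gSpeed α t = L) (hgc : Continuous g)
    (hg : ∀ t ∈ Icc (0:ℝ) 1, g (L * t) = Fvol n cn (α t)) (hv : ∃ K, LipschitzWith K v)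
    (hw : ∀ t ∈ Icc (0:ℝ) 1, w t = v (L * t)) :
    IntervalIntegrable (numG n cn p (Icc 0 1) α w) volume 0 1 := by
  obtain ⟨K, hK⟩ := hv
  have h1 := intervalIntegrable_deriv_rpow_mul hp (hK.comp (lipschitzWith_mul_left hL.le))
    (f := fun t => g (L * t) * L ^ (1 - p)) (by fun_prop) 0 1
  rw [intervalIntegrable_iff_integrableOn_Ioo_of_le zero_le_one] at h1 ⊢
  exact h1.congr_fun (fun t ht => (numG_eq hα hg hw ht).symm) measurableSet_Ioo

theorem intervalIntegrable_denG (hp : 0 ≤ p)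
    (hα : ∀ t ∈ Icc (0:ℝ) 1, gSpeed α t = L) (hgc : Continuous g)
    (hg : ∀ t ∈ Icc (0:ℝ) 1, g (L * t) = Fvol n cn (α t)) (hv : ∃ K, LipschitzWith K v)
    (hw : ∀ t ∈ Icc (0:ℝ) 1, w t = v (L * t)) :
    IntervalIntegrable (denG n cn p (Icc 0 1) α w) volume 0 1 := by
  obtain ⟨K, hK⟩ := hv
  have h1 : Continuous fun t => L * (|v (L * t)| ^ p * g (L * t)) := by
    have := hK.continuous
    exact continuous_const.mul (((this.comp (by fun_prop)).abs.rpow_const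
      fun _ => Or.inr hp).mul (hgc.comp (by fun_prop)))
  have h2 := h1.intervalIntegrable (μ := volume) 0 1
  rw [intervalIntegrable_iff_integrableOn_Ioo_of_le zero_le_one] at h2 ⊢
  exact h2.congr_fun (fun t ht => (denG_eq hα hg hw (Ioo_subset_Icc_self ht)).symm)
    measurableSet_Ioo

theorem gSpeedOn_nonneg (s : Set ℝ) (α : ℝ → ℝ × ℝ) (t : ℝ) : 0 ≤ gSpeedOn s α t :=
  Real.sqrt_nonneg _

theorem integral_numG_nonneg (hcn : 0 ≤ cn) (hP : ∀ t ∈ Icc (0:ℝ) 1, α t ∈ Pset) (w : ℝ → ℝ) :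
    0 ≤ ∫ t in (0:ℝ)..1, numG n cn p (Icc 0 1) α w t := by
  refine intervalIntegral.integral_nonneg zero_le_one fun t ht => ?_
  exact mul_nonneg (mul_nonneg (Real.rpow_nonneg (abs_nonneg _) _) (Fvol_nonneg n hcn (hP t ht)))
    (Real.rpow_nonneg (gSpeedOn_nonneg _ _ _) _)

theorem lambdaG_nonneg (hcn : 0 ≤ cn) (hP : ∀ t ∈ Icc (0:ℝ) 1, α t ∈ Pset) :
    0 ≤ lambdaG n cn p α := by
  refine Real.sInf_nonneg ?_
  rintro q ⟨w, -, -, -, -, hd, rfl⟩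
  exact div_nonneg (integral_numG_nonneg hcn hP w) hd.le

/-- A curve of constant speed satisfies the Hardy inequality with constant its eigenvalue. -/
theorem hardy_lambdaG (hp : 0 ≤ p) (hcn : 0 ≤ cn) (hL : 0 < L)
    (hα : ∀ t ∈ Icc (0:ℝ) 1, gSpeed α t = L) (hP : ∀ t ∈ Icc (0:ℝ) 1, α t ∈ Pset)
    (hgc : Continuous g) (hg : ∀ t ∈ Icc (0:ℝ) 1, g (L * t) = Fvol n cn (α t)) :
    Hardy p (lambdaG n cn p α) L g := by
  intro v hv hv0
  have hw : ∀ t ∈ Icc (0:ℝ) 1, (fun t => v (L * t)) t = v (L * t) := fun t _ => rfl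
  have hnum := integral_numG (p := p) hL hα hg hw
  have hden := integral_denG (p := p) hα hg hw
  have h0 := integral_numG_nonneg (n := n) (p := p) hcn hP fun t => v (L * t)
  have h1 : 0 ≤ ∫ t in (0:ℝ)..1, denG n cn p (Icc 0 1) α (fun t => v (L * t)) t :=
    intervalIntegral.integral_nonneg zero_le_one fun t ht =>
      mul_nonneg (mul_nonneg (Real.rpow_nonneg (abs_nonneg _) _) (Fvol_nonneg n hcn (hP t ht)))
        (gSpeedOn_nonneg _ _ _)
  rw [← hnum, ← hden]
  rcases h1.eq_or_lt with h2 | h2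
  · rw [← h2, mul_zero]
    exact h0
  · rw [← le_div_iff₀ h2]
    refine csInf_le ⟨0, ?_⟩ ⟨_, ?_, ?_, ?_, ?_, h2, rfl⟩
    · rintro q ⟨w, -, -, -, -, hd, rfl⟩
      exact div_nonneg (integral_numG_nonneg hcn hP w) hd.le
    · obtain ⟨K, hK⟩ := hv
      exact ⟨_, (hK.comp (lipschitzWith_mul_left hL.le)).lipschitzOnWith⟩
    · simpa using hv0
    · exact intervalIntegrable_numG hp hL hα hgc hg hv hw
    · exact intervalIntegrable_denG hp hα hgc hg hv hw

/-- The eigenvalue of a curve of constant speed is at least any Hardy constant. -/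
theorem Hardy.le_lambdaG (hp : 0 ≤ p) (hcn : 0 < cn) (hL : 0 < L)
    (hα : ∀ t ∈ Icc (0:ℝ) 1, gSpeed α t = L) (hP : ∀ t ∈ Ico (0:ℝ) 1, α t ∈ Pint)
    (hgc : Continuous g) (hg : ∀ t ∈ Icc (0:ℝ) 1, g (L * t) = Fvol n cn (α t)) {lam : ℝ}
    (h : Hardy p lam L g) : lam ≤ lambdaG n cn p α := by
  refine le_csInf ?_ ?_
  · have hv : ∃ K, LipschitzWith K (fun t : ℝ => L⁻¹ * t) :=
      ⟨_, lipschitzWith_mul_left (inv_nonneg.2 hL.le)⟩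
    have hw : ∀ t ∈ Icc (0:ℝ) 1, (fun t : ℝ => t) t = (fun t : ℝ => L⁻¹ * t) (L * t) :=
      fun t _ => by field_simp
    have hd := intervalIntegrable_denG (p := p) hp hα hgc hg hv hw
    refine ⟨_, fun t => t, ⟨1, LipschitzWith.id.lipschitzOnWith⟩, rfl,
      intervalIntegrable_numG hp hL hα hgc hg hv hw, hd, ?_, rfl⟩
    refine intervalIntegral.intervalIntegral_pos_of_pos_on hd (fun t ht => ?_) zero_lt_one
    have h1 := hα t (Ioo_subset_Icc_self ht)
    rw [gSpeed] at h1
    obtain ⟨h2, h3⟩ := hP t ⟨ht.1.le, ht.2⟩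
    have h4 : 0 < |t| := abs_pos.2 ht.1.ne'
    rw [denG, h1, Fvol]
    positivity
  · rintro q ⟨w, ⟨K, hK⟩, hw0, -, -, hd, rfl⟩
    set v : ℝ → ℝ := fun τ => IccExtend zero_le_one (domRestrict (Icc (0:ℝ) 1) w) (L⁻¹ * τ) with hvd
    have hw : ∀ t ∈ Icc (0:ℝ) 1, w t = v (L * t) := fun t ht => by
      have : L⁻¹ * (L * t) = t := by field_simp
      rw [hvd]
      simp only
      rw [this, IccExtend_of_mem _ _ ht, domRestrict_apply]
    have hv : ∃ K, LipschitzWith K v :=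
      ⟨_, ((hK.to_restrict.comp (LipschitzWith.projIcc zero_le_one)).comp
        (lipschitzWith_mul_left (inv_nonneg.2 hL.le)))⟩
    have hv0 : v 0 = 0 := by
      have := hw 0 ⟨le_rfl, zero_le_one⟩
      rw [mul_zero] at this
      rw [← this, hw0]
    rw [le_div_iff₀ hd, integral_numG hL hα hg hw, integral_denG hα hg hw]
    exact h v hv hv0

end Rayleigh

/-- The point of the complex plane with the given coordinates. -/
def toC (z : ℝ × ℝ) : ℂ := z.1 + z.2 * Complex.I

@[simp] theorem toC_re (z : ℝ × ℝ) : (toC z).re = z.1 := by simp [toC]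

@[simp] theorem toC_im (z : ℝ × ℝ) : (toC z).im = z.2 := by simp [toC]

theorem weight_toC (n : ℕ) (cn : ℝ) (z : ℝ × ℝ) : weight n cn (toC z) = Fvol n cn z := by
  simp [weight, Fvol]

theorem _root_.MemC.mem_Pset {x0 y0 : ℝ} {β : ℝ → ℝ × ℝ} (h : MemC x0 y0 β) {t : ℝ}
    (ht : t ∈ Icc (0:ℝ) 1) : β t ∈ Pset := by
  obtain ⟨-, -, hii, hb, -⟩ := h
  rcases ht.2.lt_or_eq with h1 | h1
  · exact ⟨(hii t ⟨ht.1, h1⟩).1.le, (hii t ⟨ht.1, h1⟩).2.le⟩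
  · rw [h1]
    exact hb.1

theorem _root_.MemC.norm_sub_le {x0 y0 : ℝ} {β : ℝ → ℝ × ℝ} (h : MemC x0 y0 β) {s t : ℝ}
    (hs : s ∈ Icc (0:ℝ) 1) (ht : t ∈ Icc (0:ℝ) 1) :
    ‖toC (β t) - toC (β s)‖ ≤ Lg β * ‖t - s‖ := by
  have hd := h.1.differentiableOn one_ne_zero
  refine Convex.norm_image_sub_le_of_norm_hasDerivWithin_le (f := fun u => toC (β u))
    (f' := fun u => ((derivWithin (fun r => (β r).1) (Icc 0 1) u : ℝ) : ℂ) +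
      ((derivWithin (fun r => (β r).2) (Icc 0 1) u : ℝ) : ℂ) * Complex.I)
    (fun u hu => ?_) (fun u hu => ?_) (convex_Icc 0 1) hs ht
  · have h1 : HasDerivWithinAt (fun r => (β r).1) _ (Icc 0 1) u :=
      (hd u hu).fst.hasDerivWithinAt
    have h2 : HasDerivWithinAt (fun r => (β r).2) _ (Icc 0 1) u :=
      (hd u hu).snd.hasDerivWithinAt
    exact h1.ofReal_comp.add (h2.ofReal_comp.mul_const _)
  · rw [Complex.norm_add_mul_I]
    exact (h.2.2.2.2.2.1 u hu).le

theorem _root_.MemC.length_pos {x0 y0 : ℝ} (hx : 0 < x0) (hy : 0 < y0) {β : ℝ → ℝ × ℝ}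
    (h : MemC x0 y0 β) : 0 < Lg β := by
  have h01 : (0:ℝ) ∈ Icc (0:ℝ) 1 := ⟨le_rfl, zero_le_one⟩
  have h11 : (1:ℝ) ∈ Icc (0:ℝ) 1 := ⟨zero_le_one, le_rfl⟩
  have h0 : 0 ≤ Lg β := by
    rw [← h.2.2.2.2.2.1 0 h01]
    exact gSpeedOn_nonneg _ _ _
  refine h0.lt_of_ne' fun hL => ?_
  have h1 := h.norm_sub_le h01 h11
  rw [hL, zero_mul, norm_le_zero_iff, sub_eq_zero] at h1
  have h2 : (β 1).1 = x0 := by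
    have := congrArg Complex.re h1
    rwa [toC_re, toC_re, h.2.1] at this
  have h3 : (β 1).2 = y0 := by
    have := congrArg Complex.im h1
    rwa [toC_im, toC_im, h.2.1] at this
  rcases h.2.2.2.1.2 with h4 | h4 <;> linarith

/-- The arclength parametrization of a curve in the class `𝒞` is admissible. -/
theorem _root_.MemC.exists_adm {n : ℕ} {cn p x0 y0 : ℝ} (hcn : 0 ≤ cn) (hp : 0 ≤ p)
    (hx : 0 < x0) (hy : 0 < y0) {β : ℝ → ℝ × ℝ} (h : MemC x0 y0 β) :
    ∃ T γ, Adm n cn p (lambdaG n cn p β) quad bdry ⟨x0, y0⟩ T γ := by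
  have hL := h.length_pos hx hy
  set L := Lg β with hLd
  have hpm : ∀ τ, (projIcc (0:ℝ) 1 zero_le_one (L⁻¹ * τ) : ℝ) ∈ Icc (0:ℝ) 1 :=
    fun τ => Subtype.coe_prop _
  set γ : ℝ → ℂ := fun τ => toC (β (projIcc (0:ℝ) 1 zero_le_one (L⁻¹ * τ))) with hγ
  have hγL : ∀ t ∈ Icc (0:ℝ) 1, γ (L * t) = toC (β t) := fun t ht => by
    have : L⁻¹ * (L * t) = t := by field_simp
    simp only [hγ]
    rw [this, projIcc_of_mem _ ht]
  have hlip : LipschitzWith 1 γ := by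
    refine LipschitzWith.of_dist_le_mul fun s t => ?_
    have h1 := ((LipschitzWith.projIcc (a := (0:ℝ)) zero_le_one).comp
      (lipschitzWith_mul_left (inv_nonneg.2 hL.le))).dist_le_mul s t
    rw [one_mul, Real.coe_toNNReal _ (inv_nonneg.2 hL.le)] at h1
    rw [NNReal.coe_one, one_mul, dist_eq_norm]
    refine (h.norm_sub_le (hpm t) (hpm s)).trans ?_
    rw [← le_div_iff₀' hL, div_eq_inv_mul]
    exact h1
  refine ⟨L, γ, hlip, ?_, fun t => ?_, hL.le, ?_, ?_⟩
  · have := hγL 0 ⟨le_rfl, zero_le_one⟩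
    rw [mul_zero] at this
    rw [this, h.2.1]
    apply Complex.ext <;> simp
  · have := h.mem_Pset (hpm t)
    exact ⟨by simpa [hγ] using this.1, by simpa [hγ] using this.2⟩
  · have := hγL 1 ⟨zero_le_one, le_rfl⟩
    rw [mul_one] at this
    rw [this]
    have h1 := h.2.2.2.1
    refine ⟨⟨by simpa using h1.1.1, by simpa using h1.1.2⟩, ?_⟩
    rw [toC_re, toC_im]
    exact mul_eq_zero.2 h1.2
  · refine hardy_lambdaG hp hcn hL h.2.2.2.2.2.1 (fun t ht => h.mem_Pset ht)
      ((continuous_weight n cn).comp hlip.continuous) fun t ht => ?_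
    rw [hγL t ht, weight_toC]

theorem gSpeed_simonsCurve {R : ℝ} (hR : 0 ≤ R) {t : ℝ} (ht : t ∈ Icc (0:ℝ) 1) :
    gSpeed (simonsCurve R) t = √2 * R := by
  have h1 : HasDerivWithinAt (fun u : ℝ => (1 - u) * R) (-1 * R) (Icc 0 1) t :=
    (((hasDerivAt_id t).const_sub 1).mul_const R).hasDerivWithinAt
  have h2 := h1.derivWithin (uniqueDiffOn_Icc zero_lt_one t ht)
  simp only [gSpeed, gSpeedOn, simonsCurve, h2]
  rw [show (-1 * R) ^ 2 + (-1 * R) ^ 2 = 2 * R ^ 2 by ring, Real.sqrt_mul (by norm_num),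
    Real.sqrt_sq hR]

theorem lambdaG_simonsCurve_nonneg (n : ℕ) {cn : ℝ} (p : ℝ) {R : ℝ} (hcn : 0 ≤ cn) (hR : 0 ≤ R) :
    0 ≤ lambdaG n cn p (simonsCurve R) := by
  refine lambdaG_nonneg hcn fun t ht => ?_
  have := mul_nonneg (sub_nonneg.2 ht.2) hR
  exact ⟨this, this⟩

theorem Hardy.le_lambdaG_simonsCurve {n : ℕ} {cn p R lam : ℝ} (hp : 0 ≤ p) (hcn : 0 < cn)
    (hR : 0 < R) (h : Hardy p lam (√2 * R) (fun τ => weight n cn (diagCurve R τ))) :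
    lam ≤ lambdaG n cn p (simonsCurve R) := by
  have h2 : (√2 : ℝ) ≠ 0 := by positivity
  refine h.le_lambdaG hp hcn (by positivity) (fun t ht => gSpeed_simonsCurve hR.le ht)
    (fun t ht => ?_) ?_ fun t ht => ?_
  · have := mul_pos (sub_pos.2 ht.2) hR
    exact ⟨this, this⟩
  · simp only [weight, diagCurve]
    fun_prop
  · simp only [weight, diagCurve, Fvol, simonsCurve]
    have : R - √2 * R * t / √2 = (1 - t) * R := by field_simp
    rw [this]

/-- A minimal curve ending orthogonally on the horizontal axis is, after rescaling time, a curve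
of the class `𝒞`. -/
theorem Mini.exists_memC {n : ℕ} {cn p lam R T : ℝ} {γ : ℝ → ℂ}
    (hn : 1 ≤ n) (hcn : 0 < cn) (hp : 2 ≤ p) (hlam : 0 ≤ lam)
    (h : Mini n cn p lam quad bdry ⟨R, R⟩ T γ) (hT : 0 < T) (hT0 : (γ T).im = 0)
    (hTx : 0 < (γ T).re) :
    ∃ α, MemC R R α ∧ Lg α = T ∧ ∀ t ∈ Icc (0:ℝ) 1, toC (α t) = γ (T * t) := by
  obtain ⟨D, hDc, hDγ, hD1, hDT⟩ := h.exists_continuous_deriv hn hcn hp hlam hT hT0 hTx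
  set G : ℝ → ℂ := fun t => ⟨R, R⟩ + ∫ r in (0:ℝ)..t, D r with hG
  have hGd : ∀ t, HasDerivAt G (D t) t := fun t =>
    (intervalIntegral.integral_hasDerivAt_right (hDc.intervalIntegrable _ _)
      (hDc.stronglyMeasurableAtFilter _ _) hDc.continuousAt).const_add _
  set H : ℝ → ℂ := fun t => G (T * t) with hH
  have hHd : ∀ t, HasDerivAt H (T * D (T * t)) t := fun t => by
    have h1 : HasDerivAt (fun t : ℝ => T * t) (T * 1) t := (hasDerivAt_id t).const_mul T
    have := (hGd (T * t)).scomp t h1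
    rw [mul_one] at this
    simpa [Function.comp_def] using this
  have hre : ∀ t, HasDerivAt (fun s => (H s).re) (T * (D (T * t)).re) t := fun t => by
    have h1 := Complex.reCLM.hasFDerivAt.comp_hasDerivAt t (hHd t)
    have h2 : Complex.reCLM (T * D (T * t)) = T * (D (T * t)).re := by simp
    rw [h2] at h1
    exact h1
  have him : ∀ t, HasDerivAt (fun s => (H s).im) (T * (D (T * t)).im) t := fun t => by
    have h1 := Complex.imCLM.hasFDerivAt.comp_hasDerivAt t (hHd t)
    have h2 : Complex.imCLM (T * D (T * t)) = T * (D (T * t)).im := by simp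
    rw [h2] at h1
    exact h1
  set α : ℝ → ℝ × ℝ := fun t => ((H t).re, (H t).im) with hα
  have hTm : ∀ t ∈ Icc (0:ℝ) 1, T * t ∈ Icc 0 T := fun t ht =>
    ⟨mul_nonneg hT.le ht.1, mul_le_of_le_one_right hT.le ht.2⟩
  have hαγ : ∀ t ∈ Icc (0:ℝ) 1, toC (α t) = γ (T * t) := fun t ht => by
    rw [hDγ _ (hTm t ht)]
    apply Complex.ext <;> simp [hα, hH, hG]
  have hα1 : ∀ t ∈ Icc (0:ℝ) 1, (α t).1 = (γ (T * t)).re := fun t ht => by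
    rw [← hαγ t ht, toC_re]
  have hα2 : ∀ t ∈ Icc (0:ℝ) 1, (α t).2 = (γ (T * t)).im := fun t ht => by
    rw [← hαγ t ht, toC_im]
  have h01 : (0:ℝ) ∈ Icc (0:ℝ) 1 := ⟨le_rfl, zero_le_one⟩
  have h11 : (1:ℝ) ∈ Icc (0:ℝ) 1 := ⟨zero_le_one, le_rfl⟩
  have hu := uniqueDiffOn_Icc (zero_lt_one (α := ℝ))
  have hsp : ∀ t ∈ Icc (0:ℝ) 1, gSpeed α t = T := fun t ht => by
    have e1 := ((hre t).hasDerivWithinAt (s := Icc 0 1)).derivWithin (hu t ht)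
    have e2 := ((him t).hasDerivWithinAt (s := Icc 0 1)).derivWithin (hu t ht)
    have e3 := hD1 _ (hTm t ht)
    have e4 := normSq_sub_eq (D (T * t)) 0
    simp only [sub_zero, e3, Complex.zero_re, Complex.zero_im] at e4
    simp only [gSpeed, gSpeedOn, hα, e1, e2]
    rw [show (T * (D (T * t)).re) ^ 2 + (T * (D (T * t)).im) ^ 2 = T ^ 2 by
      linear_combination -T ^ 2 * e4, Real.sqrt_sq hT.le]
  have hLg : Lg α = T := by
    rw [Lg, intervalIntegral.integral_congr (g := fun _ => T)]
    · simp
    · intro t ht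
      rw [uIcc_of_le zero_le_one] at ht
      exact hsp t ht
  have hα1T : (α 1).1 = (γ T).re := by rw [hα1 1 h11, mul_one]
  have hα2T : (α 1).2 = 0 := by rw [hα2 1 h11, mul_one, hT0]
  refine ⟨α, ⟨?_, ?_, fun t ht => ?_, ⟨⟨?_, hα2T.ge⟩, Or.inr hα2T⟩, fun h0 => ?_, fun t ht => ?_,
    fun h0 => ?_, fun _ => ?_⟩, hLg, hαγ⟩
  · refine ContDiff.contDiffOn ?_
    have c1 : ContDiff ℝ 1 fun t => (H t).re := by
      rw [contDiff_one_iff_deriv]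
      refine ⟨fun t => (hre t).differentiableAt, ?_⟩
      rw [funext fun t => (hre t).deriv]
      exact continuous_const.mul (Complex.continuous_re.comp (hDc.comp (by fun_prop)))
    have c2 : ContDiff ℝ 1 fun t => (H t).im := by
      rw [contDiff_one_iff_deriv]
      refine ⟨fun t => (him t).differentiableAt, ?_⟩
      rw [funext fun t => (him t).deriv]
      exact continuous_const.mul (Complex.continuous_im.comp (hDc.comp (by fun_prop)))
    exact c1.prodMk c2
  · have h0 := hα1 0 h01
    have h1 := hα2 0 h01
    rw [mul_zero, h.start] at h0 h1
    exact Prod.ext h0 h1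
  · have ht' : t ∈ Icc (0:ℝ) 1 := ⟨ht.1, ht.2.le⟩
    obtain ⟨h1, h2⟩ := h.coord_pos hcn.le (by linarith) hlam (t := T * t) (hTm t ht').1
      (mul_lt_of_lt_one_right hT ht.2)
    refine ⟨?_, ?_⟩
    · rw [hα1 t ht']; exact h1
    · rw [hα2 t ht']; exact h2
  · rw [hα1T]; exact hTx.le
  · rw [h0] at hα1T
    exact hTx.ne hα1T
  · rw [hsp t ht, hLg]
  · rw [h0] at hα1T
    exact absurd hα1T hTx.ne
  · have e1 := ((hre 1).hasDerivWithinAt (s := Icc 0 1)).derivWithin (hu 1 h11)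
    simp only [hα, e1, mul_one, hDT]
    simp

end QuarterPlane

/-- For `n ≥ 2`, `p ≥ 2n-1`, `x₀ = y₀ = R > 0`, if Simons' cone
does not maximize `λ_{1,p}` (i.e. `λ_{1,p}(σ) < sup{λ_{1,p}(β) : β ∈ 𝒞}`), then
there is a simple curve `α ∈ 𝒞` maximizing `λ_{1,p}` over `𝒞`. -/
theorem simons_stmt1 (n : ℕ) (hn : 2 ≤ n) (cn : ℝ) (hcn : 0 < cn)
    (p : ℝ) (hp : 2 * (n : ℝ) - 1 ≤ p) (R : ℝ) (hR : 0 < R)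
    (hcone : ∃ β : ℝ → ℝ × ℝ, MemC R R β ∧
      lambdaG n cn p (simonsCurve R) < lambdaG n cn p β) :
    ∃ α : ℝ → ℝ × ℝ, MemC R R α ∧ InjOn α (Icc 0 1) ∧
      ∀ β : ℝ → ℝ × ℝ, MemC R R β → lambdaG n cn p β ≤ lambdaG n cn p α := by
  obtain ⟨β₀, hβ₀, hlt⟩ := hcone
  have hn2 : (2:ℝ) ≤ n := by exact_mod_cast hn
  have hp0 : 0 ≤ p := by linarith
  have hp2 : 2 ≤ p := by linarith
  have hσ := QuarterPlane.lambdaG_simonsCurve_nonneg n p hcn.le hR.le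
  obtain ⟨δ, η, lam, T, γ, t1, hδ, hη, hl, hm, hF, hmax⟩ :=
    QuarterPlane.exists_maximal (by omega) hcn hp2 hR (hσ.trans_lt hlt)
      (hβ₀.exists_adm hcn.le hp0 hR hR) fun h =>
        (h.le_lambdaG_simonsCurve hp0 hcn hR).not_gt hlt
  have hlam : 0 ≤ lam := (hσ.trans hlt.le).trans hl
  have hT : 0 < T := hR.trans_le hm.toAdm.le_time
  have hTx : 0 < (γ T).re :=
    (Real.sqrt_pos.2 (by linarith)).trans_le (hF.sqrt_le hm.mem hF.le)
  obtain ⟨α, hα, hLα, hαγ⟩ := hm.exists_memC (by omega) hcn hp2 hlam hT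
    (hF.im_eq_zero hη hm.mem hm.fin) hTx
  refine ⟨α, hα, fun s hs t ht hst => ?_, fun β hβ => ?_⟩
  · have h1 := congrArg QuarterPlane.toC hst
    rw [hαγ s hs, hαγ t ht] at h1
    have h2 := hm.injOn hcn.le (by linarith) hlam subset_rfl
      ⟨mul_nonneg hT.le hs.1, mul_le_of_le_one_right hT.le hs.2⟩
      ⟨mul_nonneg hT.le ht.1, mul_le_of_le_one_right hT.le ht.2⟩ h1
    exact mul_left_cancel₀ hT.ne' h2
  · obtain ⟨T', γ', hA⟩ := hβ.exists_adm (n := n) (p := p) hcn.le hp0 hR hR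
    refine (hmax _ T' γ' (QuarterPlane.lambdaG_nonneg hcn.le fun t ht => hβ.mem_Pset ht) hA).trans
      (hm.hardy.le_lambdaG hp0 hcn hT (fun t ht => ?_) hα.2.2.1
        ((QuarterPlane.continuous_weight n cn).comp hm.lip.continuous) fun t ht => ?_)
    · rw [hα.2.2.2.2.2.1 t ht, hLα]
    · rw [Function.comp_apply, ← hαγ t ht, QuarterPlane.weight_toC]
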